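/- First symmetry relation of the Griffiths polynomials of q-Racah type (exchange of variables): for all nonnegative integers i, j, x, y with i+j ≤ N and x+y ≤ N, one has G_{i,j}(x,y;c₁,c₂,c₃,c₄;N) = (c₀/c₁)^{i/2}(c₃/c₁)^{j/2}(c₁/c₀)^{x/2}(c₁/c₄)^{y/2}·[ξ_i(c₂,c₃)ξ_j(c₀,c₄)/(ξ_x(c₂,c₄)ξ_y(c₀,c₃))]·[ω_j(c₀c₂c₄/c₁)/ω_i(c₃c₀c₂/c₁)]·ω_N(qc₁c₂c₃)·Ĝ_{i,j}(y,x), where Ĝ_{i,j}(y,x) denotes the Griffiths polynomial G_{i,j}(y,x;c₁⁻¹,c₃⁻¹,c₂⁻¹,c₀⁻¹;N) built with base q⁻¹ (chosen square root s⁻¹) and parameters c₁⁻¹,c₃⁻¹,c₂⁻¹,c₀⁻¹ (chosen square roots t₁⁻¹,t₃⁻¹,t₂⁻¹,t₀⁻¹); the induced fifth parameter for Ĝ is then c₄⁻¹. -/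

import Mathlib

noncomputable section
namespace qR

/-- q-Pochhammer symbol `(a;q)_k = ∏_{l<k} (1 - a qˡ)`. -/
def poch (q a : ℂ) (k : ℕ) : ℂ := ∏ l ∈ Finset.range k, (1 - a * q ^ l)

/-- q-binomial coefficient, zero outside `0 ≤ n ≤ N`. -/
def binom (q : ℂ) (N n : ℤ) : ℂ :=
  if 0 ≤ n ∧ n ≤ N then poch q q N.toNat / (poch q q n.toNat * poch q q (N - n).toNat) else 0

/-- Normalisation `Ω(n;J,O,o;N)`; `s` and `t2` are the chosen square roots of `q` and `O`,
so that `(q O)^(n - N/2) = (s t2)^(2n - N)`. -/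
def Om (q s J O o t2 : ℂ) (N n : ℤ) : ℂ :=
  binom q N n * (1 - O * o * q ^ (2 * n + 1)) * poch q (q * O) n.toNat
      * poch q (J * O * o * q ^ (N + 2)) n.toNat * poch q (q * J) (N - n).toNat
    / ((s * t2) ^ (2 * n - N) * poch q (O * o * q ^ (n + 1)) (N + 1).toNat
        * poch q (q * o) n.toNat)

/-- Normalised q-Racah polynomial `p_n(x;J,O,o;N)`, with the convention that it
vanishes unless `0 ≤ n ≤ N` and `0 ≤ x ≤ N`. -/
def p (q s J O o t2 : ℂ) (N n x : ℤ) : ℂ :=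
  if 0 ≤ n ∧ n ≤ N ∧ 0 ≤ x ∧ x ≤ N then
    Om q s J O o t2 N n *
      ∑ k ∈ Finset.range (n.toNat + 1),
        poch q (q ^ (-n)) k * poch q (O * o * q ^ (n + 1)) k * poch q (q ^ (-x)) k
            * poch q (J * O * q ^ (x + 1)) k * q ^ k
          / (poch q (q * O) k * poch q (J * O * o * q ^ (N + 2)) k
              * poch q (q ^ (-N)) k * poch q q k)
  else 0

/-- `ω_n(c) = (-1)^n c^{n/2} q^{n(n+1)/2}`, where `r` is the chosen square root of `c`. -/
def om (q r : ℂ) (n : ℤ) : ℂ := (-1 : ℂ) ^ n * r ^ n * q ^ (n * (n + 1) / 2)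

/-- `ξ_n(J,O) = ((qc1;q)_n/(qc2;q)_n) (O/J)^{n/2}`, where `t1, t2` are the chosen
square roots of `J, O`. -/
def xi (q J O t1 t2 : ℂ) (n : ℤ) : ℂ :=
  poch q (q * J) n.toNat / poch q (q * O) n.toNat * (t2 / t1) ^ n

/-- `λ(x;c) = -(1-q^{-x})(1-c q^{x+1})`. -/
def lam (q c : ℂ) (x : ℤ) : ℂ := -(1 - q ^ (-x)) * (1 - c * q ^ (x + 1))

def PhiP (q J O o : ℂ) (N n : ℤ) : ℂ :=
  -O * q ^ (n - N) * (1 - q ^ n) * (1 - J * q ^ (N - n + 1)) * (1 - O * o * q ^ (n + N + 1))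
      * (1 - o * q ^ n)
    / ((1 - O * o * q ^ (2 * n)) * (1 - O * o * q ^ (2 * n + 1)))

def PhiM (q J O o : ℂ) (N n : ℤ) : ℂ :=
  (1 - q ^ (n - N)) * (1 - J * O * o * q ^ (n + N + 2)) * (1 - O * q ^ (n + 1))
      * (1 - O * o * q ^ (n + 1))
    / ((1 - O * o * q ^ (2 * n + 1)) * (1 - O * o * q ^ (2 * n + 2)))

/-- `Φ^ε(n;J,O,o;N)`, where `ε = 1, -1, 0` selects `Φ⁺, Φ⁻, Φ⁰`. -/
def Phi (q J O o : ℂ) (N ε n : ℤ) : ℂ :=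
  if ε = 1 then PhiP q J O o N n
  else if ε = -1 then PhiM q J O o N n
  else -PhiP q J O o N n - PhiM q J O o N n

/-- `λ₊(x;J,O,o;N)`. -/
def lamP (q J O o : ℂ) (N x : ℤ) : ℂ :=
  -(q ^ (-N - 1) / o - q ^ (-x)) * (1 - J * O * o * q ^ (N + x + 2))

/-- `λ₋(x;J,O,o;N)`. -/
def lamM (q J O o : ℂ) (N x : ℤ) : ℂ :=
  -(q ^ (-N) - q ^ (-x)) * (1 - J * O * q ^ (N + x + 1))

def PhiPp (q sq J O o : ℂ) (N n : ℤ) : ℂ :=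
  -sq * O * q ^ (2 * n - N - 1) * (1 - q ^ n) * (1 - J * q ^ (N - n + 1))
      * (1 - J * q ^ (N + 2 - n)) * (1 - o * q ^ n)
    / ((1 - O * o * q ^ (2 * n)) * (1 - O * o * q ^ (2 * n + 1)))

def PhiPm (q sq J O o : ℂ) (N n : ℤ) : ℂ :=
  -((1 - J * O * o * q ^ (n + N + 2)) * (1 - J * O * o * q ^ (n + N + 3))
      * (1 - O * q ^ (n + 1)) * (1 - O * o * q ^ (n + 1)))
    / (o * q ^ (N + 1) * sq * (1 - O * o * q ^ (2 * n + 1)) * (1 - O * o * q ^ (2 * n + 2)))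

def PhiP0 (q sq J O o : ℂ) (N n : ℤ) : ℂ :=
  -PhiPp q sq J O o N n - PhiPm q sq J O o N n
    - (1 - J * O * q ^ (N + 2)) * (1 - J * O * o * q ^ (N + 2)) / (o * q ^ (N + 1) * sq)

def PhiMp (q sq J O o : ℂ) (N n : ℤ) : ℂ :=
  -sq * (1 - q ^ n) * (1 - o * q ^ n) * (1 - O * o * q ^ (n + N))
      * (1 - O * o * q ^ (n + N + 1))
    / (q ^ N * (1 - O * o * q ^ (2 * n)) * (1 - O * o * q ^ (2 * n + 1)))

def PhiMm (q sq J O o : ℂ) (N n : ℤ) : ℂ :=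
  -o * sq * q ^ N * (1 - q ^ (n - N)) * (1 - q ^ (n - N + 1)) * (1 - O * q ^ (n + 1))
      * (1 - O * o * q ^ (n + 1))
    / ((1 - O * o * q ^ (2 * n + 1)) * (1 - O * o * q ^ (2 * n + 2)))

def PhiM0 (q sq J O o : ℂ) (N n : ℤ) : ℂ :=
  -PhiMp q sq J O o N n - PhiMm q sq J O o N n - sq * (1 - o * q ^ N) * (q ^ (-N) - 1)

/-- Contiguity coefficient `Φ_σ^ε(n;J,O,o;N)`, where `σ = 1` is the `+` and `σ = -1`
the `-` family, `ε ∈ {1,0,-1}` selects the superscript, and `sq` is the chosen square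
root of `q O`. -/
def PhiC (q sq J O o : ℂ) (σ ε N n : ℤ) : ℂ :=
  if σ = 1 then
    if ε = 1 then PhiPp q sq J O o N n
    else if ε = -1 then PhiPm q sq J O o N n
    else PhiP0 q sq J O o N n
  else
    if ε = 1 then PhiMp q sq J O o N n
    else if ε = -1 then PhiMm q sq J O o N n
    else PhiM0 q sq J O o N n

def Fp (q J O : ℂ) (x : ℤ) : ℂ :=
  J * O ^ 2 * q ^ (x + 1) * (1 - J * q ^ x) * (1 - q ^ x)
    / ((1 - J * O * q ^ (2 * x)) * (1 - J * O * q ^ (2 * x + 1)))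

def Fm (q J O : ℂ) (x : ℤ) : ℂ :=
  J * O * q ^ (x + 1) * (1 - O * q ^ (x + 1)) * (1 - J * O * q ^ (x + 1))
    / ((1 - J * O * q ^ (2 * x + 1)) * (1 - J * O * q ^ (2 * x + 2)))

/-- The coefficients `A^{ε,ε'}_{i,j}(J,O,o,F;N)` for `(ε,ε') ≠ (0,0)`;
`t2` is the chosen square root of `O` and the fifth parameter
`L = (q^{2N+3} J O o F)⁻¹` is computed internally. -/
def Aaux (q s J O o F t2 : ℂ) (N ε ε' i j : ℤ) : ℂ :=
  if ε' = 1 ∨ ε' = -1 then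
    -o * q ^ (N + 1) *
        (if ε' = 1 then Fp q F ((q ^ (2 * N + 3) * J * O * o * F)⁻¹) j
         else Fm q F ((q ^ (2 * N + 3) * J * O * o * F)⁻¹) j) *
        PhiC q (s * t2) J O o ε' ε (N - j) i
  else if ε = 1 ∨ ε = -1 then
    o * q ^ (N + 1) *
        (Fp q F ((q ^ (2 * N + 3) * J * O * o * F)⁻¹) j
          + Fm q F ((q ^ (2 * N + 3) * J * O * o * F)⁻¹) j) *
        Phi q J O o (N - j) ε i
  else 0

/-- The coefficients `A^{ε,ε'}_{i,j}(J,O,o,F;N)`. -/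
def A (q s J O o F t2 : ℂ) (N ε ε' i j : ℤ) : ℂ :=
  if ε = 0 ∧ ε' = 0 then
    -((1 - o * q ^ (N + 1 - j)) * (s * t2) / (1 - J * O * q ^ (N + 2 - j)))
          * ∑ e ∈ ({-1, 0, 1} : Finset ℤ), Aaux q s J O o F t2 N e 1 i j
      - (1 - J * O * q ^ (N + 1 - j)) / ((1 - o * q ^ (N - j)) * (s * t2))
          * ∑ e ∈ ({-1, 0, 1} : Finset ℤ), Aaux q s J O o F t2 N e (-1) i j
      - ∑ e ∈ ({-1, 1} : Finset ℤ), Aaux q s J O o F t2 N e 0 i j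
  else Aaux q s J O o F t2 N ε ε' i j

/-- `Λ(x;J,O,o,F;N)`; `s, t1, t2, t3, t4` are the chosen square roots of
`q, J, O, o, F`. -/
def Lam (q s J O o F t1 t2 t3 t4 : ℂ) (N x : ℤ) : ℂ :=
  (-1 : ℂ) ^ x * binom q N x * (1 - J * O * q ^ (2 * x + 1)) * poch q (q * O) x.toNat
      * (s * t2) ^ N * (t1 * t3 / (t2 * t4)) ^ x * q ^ (x * (x - 1) / 2)
    / (poch q (q * J) x.toNat * poch q (q ^ (x + 1) * J * O) (N + 1).toNat)

/-- Tratnik polynomial of q-Racah type `T_{i,j}(x,y;J,O,o,F;N)`; the fifth parameter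
`L = (q^{2N+3} J O o F)⁻¹` and its square root `t0 = (s^{2N+3} t1 t2 t3 t4)⁻¹`
are computed internally. -/
def T (q s J O o F t1 t2 t3 t4 : ℂ) (N i j x y : ℤ) : ℂ :=
  if 0 ≤ i ∧ 0 ≤ j ∧ i + j ≤ N then
    p q s J O o t2 (N - j) i x *
      p q s o ((q ^ (2 * N + 3) * J * O * o * F)⁻¹) F
        ((s ^ (2 * N + 3) * t1 * t2 * t3 * t4)⁻¹) (N - x) j y
  else 0

/-- Griffiths polynomial of q-Racah type `G_{i,j}(x,y;J,O,o,F;N)`; the fifth parameter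
`L = (q^{2N+3} J O o F)⁻¹` and its square root `t0 = (s^{2N+3} t1 t2 t3 t4)⁻¹`
are computed internally. -/
def G (q s J O o F t1 t2 t3 t4 : ℂ) (N i j x y : ℤ) : ℂ :=
  if 0 ≤ i ∧ 0 ≤ j ∧ i + j ≤ N then
    ∑ a ∈ Finset.range ((min (N - j) (N - y)).toNat + 1),
      om q (t1 * t2 * t3 / t4) (a : ℤ) * p q s J O o t2 (N - j) i (a : ℤ) *
        p q s o ((q ^ (2 * N + 3) * J * O * o * F)⁻¹) F
          ((s ^ (2 * N + 3) * t1 * t2 * t3 * t4)⁻¹) (N - (a : ℤ)) j y *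
        p q s F O J t2 (N - y) (a : ℤ) x
  else 0

end qR

set_option linter.all false

namespace qR

theorem poch_zero (q a : ℂ) : poch q a 0 = 1 := by simp [poch]

theorem poch_succ (q a : ℂ) (k : ℕ) : poch q a (k+1) = poch q a k * (1 - a * q ^ k) := by
  simp [poch, Finset.prod_range_succ]

theorem poch_succ' (q a : ℂ) (k : ℕ) : poch q a (k+1) = (1 - a) * poch q (a*q) k := by
  simp only [poch, Finset.prod_range_succ', pow_zero, mul_one]
  rw [mul_comm]; congr 1; apply Finset.prod_congr rfl; intro l _; ring

theorem poch_shift (q a : ℂ) (k : ℕ) : poch q a k * (1 - a * q ^ k) = (1 - a) * poch q (a*q) k := by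
  rw [← poch_succ, poch_succ']

theorem poch_ne {q a : ℂ} {k : ℕ} (h : ∀ l < k, 1 - a * q ^ l ≠ 0) : poch q a k ≠ 0 := by
  simp only [poch, Finset.prod_ne_zero_iff, Finset.mem_range]; exact h

theorem poch_eq_zero {q a : ℂ} {k l : ℕ} (hl : l < k) (h : 1 - a * q ^ l = 0) : poch q a k = 0 :=
  Finset.prod_eq_zero (Finset.mem_range.2 hl) h

/-- truncated balanced 4phi3 -/
noncomputable def Fs (q : ℂ) (n : ℕ) (A B A' B' D E G : ℂ) : ℂ :=
  ∑ k ∈ Finset.range (n+1), poch q A k * poch q B k * poch q A' k * poch q B' k * q ^ k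
    / (poch q D k * poch q E k * poch q G k * poch q q k)

theorem tele (n : ℕ) (l r H H' : ℕ → ℂ) (h : ∀ k ≤ n, l k = r k + H' k - H k)
    (h0 : H 0 = 0) (hs : ∀ k < n, H' k = H (k+1)) (hn : H' n = 0) :
    ∑ k ∈ Finset.range (n+1), l k = ∑ k ∈ Finset.range (n+1), r k := by
  have key : ∀ m ≤ n, ∑ k ∈ Finset.range (m+1), l k = ∑ k ∈ Finset.range (m+1), r k + H' m := by
    intro m
    induction m with
    | zero => intro _; simp [h 0 (by omega), h0]
    | succ m ih =>
      intro hm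
      rw [Finset.sum_range_succ, ih (by omega), Finset.sum_range_succ _ (m+1), h (m+1) hm,
        hs m (by omega)]; ring
  rw [key n le_rfl, hn, add_zero]

/-- termwise contiguity -/
theorem FT (q : ℂ) (n : ℕ) (A1 B1 A B D E G : ℂ) (hAB : A ≠ B)
    (hD : ∀ k ≤ n, 1 - D * q ^ k ≠ 0) :
    Fs q n A1 B1 A B D E G =
      (1-B)*(A-D)/((A-B)*(1-D)) * Fs q n A1 B1 A (B*q) (D*q) E G
      + (1-A)*(B-D)/((B-A)*(1-D)) * Fs q n A1 B1 (A*q) B (D*q) E G := by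
  have h1 : 1 - D ≠ 0 := by simpa using hD 0 (by omega)
  have hs : A - B ≠ 0 := sub_ne_zero.2 hAB
  have hs' : B - A ≠ 0 := sub_ne_zero.2 (Ne.symm hAB)
  unfold Fs
  rw [Finset.mul_sum, Finset.mul_sum, ← Finset.sum_add_distrib]
  apply Finset.sum_congr rfl
  intro k hk
  have hk' : k ≤ n := by simpa [Nat.lt_succ_iff] using hk
  have hDk := hD k hk'
  have a1 := poch_shift q A k
  have b1 := poch_shift q B k
  have d1 := poch_shift q D k
  have hDD : poch q D k ≠ 0 := poch_ne (fun l hl => hD l (by omega))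
  have hDq : poch q (D*q) k ≠ 0 := by
    intro h; rw [h] at d1; simp [hDk, hDD] at d1
  have e : poch q A k * poch q B k / poch q D k =
    ((1-B)*(A-D)/((A-B)*(1-D)) * (poch q A k * poch q (B*q) k) +
     (1-A)*(B-D)/((B-A)*(1-D)) * (poch q (A*q) k * poch q B k)) / poch q (D*q) k := by
    have hB : (1-B) * poch q (B*q) k = poch q B k * (1 - B * q^k) := b1.symm
    have hA : (1-A) * poch q (A*q) k = poch q A k * (1 - A * q^k) := a1.symm
    have : (1-B)*(A-D)/((A-B)*(1-D)) * (poch q A k * poch q (B*q) k) +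
     (1-A)*(B-D)/((B-A)*(1-D)) * (poch q (A*q) k * poch q B k) =
      poch q A k * poch q B k * (1 - D*q^k) / (1-D) := by
      have : (1-B)*(A-D)/((A-B)*(1-D)) * (poch q A k * poch q (B*q) k) +
        (1-A)*(B-D)/((B-A)*(1-D)) * (poch q (A*q) k * poch q B k) =
        ((1-B) * poch q (B*q) k * (A-D) * poch q A k  -
        (1-A) * poch q (A*q) k * (B-D) * poch q B k) / ((A-B)*(1-D)) := by
        have : B - A = -(A-B) := by ring
        rw [this]; field_simp; ring
      rw [this, hA, hB]; field_simp; ring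
    rw [this, div_eq_div_iff hDD hDq, div_mul_eq_mul_div, eq_div_iff h1]
    linear_combination (-(poch q A k * poch q B k)) * d1
  calc _ = (poch q A k * poch q B k / poch q D k) * (poch q A1 k * poch q B1 k * q ^ k / (poch q E k * poch q G k * poch q q k)) := by ring
    _ = _ := by rw [e]; ring

end qR

namespace qR

theorem FII (q : ℂ) (n : ℕ) (A1 B1 a b D E G : ℂ) (hq : q ≠ 0) (hA1 : A1 ≠ 0) (hB1 : B1 ≠ 0)
    (ha : 1 - a ≠ 0) (hb : 1 - b ≠ 0) (hab : a ≠ b) (hD0 : D ≠ 0) (hE0 : E ≠ 0)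
    (hD : ∀ k < n, 1 - D * q ^ k ≠ 0) (hE : ∀ k < n, 1 - E * q ^ k ≠ 0)
    (hG : ∀ k ≤ n, 1 - G * q ^ k ≠ 0) (hqq : ∀ k < n, 1 - q * q ^ k ≠ 0)
    (hz : (1-A1*q^n)*(1-B1*q^n)*(1-a*q^n)*(1-b*q^n) = 0)
    (bal : A1*B1*a*b*q^2 = D*E*G) :
    (1-G/A1)*(1-G/B1)/(1-G) * Fs q n A1 B1 (a*q) (b*q) D E (G*q) =
      a*(b*q-D)*(b*q-E)/(D*E*(a-b)) * Fs q n A1 B1 (a*q) b D E G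
      + b*(a*q-D)*(a*q-E)/(D*E*(b-a)) * Fs q n A1 B1 a (b*q) D E G := by
  have h1 : 1 - G ≠ 0 := by simpa using hG 0 (by omega)
  have hs : a - b ≠ 0 := sub_ne_zero.2 hab
  have hs' : b - a ≠ 0 := sub_ne_zero.2 (Ne.symm hab)
  set τ : ℕ → ℂ := fun k => poch q A1 k * poch q B1 k * poch q a k * poch q b k /
    (poch q D k * poch q E k * poch q G k * poch q q k) with hτ
  set ρ := G/(A1*B1) with hρ
  unfold Fs
  simp only [Finset.mul_sum]
  rw [← Finset.sum_add_distrib]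
  apply tele n _ _ (fun k => ρ * τ k * (1-D*q^k/q)*(1-E*q^k/q)*(1-q^k)/((1-a)*(1-b)))
    (fun k => ρ * τ k * ((1-A1*q^k)*(1-B1*q^k)*(1-a*q^k)*(1-b*q^k))/((1-a)*(1-b)*(1-G*q^k)))
  · intro k hk
    have hGk := hG k hk
    have pa : poch q (a*q) k = poch q a k * (1-a*q^k)/(1-a) := by
      rw [eq_div_iff ha, poch_shift]; ring
    have pb : poch q (b*q) k = poch q b k * (1-b*q^k)/(1-b) := by
      rw [eq_div_iff hb, poch_shift]; ring
    have pG : poch q (G*q) k = poch q G k * (1-G*q^k)/(1-G) := by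
      rw [eq_div_iff h1, poch_shift]; ring
    have nD : poch q D k ≠ 0 := poch_ne (fun l hl => hD l (by omega))
    have nE : poch q E k ≠ 0 := poch_ne (fun l hl => hE l (by omega))
    have nG : poch q G k ≠ 0 := poch_ne (fun l hl => hG l (by omega))
    have nq : poch q q k ≠ 0 := poch_ne (fun l hl => hqq l (by omega))
    have eqs : ∀ (t X : ℂ), X ≠ 0 → 1 - G*X ≠ 0 →
      (1-G/A1)*(1-G/B1)*(t*((1-a*X)*(1-b*X)/((1-a)*(1-b))*X/(1-G*X))) =
       a*(b*q-D)*(b*q-E)/(D*E*(a-b)) * (t*((1-a*X)/(1-a)*X)) + b*(a*q-D)*(a*q-E)/(D*E*(b-a))*(t*((1-b*X)/(1-b)*X))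
       + ρ*t*((1-A1*X)*(1-B1*X)*(1-a*X)*(1-b*X))/((1-a)*(1-b)*(1-G*X)) - ρ*t*(1-D*X/q)*(1-E*X/q)*(1-X)/((1-a)*(1-b)) := by
      intro t X hX hGX
      have hGv : G = A1*B1*a*b*q^2/(D*E) := by rw [bal]; field_simp
      have hr : ρ = a*b*q^2/(D*E) := by rw [hρ, hGv]; field_simp
      have key : (1-G/A1)*(1-G/B1) = (1-G*X)*(1-ρ/X) + ρ/X*(1-A1*X)*(1-B1*X) := by
        rw [hρ]; field_simp; ring
      have key2 : (1-a*X)*(1-b*X)*(X-ρ)+ρ*(1-D*X/q)*(1-E*X/q)*(1-X) =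
         a*(b*q-D)*(b*q-E)/(D*E*(a-b))*(1-b)*(1-a*X)*X+b*(a*q-D)*(a*q-E)/(D*E*(b-a))*(1-a)*(1-b*X)*X := by
        rw [hr, show b - a = -(a-b) by ring]; field_simp; ring
      have : (1-G/A1)*(1-G/B1)*(t*((1-a*X)*(1-b*X)/((1-a)*(1-b))*X/(1-G*X))) =
         t/((1-a)*(1-b))*((1-a*X)*(1-b*X)*(X-ρ)) + ρ*t*((1-A1*X)*(1-B1*X)*(1-a*X)*(1-b*X))/((1-a)*(1-b)*(1-G*X)) := by
        rw [key]; field_simp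
      rw [this, eq_sub_of_add_eq key2]
      generalize a*(b*q-D)*(b*q-E)/(D*E*(a-b)) = w, b*(a*q-D)*(a*q-E)/(D*E*(b-a)) = z, ρ*((1-A1*X)*(1-B1*X)) = r1
      field_simp
      ring
    have := eqs (τ k) (q^k) (pow_ne_zero _ hq) hGk
    have e1 : (1-G/A1)*(1-G/B1)/(1-G) * (poch q A1 k * poch q B1 k * poch q (a*q) k * poch q (b*q) k * q ^ k
    / (poch q D k * poch q E k * poch q (G*q) k * poch q q k)) = (1-G/A1)*(1-G/B1)*(τ k*((1-a*q^k)*(1-b*q^k)/((1-a)*(1-b))*q^k/(1-G*q^k))) := by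
      rw [pa, pb, pG, hτ]
      generalize (1-G/A1)*(1-G/B1) = g
      field_simp
    have e2 : poch q A1 k * poch q B1 k * poch q (a*q) k * poch q b k * q ^ k
    / (poch q D k * poch q E k * poch q G k * poch q q k) = τ k*((1-a*q^k)/(1-a)*q^k) := by
      rw [pa, hτ]; field_simp
    have e3 : poch q A1 k * poch q B1 k * poch q a k * poch q (b*q) k * q ^ k
    / (poch q D k * poch q E k * poch q G k * poch q q k) = τ k*((1-b*q^k)/(1-b)*q^k) := by
      rw [pb, hτ]; field_simp
    rw [e1, e2, e3, this]
  · simp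
  · intro k hk
    have hGk := hG k hk.le
    have hDk := hD k hk
    have hEk := hE k hk
    have hqk := hqq k hk
    have hqk' : 1 - q^(k+1) ≠ 0 := by rw [pow_succ']; exact hqk
    have nD : poch q D k ≠ 0 := poch_ne (fun l hl => hD l (by omega))
    have nE : poch q E k ≠ 0 := poch_ne (fun l hl => hE l (by omega))
    have nG : poch q G k ≠ 0 := poch_ne (fun l hl => hG l (by omega))
    have nq : poch q q k ≠ 0 := poch_ne (fun l hl => hqq l (by omega))
    simp only [hτ, poch_succ]
    rw [show D * q^(k+1)/q = D*q^k by rw [pow_succ]; field_simp, show E * q^(k+1)/q = E*q^k by rw [pow_succ]; field_simp, show q^(k+1) = q*q^k by ring]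
    generalize 1 - G*q^k = g1, 1 - D*q^k = g2, 1 - E*q^k = g3, 1 - q*q^k = g4, 1 - a = g5, 1 - b = g6 at *
    field_simp
  · simp only [hz]; simp

set_option maxHeartbeats 1000000 in
theorem FBS (q : ℂ) (n : ℕ) (A1 B1 A2 B2 D E G : ℂ)
    (hA1 : 1 - A1 ≠ 0) (hB1 : 1 - B1 ≠ 0) (hA2 : A2 ≠ 0) (hB2 : B2 ≠ 0) (hAB : A2 ≠ B2)
    (hD : ∀ k ≤ n, 1 - D * q ^ k ≠ 0) (hE : ∀ k ≤ n, 1 - E * q ^ k ≠ 0)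
    (hG : ∀ k ≤ n, 1 - G * q ^ k ≠ 0) (hqq : ∀ k ≤ n, 1 - q * q ^ k ≠ 0)
    (hz : 1-A1*q^(n+1) = 0)
    (bal : A1*B1*A2*B2*q = D*E*G) :
    Fs q (n+1) A1 B1 A2 B2 D E G =
      (1-B2)*(A2-D)*(A2-E)*(A2-G)/(A2*(A2-B2)*((1-D)*(1-E)*(1-G))) *
        Fs q n (A1*q) (B1*q) A2 (B2*q) (D*q) (E*q) (G*q)
      + (1-A2)*(B2-D)*(B2-E)*(B2-G)/(B2*(B2-A2)*((1-D)*(1-E)*(1-G))) *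
        Fs q n (A1*q) (B1*q) (A2*q) B2 (D*q) (E*q) (G*q) := by
  have hs : A2 - B2 ≠ 0 := sub_ne_zero.2 hAB
  have hs' : B2 - A2 ≠ 0 := sub_ne_zero.2 (Ne.symm hAB)
  have d1 : 1 - D ≠ 0 := by simpa using hD 0 (by omega)
  have e1 : 1 - E ≠ 0 := by simpa using hE 0 (by omega)
  have g1 : 1 - G ≠ 0 := by simpa using hG 0 (by omega)
  have hz' : poch q (A1*q) (n+1) = 0 := poch_eq_zero (l := n) (by omega) (by rw [← hz]; ring)
  have ext : ∀ B A' B' D E G, Fs q n (A1*q) B A' B' D E G = Fs q (n+1) (A1*q) B A' B' D E G := by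
    intro B A' B' D E G
    unfold Fs
    rw [Finset.sum_range_succ _ (n+1), hz']; simp
  rw [ext, ext]
  set τ : ℕ → ℂ := fun k => poch q A1 k * poch q B1 k * poch q A2 k * poch q B2 k /
    (poch q D k * poch q E k * poch q G k * poch q q k) with hτ
  unfold Fs
  simp only [Finset.mul_sum]
  rw [← Finset.sum_add_distrib]
  apply tele (n+1) _ _ (fun k => τ k * (1-q^k)*(1-A1*B1*q^k)/((1-A1)*(1-B1)))
    (fun k => if k = n+1 then 0 else
      τ k * ((1-A1*q^k)*(1-B1*q^k)*(1-A2*q^k)*(1-B2*q^k)*(1-A1*B1*q*q^k))/((1-A1)*(1-B1)*((1-D*q^k)*(1-E*q^k)*(1-G*q^k))))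
  · intro k hk
    rcases Nat.lt_or_ge k (n+1) with hk1 | hk1
    · rw [if_neg (by omega)]
      have hDk := hD k (by omega)
      have hEk := hE k (by omega)
      have hGk := hG k (by omega)
      have pA : poch q (A1*q) k = poch q A1 k * (1-A1*q^k)/(1-A1) := by
        rw [eq_div_iff hA1, poch_shift]; ring
      have pB : poch q (B1*q) k = poch q B1 k * (1-B1*q^k)/(1-B1) := by
        rw [eq_div_iff hB1, poch_shift]; ring
      have pD : poch q (D*q) k = poch q D k * (1-D*q^k)/(1-D) := by
        rw [eq_div_iff d1, poch_shift]; ring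
      have pE : poch q (E*q) k = poch q E k * (1-E*q^k)/(1-E) := by
        rw [eq_div_iff e1, poch_shift]; ring
      have pG : poch q (G*q) k = poch q G k * (1-G*q^k)/(1-G) := by
        rw [eq_div_iff g1, poch_shift]; ring
      have nD : poch q D k ≠ 0 := poch_ne (fun l hl => hD l (by omega))
      have nE : poch q E k ≠ 0 := poch_ne (fun l hl => hE l (by omega))
      have nG : poch q G k ≠ 0 := poch_ne (fun l hl => hG l (by omega))
      have nq : poch q q k ≠ 0 := poch_ne (fun l hl => hqq l (by omega))
      have f (A B t : ℂ) (hA : A ≠ 0) (hs : A - B ≠ 0) (ht : t = poch q A1 k * poch q B1 k * poch q A k * poch q B k / (poch q D k * poch q E k * poch q G k * poch q q k)) : (1-B)*(A-D)*(A-E)*(A-G)/(A*(A-B)*((1-D)*(1-E)*(1-G))) *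
        (poch q (A1*q) k * poch q (B1*q) k * poch q A k * poch q (B*q) k * q ^ k
        / (poch q (D*q) k * poch q (E*q) k * poch q (G*q) k * poch q q k)) =
        t * q^k * ((1-A1*q^k)*(1-B1*q^k)/((1-A1)*(1-B1)*((1-D*q^k)*(1-E*q^k)*(1-G*q^k)))) * ((A-D)*(A-E)*(A-G)/(A*(A-B))*(1-B*q^k)) := by
        have b := poch_shift q B k
        rw [ht, pA, pB, pD, pE, pG]
        clear pA pB pD pE pG hz hz' ext hG hE hD hqq bal hτ hs' ht
        generalize A-D = x, A-E = y, A-G = z, poch q D k = p1, poch q E k = p2, poch q G k = p3, poch q q k = p4, 1 - G*q^k = g1, 1 - D*q^k = g2, 1 - E*q^k = g3, 1 - A1*q^k = g7, 1 - B1*q^k = g8, 1 - A1 = g5, 1 - B1 = g6, 1 - D = h5, 1 - E = h6, 1 - G = h7, A - B = h8 at *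
        field_simp
        linear_combination -poch q A1 k*g7*poch q B1 k*g8*poch q A k*q^k*x*y*z*b
      rw [f A2 B2 (τ k) hA2 hs rfl, mul_right_comm _ (poch q (A2*q) k), f B2 A2 (τ k) hB2 hs' (by rw [hτ]; ring)]
      have f0 : poch q A1 k * poch q B1 k * poch q A2 k * poch q B2 k * q ^ k
        / (poch q D k * poch q E k * poch q G k * poch q q k) = τ k * q^k := by rw [hτ]; ring
      rw [f0]
      generalize τ k = t
      generalize q^k = X at *
      have key : X*(1-A1)*(1-B1)*((1-D*X)*(1-E*X)*(1-G*X)) =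
         X*(1-A1*X)*(1-B1*X)*((A2-D)*(A2-E)*(A2-G)/(A2*(A2-B2))*(1-B2*X)+(B2-D)*(B2-E)*(B2-G)/(B2*(B2-A2))*(1-A2*X))
         + ((1-A1*X)*(1-B1*X)*(1-A2*X)*(1-B2*X)*(1-A1*B1*q*X)) - (1-X)*(1-A1*B1*X)*((1-D*X)*(1-E*X)*(1-G*X)) := by
        have hPq : A1*B1*q = D*E*G/(A2*B2) := by rw [← bal]; field_simp
        rw [hPq, show B2 - A2 = -(A2-B2) by ring]
        field_simp
        ring
      have key' : t*X = t/((1-A1)*(1-B1)*((1-D*X)*(1-E*X)*(1-G*X))) * (X*(1-A1)*(1-B1)*((1-D*X)*(1-E*X)*(1-G*X))) := by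
        rw [div_mul_eq_mul_div, eq_div_iff (mul_ne_zero (mul_ne_zero hA1 hB1) (mul_ne_zero (mul_ne_zero hDk hEk) hGk))]; ring
      refine key'.trans ?_
      rw [key]
      generalize (A2-D)*(A2-E)*(A2-G)/(A2*(A2-B2)) = g1, (B2-D)*(B2-E)*(B2-G)/(B2*(B2-A2)) = g2
      clear key key' f0 f bal
      generalize 1 - G*X = g1, 1 - D*X = g2, 1 - E*X = g3, 1 - A1 = g5, 1 - B1 = g6 at *
      field_simp
    · have hk2 : k = n+1 := by omega
      subst hk2
      simp only [hz', if_true]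
      have hX : A1 * q^(n+1) = 1 := by linear_combination -hz
      generalize q^(n+1) = X at *
      have hA0 : X ≠ 0 := by rintro rfl; simp at hX
      have : A1 = 1/X := by field_simp; exact hX
      have hx1 : 1 - 1/X ≠ 0 := this ▸ hA1
      have : (1-X)*(1-A1*B1*X)/((1-A1)*(1-B1)) = -X := by
        rw [show A1*B1*X = B1 by rw [this]; field_simp]
        rw [div_eq_iff (mul_ne_zero hA1 hB1)]
        linear_combination (-(1-B1))*hX
      rw [mul_assoc (τ (n+1)), mul_div_assoc (τ (n+1)), this, hτ]; simp; ring
  · simp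
  · intro k hk
    rw [if_neg (by omega)]
    have hDk := hD k (by omega)
    have hEk := hE k (by omega)
    have hGk := hG k (by omega)
    have hqk := hqq k (by omega)
    have nD : poch q D k ≠ 0 := poch_ne (fun l hl => hD l (by omega))
    have nE : poch q E k ≠ 0 := poch_ne (fun l hl => hE l (by omega))
    have nG : poch q G k ≠ 0 := poch_ne (fun l hl => hG l (by omega))
    have nq : poch q q k ≠ 0 := poch_ne (fun l hl => hqq l (by omega))
    simp only [hτ, poch_succ]
    rw [show q^(k+1) = q*q^k by ring, show A1*B1*(q*q^k) = A1*B1*q*q^k by ring]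
    generalize 1 - G*q^k = g1, 1 - D*q^k = g2, 1 - E*q^k = g3, 1 - q*q^k = g4, 1 - A1 = g5, 1 - B1 = g6, 1 - A1*q^k = g7, 1 - B1*q^k = g8, 1 - A2*q^k = g9, 1 - B2*q^k = g10, 1 - A1*B1*q*q^k = g11 at *
    field_simp
  · simp

end qR

namespace qR

theorem Fs_swap (q : ℂ) (n : ℕ) (A B A' B' D E G : ℂ) :
    Fs q n A B A' B' D E G = Fs q n A' B' A B D E G := by
  unfold Fs; apply Finset.sum_congr rfl; intro k _; congr 1; ring

theorem Fs_perm1 (q : ℂ) (n : ℕ) (A B A' B' D E G : ℂ) :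
    Fs q n A B A' B' D E G = Fs q n A B A' B' E D G := by
  unfold Fs; apply Finset.sum_congr rfl; intro k _; congr 1; ring

theorem Fs_perm2 (q : ℂ) (n : ℕ) (A B A' B' D E G : ℂ) :
    Fs q n A B A' B' D E G = Fs q n A B A' B' G E D := by
  unfold Fs; apply Finset.sum_congr rfl; intro k _; congr 1; ring

theorem Fs_trunc (q : ℂ) (m n : ℕ) (A B A' B' D E G : ℂ) (hmn : m ≤ n) (h : 1 - A * q^m = 0) :
    Fs q n A B A' B' D E G = Fs q m A B A' B' D E G := by
  unfold Fs
  symm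
  apply Finset.sum_subset
  · intro k hk; simp at *; omega
  · intro k _ hk
    have : poch q A k = 0 := poch_eq_zero (l := m) (by simp at hk; omega) h
    rw [this]; simp

noncomputable def Rc (q : ℂ) (n : ℕ) (U V W J O o : ℂ) : ℂ :=
  Fs q n U⁻¹ (O*o*q*U) V⁻¹ (J*O*q*V) (q*O) W⁻¹ (J*O*o*q^2*W)

theorem Rc_swap (q : ℂ) (n : ℕ) (U V W J O o : ℂ) :
    Rc q n U V W J O o = Rc q n V U W o O J := by
  unfold Rc; rw [Fs_swap]; congr 1 <;> ring

theorem Rc_truncU (q : ℂ) (m n : ℕ) (V W J O o : ℂ) (hq : q ≠ 0) (hmn : m ≤ n) :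
    Rc q n (q^m) V W J O o = Rc q m (q^m) V W J O o := by
  unfold Rc; apply Fs_trunc _ _ _ _ _ _ _ _ _ _ hmn
  rw [inv_mul_cancel₀ (pow_ne_zero _ hq), sub_self]

theorem Rc_truncV (q : ℂ) (m n : ℕ) (U W J O o : ℂ) (hq : q ≠ 0) (hmn : m ≤ n) :
    Rc q n U (q^m) W J O o = Rc q m U (q^m) W J O o := by
  rw [Rc_swap, Rc_truncU _ _ _ _ _ _ _ _ hq hmn, Rc_swap]

theorem Rc_sym (q : ℂ) (m n : ℕ) (W J O o : ℂ) (hq : q ≠ 0) :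
    Rc q m (q^m) (q^n) W J O o = Rc q n (q^n) (q^m) W o O J := by
  rcases le_total m n with h | h
  · rw [← Rc_truncU _ _ _ _ _ _ _ _ hq h, Rc_swap]
  · rw [Rc_truncV q n m _ _ _ _ _ hq h, Rc_swap]

theorem Rc_zeroU (q : ℂ) (n : ℕ) (V W J O o : ℂ) : Rc q n (q^0) V W J O o = 1 := by
  have : Rc q n (q^0) V W J O o = Rc q 0 (q^0) V W J O o := by
    unfold Rc; apply Fs_trunc _ _ _ _ _ _ _ _ _ _ (Nat.zero_le n); simp
  rw [this]; simp [Rc, Fs, poch_zero]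

theorem Rc_zeroV (q : ℂ) (n : ℕ) (U W J O o : ℂ) : Rc q n U (q^0) W J O o = 1 := by
  rw [Rc_swap, Rc_zeroU]

variable {q : ℂ}

theorem RBS (n : ℕ) (V W J O o : ℂ) (hq : q ≠ 0) (hV : V ≠ 0) (hW : W ≠ 0) (h1 : J ≠ 0) (h2 : O ≠ 0)
    (hU : 1 - q^(n+1) ≠ 0) (hB1 : 1 - O*o*q*q^(n+1) ≠ 0)
    (hVV : 1 - J*O*q*V^2 ≠ 0)
    (hD : ∀ k ≤ n, 1 - q*O * q ^ k ≠ 0) (hE : ∀ k ≤ n, 1 - W⁻¹ * q ^ k ≠ 0)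
    (hG : ∀ k ≤ n, 1 - J*O*o*q^2*W * q ^ k ≠ 0) (hqq : ∀ k ≤ n, 1 - q * q ^ k ≠ 0) :
    Rc q (n+1) (q^(n+1)) V W J O o =
      (1-J*O*q*V)*(1-q*O*V)*(W-V)*(1-J*O*o*q^2*W*V)
        /(V*(1-J*O*q*V^2)*(1-q*O)*(W-1)*(1-J*O*o*q^2*W)) *
        Rc q n (q^n) V (W/q) J (O*q) (o*q)
      + -(V-1)*q*O*(1-J*V)*(1-J*O*q*V*W)*(V-o*q*W)
        /(V*(1-J*O*q*V^2)*(1-q*O)*(W-1)*(1-J*O*o*q^2*W)) *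
        Rc q n (q^n) (V/q) (W/q) J (O*q) (o*q) := by
  have d1 : 1 - q*O ≠ 0 := by simpa using hD 0 (by omega)
  have e1 : 1 - W⁻¹ ≠ 0 := by simpa using hE 0 (by omega)
  have e2 : W - 1 ≠ 0 := by
    intro h; apply e1; rw [show W = 1 by linear_combination h]; simp
  have g1 : 1 - J*O*o*q^2*W ≠ 0 := by simpa using hG 0 (by omega)
  have hn : q^(n+1) ≠ 0 := pow_ne_zero _ hq
  have hn0 : q^n ≠ 0 := pow_ne_zero _ hq
  have e0 : V⁻¹ - J*O*q*V = (1 - J*O*q*V^2)/V := by field_simp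
  have e0' : J*O*q*V - V⁻¹ = -(1 - J*O*q*V^2)/V := by field_simp; ring
  have hAB : V⁻¹ ≠ J*O*q*V := by
    intro h; rw [← sub_eq_zero, e0] at h; simp [hVV, hV] at h
  have := FBS q n (q^(n+1))⁻¹ (O*o*q*q^(n+1)) V⁻¹ (J*O*q*V) (q*O) W⁻¹ (J*O*o*q^2*W)
    (by intro h; apply hU; have : (q^(n+1))⁻¹ = 1 := by linear_combination -h
        rw [inv_eq_one] at this; rw [this]; ring)
    hB1 (inv_ne_zero hV) (by simp [h1,h2,hq,hV]) hAB hD hE hG hqq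
    (by rw [inv_mul_cancel₀ hn, sub_self]) (by field_simp)
  unfold Rc
  rw [this]
  have c1' : (1 - J*O*q*V)*(V⁻¹ - q*O)*(V⁻¹-W⁻¹)*(V⁻¹-J*O*o*q^2*W)/(V⁻¹*(V⁻¹-J*O*q*V)*((1-q*O)*(1-W⁻¹)*(1-J*O*o*q^2*W)))
    = (1-J*O*q*V)*(1-q*O*V)*(W-V)*(1-J*O*o*q^2*W*V)
        /(V*(1-J*O*q*V^2)*(1-q*O)*(W-1)*(1-J*O*o*q^2*W)) := by
    rw [e0, show 1 - W⁻¹ = (W-1)/W by field_simp, show V⁻¹ - W⁻¹ = (W-V)/(V*W) by field_simp, show V⁻¹ - q*O = (1-q*O*V)/V by field_simp,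
      show V⁻¹-J*O*o*q^2*W = (1-J*O*o*q^2*W*V)/V by field_simp]
    generalize 1-J*O*q*V^2 = x1, 1-q*O = x2, W-1 = x3, 1-J*O*o*q^2*W = x4 at *
    field_simp
  have c2' : (1 - V⁻¹)*(J*O*q*V - q*O)*(J*O*q*V-W⁻¹)*(J*O*q*V-J*O*o*q^2*W)/(J*O*q*V*(J*O*q*V - V⁻¹)*((1-q*O)*(1-W⁻¹)*(1-J*O*o*q^2*W)))
    = -(V-1)*q*O*(1-J*V)*(1-J*O*q*V*W)*(V-o*q*W)
        /(V*(1-J*O*q*V^2)*(1-q*O)*(W-1)*(1-J*O*o*q^2*W)) := by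
    rw [e0', show 1 - W⁻¹ = (W-1)/W by field_simp, show 1 - V⁻¹ = (V-1)/V by field_simp, show J*O*q*V - W⁻¹ = -(1-J*O*q*V*W)/W by field_simp; ring,
      show J*O*q*V - q*O = -q*O*(1-J*V) by ring,
      show J*O*q*V-J*O*o*q^2*W = J*O*q*(V-o*q*W) by ring]
    generalize 1-J*O*q*V^2 = x1, 1-q*O = x2, W-1 = x3, 1-J*O*o*q^2*W = x4, 1-J*O*q*V*W = x5, 1-J*V = x6, V-o*q*W = x7 at *
    field_simp
  rw [c1', c2']
  congr 3 <;> first | rfl | (field_simp; done) | (rw [pow_succ]; field_simp; done) | (field_simp; ring)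

theorem RT1 (n : ℕ) (U V W J O o : ℂ) (hq : q ≠ 0) (hV : V ≠ 0) (hW : W ≠ 0)
    (hVV : 1 - J*O*q*V^2 ≠ 0) (hE : ∀ k ≤ n, 1 - W⁻¹ * q ^ k ≠ 0) :
    Rc q n U V W J O o =
      (1-J*O*q*V)*(W-V)/((1-J*O*q*V^2)*(W-1)) * Rc q n U V (W/q) (J*q) O o
      + (V-1)*(1-J*O*q*V*W)/((1-J*O*q*V^2)*(W-1)) * Rc q n U (V/q) (W/q) (J*q) O o := by
  have e1 : 1 - W⁻¹ ≠ 0 := by simpa using hE 0 (by omega)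
  have e2 : W - 1 ≠ 0 := by
    intro h; apply e1; rw [show W = 1 by linear_combination h]; simp
  have e0 : V⁻¹ - J*O*q*V = (1 - J*O*q*V^2)/V := by field_simp
  have e0' : J*O*q*V - V⁻¹ = -(1 - J*O*q*V^2)/V := by field_simp; ring
  have hAB : V⁻¹ ≠ J*O*q*V := by
    intro h; rw [← sub_eq_zero, e0] at h; simp [hVV, hV] at h
  unfold Rc
  have := FT q n U⁻¹ (O*o*q*U) V⁻¹ (J*O*q*V) W⁻¹ (q*O) (J*O*o*q^2*W) hAB hE
  rw [Fs_perm1, this, Fs_perm1 q n _ _ _ _ _ (q*O), Fs_perm1 q n _ _ _ _ _ (q*O)]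
  have c1' : (1-J*O*q*V)*(V⁻¹-W⁻¹)/((V⁻¹-J*O*q*V)*(1-W⁻¹)) = (1-J*O*q*V)*(W-V)/((1-J*O*q*V^2)*(W-1)) := by
    rw [e0, show 1 - W⁻¹ = (W-1)/W by field_simp, show V⁻¹ - W⁻¹ = (W-V)/(V*W) by field_simp]
    generalize 1-J*O*q*V^2 = x1 at *
    field_simp
  have c2' : (1-V⁻¹)*(J*O*q*V-W⁻¹)/((J*O*q*V-V⁻¹)*(1-W⁻¹)) = (V-1)*(1-J*O*q*V*W)/((1-J*O*q*V^2)*(W-1)) := by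
    rw [e0', show 1 - W⁻¹ = (W-1)/W by field_simp, show 1 - V⁻¹ = (V-1)/V by field_simp, show J*O*q*V - W⁻¹ = -(1-J*O*q*V*W)/W by field_simp; ring]
    generalize 1-J*O*q*V^2 = x1, 1-J*O*q*V*W = x5 at *
    field_simp
  rw [c1', c2']
  congr 3 <;> first | rfl | (field_simp; done) | (rw [pow_succ]; field_simp; done) | (field_simp; ring)

theorem RT2 (n : ℕ) (U V W J O o : ℂ) (hq : q ≠ 0) (hV : V ≠ 0)
    (hVV : 1 - J*O*q*V^2 ≠ 0) (hG : ∀ k ≤ n, 1 - J*O*o*q^2*W * q ^ k ≠ 0) :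
    Rc q n U V W J O o =
      (1-J*O*q*V)*(1-J*O*o*q^2*W*V)/((1-J*O*q*V^2)*(1-J*O*o*q^2*W)) * Rc q n U V W (J*q) O o
      + -(V-1)*J*O*q*(V-o*q*W)/((1-J*O*q*V^2)*(1-J*O*o*q^2*W)) * Rc q n U (V/q) W (J*q) O o := by
  have g1 : 1 - J*O*o*q^2*W ≠ 0 := by simpa using hG 0 (by omega)
  have e0 : V⁻¹ - J*O*q*V = (1 - J*O*q*V^2)/V := by field_simp
  have e0' : J*O*q*V - V⁻¹ = -(1 - J*O*q*V^2)/V := by field_simp; ring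
  have hAB : V⁻¹ ≠ J*O*q*V := by
    intro h; rw [← sub_eq_zero, e0] at h; simp [hVV, hV] at h
  unfold Rc
  have := FT q n U⁻¹ (O*o*q*U) V⁻¹ (J*O*q*V) (J*O*o*q^2*W) W⁻¹ (q*O) hAB hG
  rw [Fs_perm2, this, Fs_perm2 q n _ _ _ _ _ _ (q*O), Fs_perm2 q n _ _ _ _ _ _ (q*O)]
  have c1' : (1-J*O*q*V)*(V⁻¹-J*O*o*q^2*W)/((V⁻¹-J*O*q*V)*(1-J*O*o*q^2*W)) = (1-J*O*q*V)*(1-J*O*o*q^2*W*V)/((1-J*O*q*V^2)*(1-J*O*o*q^2*W)) := by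
    rw [e0, show V⁻¹-J*O*o*q^2*W = (1-J*O*o*q^2*W*V)/V by field_simp]
    generalize 1-J*O*q*V^2 = x1, 1-J*O*o*q^2*W = x2 at *
    field_simp
  have c2' : (1-V⁻¹)*(J*O*q*V-J*O*o*q^2*W)/((J*O*q*V-V⁻¹)*(1-J*O*o*q^2*W)) = -(V-1)*J*O*q*(V-o*q*W)/((1-J*O*q*V^2)*(1-J*O*o*q^2*W)) := by
    rw [e0', show 1 - V⁻¹ = (V-1)/V by field_simp]
    generalize 1-J*O*q*V^2 = x1, 1-J*O*o*q^2*W = x2 at *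
    field_simp
  rw [c1', c2']
  congr 3 <;> first | rfl | (field_simp; done) | (rw [pow_succ]; field_simp; done) | (field_simp; ring)

theorem RII (n : ℕ) (U V W J O o : ℂ) (hq : q ≠ 0) (hU : U ≠ 0) (hV : V ≠ 0) (hW : W ≠ 0)
    (h1 : J ≠ 0) (h2 : O ≠ 0) (h3 : o ≠ 0)
    (ha : 1 - q*V ≠ 0) (hb : 1 - J*O*q*V ≠ 0) (hab : 1 - J*O*q^2*V^2 ≠ 0)
    (hD : ∀ k < n, 1 - q*O * q ^ k ≠ 0) (hE : ∀ k < n, 1 - W⁻¹ * q ^ k ≠ 0)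
    (hG : ∀ k ≤ n, 1 - J*O*o*q^2*W * q ^ k ≠ 0) (hqq : ∀ k < n, 1 - q * q ^ k ≠ 0)
    (hz : q^n = U ∨ q^n = q*V) :
    (1-J*O*o*q^2*W*U)*(1-J*q*W/U)/(1-J*O*o*q^2*W) * Rc q n U V W (J*q) O o =
      (1-J*q*V)*(1-J*O*q^2*V*W)/(1-J*O*q^2*V^2) * Rc q n U V W J O o
      + -J*q*(1-q*O*V)*(W-V)/(1-J*O*q^2*V^2) * Rc q n U (V*q) W J O o := by
  have g1 : 1 - J*O*o*q^2*W ≠ 0 := by simpa using hG 0 (by omega)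
  have e0 : (q*V)⁻¹ - J*O*q*V = (1 - J*O*q^2*V^2)/(q*V) := by field_simp
  have e0' : J*O*q*V - (q*V)⁻¹ = -(1 - J*O*q^2*V^2)/(q*V) := by field_simp; ring
  have hAB : (q*V)⁻¹ ≠ J*O*q*V := by
    intro h; rw [← sub_eq_zero, e0] at h; simp [hab, hV, hq] at h
  have := FII q n U⁻¹ (O*o*q*U) (q*V)⁻¹ (J*O*q*V) (q*O) W⁻¹ (J*O*o*q^2*W) hq
    (inv_ne_zero hU) (by simp [h2,h3,hq,hU])
    (by intro h; apply ha; have : (q*V)⁻¹ = 1 := by linear_combination -h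
        rw [inv_eq_one] at this; rw [this]; ring)
    hb hAB (mul_ne_zero hq h2) (inv_ne_zero hW) hD hE hG hqq
    (by rcases hz with h | h <;> rw [h] <;> [skip; skip]
        · rw [inv_mul_cancel₀ hU]; ring
        · rw [inv_mul_cancel₀ (mul_ne_zero hq hV)]; ring)
    (by field_simp)
  unfold Rc
  have f1 : (1 - J*O*o*q^2*W/U⁻¹)*(1-J*O*o*q^2*W/(O*o*q*U)) = (1-J*O*o*q^2*W*U)*(1-J*q*W/U) := by
    congr 1 <;> field_simp
  have f2 : (q*V)⁻¹*(J*O*q*V*q-q*O)*(J*O*q*V*q-W⁻¹)/(q*O*W⁻¹*((q*V)⁻¹-J*O*q*V)) =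
     (1-J*q*V)*(1-J*O*q^2*V*W)/(1-J*O*q^2*V^2) := by
    rw [e0, show J*O*q*V*q - q*O = -q*O*(1-J*q*V) by ring, show J*O*q*V*q-W⁻¹ = -(1-J*O*q^2*V*W)/W by field_simp; ring]
    generalize 1-J*O*q^2*V^2 = x1, 1-J*O*q^2*V*W = x2, 1-J*q*V = x3 at *
    field_simp
  have f3 : J*O*q*V*((q*V)⁻¹*q-q*O)*((q*V)⁻¹*q-W⁻¹)/(q*O*W⁻¹*(J*O*q*V-(q*V)⁻¹)) =
     -J*q*(1-q*O*V)*(W-V)/(1-J*O*q^2*V^2) := by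
    rw [e0', show (q*V)⁻¹*q - q*O = (1-q*O*V)/V by field_simp, show (q*V)⁻¹*q-W⁻¹ = (W-V)/(V*W) by field_simp]
    generalize 1-J*O*q^2*V^2 = x1, 1-q*O*V = x2, W-V = x3 at *
    field_simp
  rw [f1, f2, f3] at this
  have h4 : (q*V)⁻¹*q = V⁻¹ := by field_simp
  rw [h4] at this
  have h5 : V*q = q*V := mul_comm _ _
  rw [h5]
  rw [show J*q*O*q*V = J*O*q*V*q by ring, show J*q*O*o*q^2*W = J*O*o*q^2*W*q by ring,
    show J*O*q*(q*V) = J*O*q*V*q by ring]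
  exact this

end qR

namespace qR

noncomputable def t65 (q A B C : ℂ) (n b : ℕ) : ℂ :=
  poch q A b * (1 - A*q^b*q^b) * poch q B b * poch q C b * poch q (q^n)⁻¹ b /
    (poch q q b * poch q (A*q/B) b * poch q (A*q/C) b * poch q (A*q*q^n) b) * (A*q*q^n/(B*C))^b

theorem key65 (q A B C x y : ℂ) (hq : q ≠ 0) (hx : x ≠ 0) (hB : B ≠ 0) (hC : C ≠ 0)
    (a1 : 1 - q*y ≠ 0) (a2 : B - A*q*y ≠ 0) (a3 : C - A*q*y ≠ 0) (a4 : 1 - A*q*(x*q)*y ≠ 0) :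
    (1 - A * q / B * x) * (1 - A * q / C * x) * ((1 - A * (y * q) * (y * q)) * (1 - (x * q)⁻¹) /
          ((1 - q * y) * (((B - A * q * y) / B)) * (((C - A * q * y) / C)) * ((1 - A * q * (x * q) * y))) * ((y * q)))
          = (1-A*q/(B*C)*x) * ((1 - A * (y * q) * (y * q)) * (1 - x⁻¹*y)/((1 - q * y) * (((B - A * q * y) / B)) * (((C - A * q * y) / C))))
          + (1 - A*(y*q))*(1-B*(y*q))*(1-C*(y*q))*(1-x⁻¹*y)/((1 - q * y) * (((B - A * q * y) / B)) * (((C - A * q * y) / C)) * ((1 - A * q * (x * q) * y)))*(A*q*x/(B*C)) - 1 := by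
  generalize hu1 : 1 - q*y = u1, hu2 : B - A*q*y = u2, hu3 : C - A*q*y = u3, hu4 : 1 - A*q*(x*q)*y = u4 at *
  field_simp
  rw [← hu1, ← hu2, ← hu3, ← hu4]
  ring

theorem sum65_step (q A B C : ℂ) (n : ℕ) (hq : q ≠ 0) (hB : B ≠ 0) (hC : C ≠ 0)
    (h1 : ∀ k : ℕ, 1 - q*q^k ≠ 0) (h2 : ∀ k : ℕ, 1 - A*q/B*q^k ≠ 0) (h3 : ∀ k : ℕ, 1 - A*q/C*q^k ≠ 0)
    (h4 : ∀ k : ℕ, 1 - A*q*q^k ≠ 0) :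
    ∑ b ∈ Finset.range (n+1+1), (1 - A*q/B*q^n)*(1-A*q/C*q^n)*t65 q A B C (n+1) b =
    ∑ b ∈ Finset.range (n+1+1), (1 - A*q*q^n)*(1-A*q/(B*C)*q^n)*t65 q A B C n b := by
  set g : ℕ → ℂ := fun b => poch q A (b+1) * poch q B (b+1) * poch q C (b+1) * poch q (q^n)⁻¹ b /
    (poch q q b * poch q (A*q/B) b * poch q (A*q/C) b * poch q (A*q*q^(n+1)) b) * (A*q*q^n/(B*C))^(b+1) with hg
  have hqn : q^n ≠ 0 := pow_ne_zero _ hq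
  have h4' : ∀ k m: ℕ, 1 - A*q*q^k*q^m ≠ 0 := fun k m => by
    have := h4 (k+m); rwa [pow_add, ← mul_assoc] at this
  apply tele (n+1) _ _ (fun b => match b with | 0 => 0 | b+1 => g b) g
  · intro k hk
    cases k with
    | zero =>
      simp only [hg, t65, poch_zero, poch_succ, pow_zero, zero_add, pow_one]
      field_simp; ring
    | succ k =>
      simp only [hg, t65]
      have p1 : poch q (q^(n+1))⁻¹ (k+1) = (1 - (q^(n+1))⁻¹) * poch q (q^n)⁻¹ k := by
        rw [poch_succ', show (q^(n+1))⁻¹*q = (q^n)⁻¹ by rw [pow_succ]; field_simp]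
      have p2 : poch q (A*q*q^n) (k+1) = (1-A*q*q^n) * poch q (A*q*q^(n+1)) k := by
        rw [poch_succ', show A*q*q^n*q = A*q*q^(n+1) by ring]
      rw [p1, p2, poch_succ _ (q^n)⁻¹, poch_succ _ _ (k+1), poch_succ _ _ (k+1), poch_succ _ _ (k+1), poch_succ _ q, poch_succ _ (A*q/B), poch_succ _ (A*q/C),
        poch_succ _ (A*q*q^(n+1))]
      have a1 := h1 k; have a2 := h2 k; have a3 := h3 k; have a4 := h4' (n+1) k; have a5 := h4 n
      have b1 : poch q q k ≠ 0 := poch_ne fun l _ => h1 l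
      have b2 : poch q (A*q/B) k ≠ 0 := poch_ne fun l _ => h2 l
      have b3 : poch q (A*q/C) k ≠ 0 := poch_ne fun l _ => h3 l
      have b4 : poch q (A*q*q^(n+1)) k ≠ 0 := poch_ne fun l _ => h4' _ l
      clear h1 h2 h3 h4 h4' p1 p2 hg g hk
      generalize poch q A (k+1) = P1, poch q B (k+1) = P2, poch q C (k+1) = P3, poch q q k = P4, poch q (A*q/B) k = P5, poch q (A*q/C) k = P6, poch q (A*q*q^(n+1)) k = P7, poch q (q^n)⁻¹ k = P8 at *
      have z : A*q*q^(n+1)/(B*C) = A*q*q^n/(B*C)*q := by ring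
      rw [z, mul_pow]
      rw [pow_succ (A*q*q^n/(B*C)) (k+1)]
      generalize (A*q*q^n/(B*C))^(k+1) = Z
      simp only [pow_succ] at *
      generalize q^n = x, q^k = y at *
      have e2 : 1 - A*q/B*y = (B-A*q*y)/B := by field_simp
      have e3 : 1 - A*q/C*y = (C-A*q*y)/C := by field_simp
      have a2' : B - A*q*y ≠ 0 := fun h => a2 (by rw [e2, h]; simp)
      have a3' : C - A*q*y ≠ 0 := fun h => a3 (by rw [e3, h]; simp)
      have key := key65 q A B C x y hq hqn hB hC a1 a2' a3' a4
      rw [← e2, ← e3] at key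
      clear e2 e3 a2' a3'
      generalize 1 - q*y = u1, 1 - A*q/B*y = u2, 1 - A*q/C*y = u3, 1 - A*q*(x*q)*y = u4, 1 - A*q*x = u5, 1 - A * q / B * x = v1, 1 - A * q / C * x = v2, 1 - A * (y * q) * (y * q) = v3, 1 - (x*q)⁻¹ = v4, 1 - A * q / (B*C) * x = v5, 1 - x⁻¹*y = v6, 1 - A * (y*q) = v7, 1 - B * (y*q) = v8, 1 - C * (y*q) = v9, A*q*x/(B*C) = v10 at *
      trans (P1*P2*P3*P8*Z/(P4*P5*P6*P7)) * (v1*v2*(v3*v4/(u1*u2*u3*u4)*(y*q)))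
      · ring
      rw [key]
      have : u5 * u5⁻¹ = 1 := mul_inv_cancel₀ a5
      linear_combination -(v5*(P1*P2*P3*P8*Z/(P4*P5*P6*P7))*(v3*v6/(u1*u2*u3)))*this
  · rfl
  · intro k _; rfl
  · simp only [hg]
    have : poch q (q^n)⁻¹ (n+1) = 0 := poch_eq_zero (l := n) (by omega) (by rw [inv_mul_cancel₀ hqn, sub_self])
    rw [this]; simp

theorem sum65 (q A B C : ℂ) (n : ℕ) (hq : q ≠ 0) (hB : B ≠ 0) (hC : C ≠ 0)
    (h1 : ∀ k : ℕ, 1 - q*q^k ≠ 0) (h2 : ∀ k : ℕ, 1 - A*q/B*q^k ≠ 0) (h3 : ∀ k : ℕ, 1 - A*q/C*q^k ≠ 0)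
    (h4 : ∀ k : ℕ, 1 - A*q*q^k ≠ 0) :
    ∑ b ∈ Finset.range (n+1), t65 q A B C n b =
      (1-A) * poch q (A*q) n * poch q (A*q/(B*C)) n / (poch q (A*q/B) n * poch q (A*q/C) n) := by
  induction n with
  | zero => simp [t65, poch_zero]
  | succ n ih =>
    have := sum65_step q A B C n hq hB hC h1 h2 h3 h4
    rw [← Finset.mul_sum, ← Finset.mul_sum] at this
    have hz : t65 q A B C n (n+1) = 0 := by
      have : poch q (q^n)⁻¹ (n+1) = 0 := poch_eq_zero (l := n) (by omega) (by rw [inv_mul_cancel₀ (pow_ne_zero _ hq), sub_self])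
      simp [t65, this]
    have n2 := h2 n; have n3 := h3 n
    have b2 : poch q (A*q/B) n ≠ 0 := poch_ne fun l _ => h2 l
    have b3 : poch q (A*q/C) n ≠ 0 := poch_ne fun l _ => h3 l
    rw [Finset.sum_range_succ (fun b => t65 q A B C n b) (n+1), hz, add_zero, ih] at this
    simp only [poch_succ]
    apply mul_left_cancel₀ (mul_ne_zero n2 n3)
    rw [this]
    generalize 1 - A*q/B*q^n = u1, 1 - A*q/C*q^n = u2 at *
    field_simp

end qR

namespace qR

structure Gn (q L J O o F : ℂ) (N : ℕ) : Prop where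
  hq : q ≠ 0
  h0 : L ≠ 0
  h1 : J ≠ 0
  h2 : O ≠ 0
  h3 : o ≠ 0
  h4 : F ≠ 0
  rel : L*J*O*o*F*q^(2*N+3) = 1
  ind : ∀ e0 e1 e2 e3 e4 m : ℤ, L^e0*J^e1*O^e2*o^e3*F^e4*q^m = 1 →
    e0 = e1 ∧ e1 = e2 ∧ e2 = e3 ∧ e3 = e4 ∧ m = (2*N+3)*e0

variable {q L J O o F : ℂ} {N : ℕ}

theorem Gn.nz (g : Gn q L J O o F N) : q ≠ 0 ∧ L ≠ 0 ∧ J ≠ 0 ∧ O ≠ 0 ∧ o ≠ 0 ∧ F ≠ 0 :=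
  ⟨g.hq, g.h0, g.h1, g.h2, g.h3, g.h4⟩

theorem Gn.ne (g : Gn q L J O o F N) (e0 e1 e2 e3 e4 m : ℤ) {X : ℂ}
    (hX : q ≠ 0 → X = L^e0*J^e1*O^e2*o^e3*F^e4*q^m := by intro hq; simp only [zpow_add₀ hq, zpow_sub₀ hq, zpow_neg, zpow_natCast, zpow_one, zpow_zero, zpow_ofNat, pow_add, div_one, one_mul, mul_one]; first | done | ring1 | (field_simp; done) | (field_simp; ring1))
    (h : ¬ (e0 = e1 ∧ e1 = e2 ∧ e2 = e3 ∧ e3 = e4 ∧ m = (2*N+3)*e0) := by first | omega | (push_cast; omega) | (rintro ⟨h, h', h2, h3, -⟩; omega)) : 1 - X ≠ 0 := by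
  intro hh; apply h; apply g.ind; rw [← hX g.hq]; linear_combination -hh

theorem Gn.mirror (g : Gn q L J O o F N) : Gn q O o L J F N where
  hq := g.hq
  h0 := g.h2
  h1 := g.h3
  h2 := g.h0
  h3 := g.h1
  h4 := g.h4
  rel := by rw [← g.rel]; ring
  ind := by
    intro e0 e1 e2 e3 e4 m h
    have := g.ind e2 e3 e0 e1 e4 m (by rw [← h]; ring)
    obtain ⟨h1, h2, h3, h4, h5⟩ := this
    refine ⟨by omega, by omega, by omega, by omega, by rw [h5]; rw [show e2 = e0 by omega]⟩

theorem Gn.sh04 (g : Gn q L J O o F N) : Gn q (L*q) J O o (F/q) N where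
  hq := g.hq
  h0 := mul_ne_zero g.h0 g.hq
  h1 := g.h1
  h2 := g.h2
  h3 := g.h3
  h4 := div_ne_zero g.h4 g.hq
  rel := by rw [← g.rel]; have := g.hq; field_simp
  ind := by
    intro e0 e1 e2 e3 e4 m h
    have := g.ind e0 e1 e2 e3 e4 (m+e0-e4) (by
      rw [← h, zpow_sub₀ g.hq, zpow_add₀ g.hq, mul_zpow, div_zpow]; ring)
    obtain ⟨h1, h2, h3, h4, h5⟩ := this
    refine ⟨by omega, by omega, by omega, by omega, by rw [← h5]; omega⟩

theorem Gn.down (g : Gn q L J O o F (N+1)) : Gn q (L*q) J O o (F*q) N where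
  hq := g.hq
  h0 := mul_ne_zero g.h0 g.hq
  h1 := g.h1
  h2 := g.h2
  h3 := g.h3
  h4 := mul_ne_zero g.h4 g.hq
  rel := by rw [← g.rel]; ring
  ind := by
    intro e0 e1 e2 e3 e4 m h
    have := g.ind e0 e1 e2 e3 e4 (m+e0+e4) (by
      rw [← h, zpow_add₀ g.hq, zpow_add₀ g.hq, mul_zpow, mul_zpow]; ring)
    obtain ⟨h1, h2, h3, h4, h5⟩ := this
    refine ⟨by omega, by omega, by omega, by omega, ?_⟩
    push_cast at h5
    have : e4 = e0 := by omega
    rw [this] at h5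
    linear_combination h5

theorem Gn.qne (g : Gn q L J O o F N) (k : ℕ) : 1 - q*q^k ≠ 0 :=
  g.ne 0 0 0 0 0 (k+1)

theorem Gn.qne' (g : Gn q L J O o F N) {k l : ℕ} (h : k ≠ l) : 1 - (q^k)⁻¹*q^l ≠ 0 :=
  g.ne 0 0 0 0 0 (l-k)

noncomputable def pr (q C α : ℂ) (b : ℕ) : ℂ := poch q α b / poch q (C*q^2/α) b

theorem pr_shift (C α β: ℂ) (b : ℕ) (hα : α ≠ 0) (hβ : β = α*q) (hq : q ≠ 0)
    (h1 : poch q (C*q/α) b ≠ 0) (h2 : poch q (C*q^2/α) b ≠ 0) :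
    (1-α)*(1-C*q/α)*pr q C β b = (1-α*q^b)*(1-C*q/α*q^b)*pr q C α b := by
  have e : C*q^2/β = C*q/α := by rw [hβ]; field_simp
  unfold pr
  rw [e, hβ]
  have s1 := poch_shift q α b
  have s2 := poch_shift q (C*q/α) b
  rw [show C*q/α*q = C*q^2/α by ring] at s2
  rw [← mul_div_assoc, ← mul_div_assoc, div_eq_div_iff h1 h2]
  linear_combination (-(1-C*q/α*q^b)* poch q (C*q/α) b) * s1 - ((1-α)*poch q (α*q) b)* s2

noncomputable def wt (q C L O F Q Z W : ℂ) (b : ℕ) : ℂ :=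
  poch q (C*q) b / poch q q b * ((1 - C*q*q^b*q^b)/(1-C*q)) * pr q C Z⁻¹ b * pr q C (L*C*Z*q^2) b
    * pr q C (O*C*Q*q^2) b * pr q C Q⁻¹ b * pr q C (C*W*q^2) b * (F*W*q)^b

noncomputable def KK (q : ℂ) (M j x a y : ℕ) (L J O o F : ℂ) : ℂ :=
  poch q (J*o*q^2) M * poch q (F*q*q^j) M / (poch q (L*q^(M+j))⁻¹ M * poch q (O*q^M)⁻¹ M)
  * (poch q (L*q^(M+j))⁻¹ x * poch q (q*O) x / (poch q (J*o*q*q^(M+j))⁻¹ x * poch q (F*q) x) * (L*F*q*q^(M+j))^x)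
  * (poch q (q*O) a * poch q (J*O*F*q^2*q^(M+j)/q^y) a * poch q (q*L) y * poch q (L*o*F*q^2*q^(M+j)/q^a) y
     * poch q (q^(M+j))⁻¹ (a+y) / (poch q (q*J) a * poch q (q*o) y * poch q (F*q^(M+j))⁻¹ (a+y) * poch q (q^(M+j))⁻¹ a
      * poch q (q^(M+j))⁻¹ y) / (O*F*q*q^(M+j))^a / (L*F*q*q^(M+j))^y * (q^a)^y)

def BEp (q : ℂ) (M j x a y : ℕ) (L J O o F : ℂ) : Prop :=
  ∑ b ∈ Finset.range (M+j+1), wt q (J*o) L O F (q^M) (q^(M+j)/q^x) (q^(M+j)) b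
    * Rc q a (q^a) (q^b) (q^M) o J O * Rc q j (q^j) (q^x) (q^(M+j)/q^b) O F L
    * Rc q b (q^b) (q^y) (q^(M+j)/q^x) L o J
  = KK q M j x a y L J O o F * Rc q j (q^j) (q^y) (q^(M+j)/q^a) o L F
    * Rc q a (q^a) (q^x) (q^(M+j)/q^y) F O J

theorem wt_sh04 (g : Gn q L J O o F N) (b : ℕ) :
    (1 - L*q*q^N) * wt q (J*o) (L*q) O (F/q) (q^N) (q^N) (q^N) b =
    wt q (J*o) L O F (q^N) (q^N) (q^N) b * ((1-L*o*J*q^2*q^N*q^b)*(1-L*q*q^N/q^b)/(1-L*o*J*q^2*q^N)) := by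
  have hq := g.hq; have h0 := g.h0; have h1 := g.h1; have h3 := g.h3
  have hN : q^N ≠ 0 := pow_ne_zero _ hq
  have hb : q^b ≠ 0 := pow_ne_zero _ hq
  have eα : J*o*q/(L*(J*o)*q^N*q^2) = (L*q^N*q)⁻¹ := by field_simp
  have eα2 : J*o*q^2/(L*(J*o)*q^N*q^2) = (L*q^N)⁻¹ := by field_simp
  have hG : 1-L*o*J*q^2*q^N ≠ 0 := g.ne 1 1 0 1 0 (N+2)
  have hp := pr_shift (q:=q) (J*o) (L*(J*o)*q^N*q^2) (L*q*(J*o)*q^N*q^2) b (by simp [*]) (by ring) hq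
    (by rw [eα]; apply poch_ne; intro l _
        exact g.ne (-1) 0 0 0 0 (l-N-1))
    (by rw [eα2]; apply poch_ne; intro l _
        exact g.ne (-1) 0 0 0 0 (l-N))
  rw [eα] at hp
  unfold wt
  have e1 : 1 - (L*q^N*q)⁻¹ = -(1-L*q*q^N)*(L*q^N*q)⁻¹ := by field_simp; ring
  have e2 : 1 - (L*q^N*q)⁻¹*q^b = -(1-L*q*q^N/q^b)*(q^b*(L*q^N*q)⁻¹) := by field_simp; ring
  rw [e1, e2] at hp
  have e3 : (F/q*q^N*q)^b = (F*q^N*q)^b/q^b := by rw [← div_pow]; congr 1; field_simp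
  rw [e3]
  have i : (L*q^N*q)⁻¹ ≠ 0 := by simp [*]
  have hp' : (1-L*q*q^N)*pr q (J*o) (L*q*(J*o)*q^N*q^2) b / q^b = (1-L*o*J*q^2*q^N*q^b)*(1-L*q*q^N/q^b)/(1-L*o*J*q^2*q^N) * pr q (J*o) (L*(J*o)*q^N*q^2) b := by
    rw [div_eq_iff hb, div_mul_eq_mul_div, div_mul_eq_mul_div, eq_div_iff hG]
    apply mul_right_cancel₀ i
    linear_combination -hp
  linear_combination (poch q (J*o*q) b / poch q q b * ((1 - J*o*q*q^b*q^b)/(1-J*o*q)) * pr q (J*o) (q^N)⁻¹ b 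
    * pr q (J*o) (O*(J*o)*q^N*q^2) b * pr q (J*o) (q^N)⁻¹ b * pr q (J*o) (J*o*q^N*q^2) b * (F*q^N*q)^b) * hp'

end qR

namespace qR

variable {q L J O o F : ℂ} {N : ℕ}

/-- (αq)_n in terms of (α)_n -/
theorem poch_up {α β : ℂ} (n : ℕ) (hβ : β = α*q) (h : 1 - α ≠ 0) :
    poch q β n = poch q α n * ((1-α*q^n)/(1-α)) := by
  rw [hβ, ← mul_div_assoc, eq_div_iff h, poch_shift]; ring

/-- (α)_n in terms of (αq)_n -/
theorem poch_dn {α β : ℂ} (n : ℕ) (hβ : β = α*q) (h : 1 - α*q^n ≠ 0) :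
    poch q α n = poch q β n * ((1-α)/(1-α*q^n)) := by
  rw [hβ, ← mul_div_assoc, eq_div_iff h, poch_shift]; ring

theorem coreL3 (L o F q W Y A : ℂ) (h0 : L ≠ 0) (h3 : o ≠ 0) (h4 : F ≠ 0) (hq : q ≠ 0) (hW : W ≠ 0) (hY : Y ≠ 0) (hA : A ≠ 0)
    (n1 : L*o*q^2*W*Y - A ≠ 0) (n2 : F*W - A*Y ≠ 0) (n3 : 1 - L*o*q^2*Y^2 ≠ 0) (n4 : 1 - q*o*Y ≠ 0)
    (n5 : W - Y ≠ 0) :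
    -(1-F)/F*(1-q*L*Y)*(1-(L*o*q^2*W*Y)⁻¹)*A/((1-(L*o*q^2*W*Y)⁻¹*A)*(1-A*Y/(F*W))) =
    (1-L*q*Y)*(1-L*o*q^2*Y*W)/(1-L*o*q^2*Y^2) + -L*q*(1-q*o*Y)*(W-Y)/(1-L*o*q^2*Y^2) *
     ((1-(L*o*q^2*W*Y)⁻¹)/(1-(L*o*q^2*W*Y)⁻¹*A)*(1-q*L*Y)*(1-L*o*F*q^2*W*Y/A)*(1-A*Y/W)/((1-q*o*Y)*(1-A*Y/(F*W))*(1-Y/W))/(L*F*q*W)*A) := by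
  have e1 : 1-(L*o*q^2*W*Y)⁻¹*A = (L*o*q^2*W*Y - A)/(L*o*q^2*W*Y) := by field_simp
  have e2 : 1-A*Y/(F*W) = (F*W-A*Y)/(F*W) := by field_simp
  have e3 : 1 - Y/W = (W-Y)/W := by field_simp
  rw [e1, e2, e3]
  generalize hu1 : L*o*q^2*W*Y - A = u1, hu2 : F*W - A*Y = u2, hu3 : 1 - L*o*q^2*Y^2 = u3, hu4 : 1 - q*o*Y = u4, hu5 : W - Y = u5 at *
  field_simp
  rw [← hu1, ← hu2, ← hu3]
  ring

theorem KK_sh04 (g : Gn q L J O o F N) (a y : ℕ) :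
    (1-L*q*q^N) * KK q N 0 0 a y (L*q) J O o (F/q) = KK q N 0 0 a y L J O o F *
     (-(1-F)/F*(1-q*L*q^y)*(1-(L*o*q^2*q^N*q^y)⁻¹)*q^a/((1-(L*o*q^2*q^N*q^y)⁻¹*q^a)*(1-q^a*q^y/(F*q^N)))) := by
  have ⟨hq, h0, h1, h2, h3, h4⟩ := g.nz
  have hN : q^N ≠ 0 := pow_ne_zero _ hq
  have hY : q^y ≠ 0 := pow_ne_zero _ hq
  have hA : q^a ≠ 0 := pow_ne_zero _ hq
  have rel : L*J*O*o*F*q^3*q^N*q^N = 1 := by rw [← g.rel]; ring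
  have th : J*O*(F/q)*q^2*q^N/q^y = (L*o*q^2*q^N*q^y)⁻¹ := by
    field_simp; rw [← rel]; ring
  have n1 : 1-F ≠ 0 := g.ne 0 0 0 0 1 0
  have n2 : 1-F*q^N ≠ 0 := g.ne 0 0 0 0 1 N
  have n3 : 1-(L*q*q^N)⁻¹*q^N ≠ 0 := g.ne (-1) 0 0 0 0 (-1)
  have n4 : 1-q*L ≠ 0 := g.ne 1 0 0 0 0 1
  have n5 : 1-(F*q^N)⁻¹ ≠ 0 := g.ne 0 0 0 0 (-1) (-N)
  have n6 : 1-(L*o*q^2*q^N*q^y)⁻¹*q^a ≠ 0 := g.ne (-1) 0 0 (-1) 0 (a-2-N-y)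
  have n7 : 1-(L*q*q^N)⁻¹ ≠ 0 := g.ne (-1) 0 0 0 0 (-1-N)
  have n8 : 1-(F*q^N)⁻¹*q^(a+y) ≠ 0 := g.ne 0 0 0 0 (-1) (a+y-N)
  have m1 : poch q (L*q^N)⁻¹ N ≠ 0 := poch_ne fun l _ => g.ne (-1) 0 0 0 0 (l-N)
  have m2 : poch q (F*q^N)⁻¹ (a+y) ≠ 0 := poch_ne fun l _ => g.ne 0 0 0 0 (-1) (l-N)
  unfold KK
  simp only [add_zero, pow_zero, mul_one, poch_zero, div_one]
  have p1 : poch q (F/q*q) N = poch q (F*q) N * ((1-F)/(1-F*q^N)) := by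
    rw [div_mul_cancel₀ _ hq]; exact poch_dn N rfl n2
  have p2 : poch q (L*q*q^N)⁻¹ N = poch q (L*q^N)⁻¹ N * ((1-(L*q*q^N)⁻¹)/(1-(L*q*q^N)⁻¹*q^N)) :=
    poch_dn N (by field_simp) n3
  have p3 : poch q (J*O*(F/q)*q^2*q^N/q^y) a = poch q (J*O*F*q^2*q^N/q^y) a * ((1-(L*o*q^2*q^N*q^y)⁻¹)/(1-(L*o*q^2*q^N*q^y)⁻¹*q^a)) := by
    rw [th]; exact poch_dn a (by rw [← th]; field_simp) n6
  have p4 : poch q (q*(L*q)) y = poch q (q*L) y * ((1-q*L*q^y)/(1-q*L)) := poch_up y (by ring) n4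
  have p5 : L*q*o*(F/q)*q^2*q^N/q^a = L*o*F*q^2*q^N/q^a := by field_simp
  have p6 : poch q (F/q*q^N)⁻¹ (a+y) = poch q (F*q^N)⁻¹ (a+y) * ((1-(F*q^N)⁻¹*q^(a+y))/(1-(F*q^N)⁻¹)) :=
    poch_up _ (by field_simp) n5
  have p7 : (O*(F/q)*q*q^N)^a = (O*F*q*q^N)^a / q^a := by rw [← div_pow]; congr 1; field_simp
  have p8 : L*q*(F/q)*q*q^N = L*F*q*q^N := by field_simp
  rw [p1, p2, p3, p4, p5, p6, p7, p8]
  have e1 : 1-(F*q^N)⁻¹ = -(1-F*q^N)/(F*q^N) := by field_simp; ring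
  have e2 : 1-(L*q*q^N)⁻¹*q^N = -(1-q*L)/(q*L) := by field_simp; ring
  have e3 : 1-(L*q*q^N)⁻¹ = -(1-L*q*q^N)/(L*q*q^N) := by field_simp; ring
  have e4 : q^a*q^y/(F*q^N) = (F*q^N)⁻¹*q^(a+y) := by rw [pow_add]; field_simp
  rw [e4]
  have n7' : 1-L*q*q^N ≠ 0 := by intro h; rw [e3, h] at n7; simp at n7
  rw [e1, e2, e3]
  clear th g p1 p2 p3 p4 p5 p6 p7 p8 rel n1 n3 n5 n7 e1 e2 e3 e4
  generalize poch q (L*q^N)⁻¹ N = P1, poch q (F*q^N)⁻¹ (a+y) = P2, poch q (J*o*q^2) N = P3, poch q (F*q) N = P4, poch q (O*q^N)⁻¹ N = P5, poch q (q*O) a = P6, poch q (J*O*F*q^2*q^N/q^y) a = P7, poch q (q*L) y = P8, poch q (L*o*F*q^2*q^N/q^a) y = P9, poch q (q^N)⁻¹ (a+y) = P10, poch q (q*J) a = P11, poch q (q*o) y = P12, poch q (q^N)⁻¹ a = P13, poch q (q^N)⁻¹ y = P14, 1-(L*o*q^2*q^N*q^y)⁻¹*q^a = u1, 1-(F*q^N)⁻¹*q^(a+y)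 = u2, 1-(L*o*q^2*q^N*q^y)⁻¹ = u3, 1-F*q^N = u4, 1-q*L = u5, 1-L*q*q^N = u6, 1-q*L*q^y = u7, (O*F*q*q^N)^a = v1, (L*F*q*q^N)^y = v2, (q^a)^y = v3 at *
  generalize q^a = A, q^y = Y, q^N = W at *
  trans (P3*P4*P6*P7*P8*P9*P10/(P1*P2*P5*P11*P12*P13*P14)/v1/v2*v3) * (u6*((1-F)/u4)*(-u5/(q*L))*(1/(-u6/(L*q*W)))*(u3/u1)*(u7/u5)*(-u4/(F*W)/u2)*A)
  · simp only [div_eq_mul_inv, mul_inv, inv_inv]; ring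
  · have : (u6*((1-F)/u4)*(-u5/(q*L))*(1/(-u6/(L*q*W)))*(u3/u1)*(u7/u5)*(-u4/(F*W)/u2)*A) = -(1-F)/F*u7*u3*A/(u1*u2) := by
      field_simp
    rw [this]; ring

theorem KK_ysucc (g : Gn q L J O o F N) (a y : ℕ) :
    KK q N 0 0 a (y+1) L J O o F = KK q N 0 0 a y L J O o F *
      ((1-(L*o*q^2*q^N*q^y)⁻¹)/(1-(L*o*q^2*q^N*q^y)⁻¹*q^a)*(1-q*L*q^y)*(1-L*o*F*q^2*q^N*q^y/q^a)*(1-q^a*q^y/q^N)/((1-q*o*q^y)*(1-q^a*q^y/(F*q^N))*(1-q^y/q^N))/(L*F*q*q^N)*q^a) := by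
  have ⟨hq, h0, h1, h2, h3, h4⟩ := g.nz
  have hN : q^N ≠ 0 := pow_ne_zero _ hq
  have hY : q^y ≠ 0 := pow_ne_zero _ hq
  have hA : q^a ≠ 0 := pow_ne_zero _ hq
  have rel : L*J*O*o*F*q^3*q^N*q^N = 1 := by rw [← g.rel]; ring
  have th : J*O*F*q^2*q^N/q^(y+1) = (L*o*q^2*q^N*q^y)⁻¹ := by
    rw [pow_succ q y]; field_simp; linear_combination rel
  have n6 : 1-(L*o*q^2*q^N*q^y)⁻¹*q^a ≠ 0 := g.ne (-1) 0 0 (-1) 0 (a-2-N-y)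
  unfold KK
  simp only [add_zero, pow_zero, mul_one, poch_zero, div_one]
  have p3 : poch q (J*O*F*q^2*q^N/q^(y+1)) a = poch q (J*O*F*q^2*q^N/q^y) a * ((1-(L*o*q^2*q^N*q^y)⁻¹)/(1-(L*o*q^2*q^N*q^y)⁻¹*q^a)) := by
    rw [th]; exact poch_dn a (by rw [← th, pow_succ q y]; field_simp) n6
  rw [p3, ← add_assoc]
  simp only [poch_succ]
  rw [pow_succ (L*F*q*q^N) y, pow_succ (q^a) y]
  have e1 : (q^N)⁻¹*q^(a+y) = q^a*q^y/q^N := by rw [pow_add]; ring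
  have e2 : (F*q^N)⁻¹*q^(a+y) = q^a*q^y/(F*q^N) := by rw [pow_add]; ring
  have e3 : (q^N)⁻¹*q^y = q^y/q^N := by ring
  have e4 : L*o*F*q^2*q^N/q^a*q^y = L*o*F*q^2*q^N*q^y/q^a := by ring
  rw [e1, e2, e3, e4]
  simp only [div_eq_mul_inv, mul_inv, inv_inv]
  ring

theorem L3 (g : Gn q L J O o F N) (a y : ℕ) (hy : y < N)
    (H1 : BEp q N 0 0 a y (L*q) J O o (F/q)) (H2 : BEp q N 0 0 a y L J O o F) :
    BEp q N 0 0 a (y+1) L J O o F := by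
  have ⟨hq, h0, h1, h2, h3, h4⟩ := g.nz
  have hN : q^N ≠ 0 := pow_ne_zero _ hq
  have hY : q^y ≠ 0 := pow_ne_zero _ hq
  have hA : q^a ≠ 0 := pow_ne_zero _ hq
  have ks := KK_sh04 g a y
  have ky := KK_ysucc g a y
  unfold BEp at *
  simp only [add_zero, pow_zero, div_one, Rc_zeroU, mul_one] at *
  have z1 : ∀ (n : ℕ) (U W c c' c'' : ℂ), Rc q n U 1 W c c' c'' = 1 := by
    intro n U W c c' c''; have := Rc_zeroV q n U W c c' c''; rwa [pow_zero] at this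
  have z2 : ∀ (n : ℕ) (V W c c' c'' : ℂ), Rc q n 1 V W c c' c'' = 1 := by
    intro n U W c c' c''; have := Rc_zeroU q n U W c c' c''; rwa [pow_zero] at this
  simp only [z1, z2, mul_one] at *
  have n3 : 1 - L*o*q^2*(q^y)^2 ≠ 0 := g.ne 1 0 0 1 0 (2+y+y)
  have n4 : 1 - q*o*q^y ≠ 0 := g.ne 0 0 0 1 0 (1+y)
  have n5 : q^N - q^y ≠ 0 := by
    have := g.qne' (k := N) (l := y) (by omega)
    intro h; apply this
    rw [show q^y = q^N by linear_combination -h, inv_mul_cancel₀ hN, sub_self]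
  set w := (1-L*q*q^y)*(1-L*o*q^2*q^y*q^N)/(1-L*o*q^2*(q^y)^2) with hw
  set z := -L*q*(1-q*o*q^y)*(q^N-q^y)/(1-L*o*q^2*(q^y)^2) with hz
  have hzne : z ≠ 0 := by rw [hz]; simp [*]
  have core := coreL3 L o F q (q^N) (q^y) (q^a) h0 h3 h4 hq hN hY hA
    (by have := g.ne (-1) 0 0 (-1) 0 (a-2-N-y) (X := (L*o*q^2*q^N*q^y)⁻¹*q^a)
        intro h; apply this; rw [show L*o*q^2*q^N*q^y = q^a by linear_combination h, inv_mul_cancel₀ hA, sub_self])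
    (by have := g.ne 0 0 0 0 (-1) (a+y-N) (X := (F*q^N)⁻¹*(q^a*q^y))
        intro h; apply this; rw [show F*q^N = q^a*q^y by linear_combination h, inv_mul_cancel₀ (mul_ne_zero hA hY), sub_self])
    n3 n4 n5
  rw [← hw, ← hz] at core
  rw [core] at ks
  have S : (1-L*q*q^N) * ∑ b ∈ Finset.range (N+1), wt q (J*o) (L*q) O (F/q) (q^N) (q^N) (q^N) b * Rc q a (q^a) (q^b) (q^N) o J O * Rc q b (q^b) (q^y) (q^N) (L*q) o J
    = w * (∑ b ∈ Finset.range (N+1), wt q (J*o) L O F (q^N) (q^N) (q^N) b * Rc q a (q^a) (q^b) (q^N) o J O * Rc q b (q^b) (q^y) (q^N) L o J)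
     + z * (∑ b ∈ Finset.range (N+1), wt q (J*o) L O F (q^N) (q^N) (q^N) b * Rc q a (q^a) (q^b) (q^N) o J O * Rc q b (q^b) (q^(y+1)) (q^N) L o J) := by
    rw [Finset.mul_sum, Finset.mul_sum, Finset.mul_sum, ← Finset.sum_add_distrib]
    apply Finset.sum_congr rfl
    intro b hb
    have hb' : b ≤ N := by simpa [Nat.lt_succ_iff] using hb
    have r := RII (q:=q) b (q^b) (q^y) (q^N) L o J hq (pow_ne_zero _ hq) hY hN h0 h3 h1
      (by have := g.qne y; exact this)
      (g.ne 1 0 0 1 0 (1+y)) n3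
      (fun k _ => g.ne 0 0 0 1 0 (1+k))
      (fun k hk => g.qne' (by omega))
      (fun k hk => g.ne 1 1 0 1 0 (2+N+k))
      (fun k _ => g.qne k) (Or.inl rfl)
    rw [← hw, ← hz, ← pow_succ] at r
    have s := wt_sh04 g b
    linear_combination Rc q a (q^a) (q^b) (q^N) o J O * Rc q b (q^b) (q^y) (q^N) (L*q) o J * s +
      wt q (J*o) L O F (q^N) (q^N) (q^N) b * Rc q a (q^a) (q^b) (q^N) o J O * r
  rw [H1, H2, ks] at S
  apply mul_left_cancel₀ hzne
  rw [ky]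
  linear_combination -S

end qR

namespace qR

variable {q L J O o F : ℂ} {N : ℕ}

noncomputable def Tq (q : ℂ) (x : ℕ) : ℂ := ∏ l ∈ Finset.range x, q^l

theorem Tq_zero (q : ℂ) : Tq q 0 = 1 := by simp [Tq]

theorem Tq_succ (q : ℂ) (x : ℕ) : Tq q (x+1) = Tq q x * q^x := by simp [Tq, Finset.prod_range_succ]

theorem Tq_sq (q : ℂ) (x : ℕ) : Tq q x * Tq q x * q^x = (q^x)^x := by
  induction x with
  | zero => simp [Tq_zero]
  | succ n ih => rw [Tq_succ]; linear_combination (q^n*q^n*q) * ih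

theorem Tq_ne (hq : q ≠ 0) (x : ℕ) : Tq q x ≠ 0 := by
  rw [Tq]; exact Finset.prod_ne_zero_iff.2 fun l _ => pow_ne_zero _ hq

theorem poch_add (q a : ℂ) (m n : ℕ) : poch q a (m+n) = poch q a m * poch q (a*q^m) n := by
  unfold poch; rw [Finset.prod_range_add]; congr 1
  apply Finset.prod_congr rfl; intro l _; ring

theorem poch_rev {α α' : ℂ} (x : ℕ) (hα : α ≠ 0) (hq : q ≠ 0) (h : α*α'*q^x = q) :
    poch q α x = (-α)^x * Tq q x * poch q α' x := by
  have e : α' = q/(q^x*α) := by rw [eq_div_iff (by simp [*])]; linear_combination h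
  unfold poch Tq
  have hc : (-α)^x = ∏ l ∈ Finset.range x, (-α) := by simp
  rw [← Finset.prod_range_reflect (fun l => (1 - α'*q^l)), hc,
    ← Finset.prod_mul_distrib, ← Finset.prod_mul_distrib]
  apply Finset.prod_congr rfl
  intro l hl
  have hl : l < x := by simpa using hl
  rw [e]
  have : q^(x-1-l) * (q*q^l) = q^x := by rw [← pow_succ', ← pow_add]; congr 1; omega
  have h1 : q^x ≠ 0 := pow_ne_zero _ hq
  field_simp
  linear_combination -this

theorem KK_mirror (M x a y : ℕ) (g : Gn q L J O o F (M+x)) :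
    KK q (M+x) 0 x a y L J O o F = KK q M x 0 y a O o L J F := by
  have ⟨hq, h0, h1, h2, h3, h4⟩ := g.nz
  have hM : q^M ≠ 0 := pow_ne_zero _ hq
  have hX : q^x ≠ 0 := pow_ne_zero _ hq
  have rel : L*J*O*o*F*q^3*q^(M+x)*q^(M+x) = 1 := by rw [← g.rel]; ring
  unfold KK
  simp only [add_zero, pow_zero, mul_one, poch_zero, div_one]
  have r1 := poch_rev (q:=q) (α := J*o*q^2*q^M) (α' := (J*o*q*q^(M+x))⁻¹) x (by simp [*]) hq
    (by rw [pow_add]; field_simp)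
  have r2 := poch_rev (q:=q) (α := q*O) (α' := (O*q^x)⁻¹) x (by simp [*]) hq
    (by field_simp)
  have t : (-(J*o*q^2*q^M))^x * Tq q x * ((-(q*O))^x*Tq q x) * (L*F*q*q^(M+x))^x = 1 := by
    have : (J*o*q^2*q^M*(q*O)*(L*F*q*q^(M+x)))^x*(q^x)^x = q^x := by
      rw [← mul_pow]; congr 1; rw [pow_add] at *; linear_combination q* rel
    have hT := Tq_sq q x
    apply mul_right_cancel₀ hX
    rw [one_mul, neg_pow, neg_pow (q*O)]
    rw [← hT] at this
    have m : (-1:ℂ)^x*(-1)^x = 1 := by rw [← mul_pow]; simp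
    rw [mul_pow, mul_pow (J*o*q^2*q^M)] at this
    linear_combination ((J*o*q^2*q^M)^x*(q*O)^x*(L*F*q*q^(M+x))^x*Tq q x*Tq q x*q^x) * m + this
  have r3 : poch q (J*o*q^2) (M+x) = poch q (J*o*q^2) M * poch q (J*o*q^2*q^M) x := poch_add ..
  have r4 : poch q (F*q) (M+x) = poch q (F*q) x * poch q (F*q*q^x) M := by rw [add_comm, poch_add]
  have r5 : poch q (O*q^(M+x))⁻¹ (M+x) = poch q (O*q^(M+x))⁻¹ M * poch q (O*q^x)⁻¹ x := by
    rw [poch_add]; congr 2; rw [pow_add]; field_simp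
  have r6 : poch q (L*q^(M+x))⁻¹ (M+x) = poch q (L*q^(M+x))⁻¹ x * poch q (L*q^M)⁻¹ M := by
    rw [add_comm M x, poch_add]; congr 2; rw [pow_add]; field_simp
  have d1 : poch q (F*q) x ≠ 0 := poch_ne fun l _ => g.ne 0 0 0 0 1 (1+l)
  have d2 : poch q (L*q^(M+x))⁻¹ x ≠ 0 := poch_ne fun l _ => g.ne (-1) 0 0 0 0 (l-M-x)
  have d3 : poch q (O*q^x)⁻¹ x ≠ 0 := poch_ne fun l _ => g.ne 0 0 (-1) 0 0 (l-x)
  have d4 : poch q (J*o*q*q^(M+x))⁻¹ x ≠ 0 := poch_ne fun l _ => g.ne 0 (-1) 0 (-1) 0 (l-M-x-1)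
  rw [add_comm y a, r3, r4, r5, r6]
  have key : poch q (J*o*q^2*q^M) x * poch q (q*O) x * (L*F*q*q^(M+x))^x = poch q (O*q^x)⁻¹ x * poch q (J*o*q*q^(M+x))⁻¹ x := by
    rw [r1, r2]; linear_combination poch q (O*q^x)⁻¹ x * poch q (J*o*q*q^(M+x))⁻¹ x * t
  clear r1 r2 r3 r4 r5 r6
  have e1 : o*J*q^2 = J*o*q^2 := by ring
  have e2 : o*L*F*q^2*q^(M+x)/q^a = L*o*F*q^2*q^(M+x)/q^a := by ring
  have e3 : O*J*F*q^2*q^(M+x)/q^y = J*O*F*q^2*q^(M+x)/q^y := by ring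
  have e4 : (q^y)^a = (q^a)^y := by rw [← pow_mul, ← pow_mul, mul_comm]
  rw [e1, e2, e3, e4]
  generalize poch q (J*o*q^2*q^M) x = P1, poch q (q*O) x = P2, poch q (O*q^x)⁻¹ x = P3, poch q (J*o*q*q^(M+x))⁻¹ x = P4, poch q (F*q) x = P5, poch q (L*q^(M+x))⁻¹ x = P6, (L*F*q*q^(M+x))^x = v at *
  set S := poch q (J*o*q^2) M * poch q (F*q*q^x) M / (poch q (O*q^(M+x))⁻¹ M * poch q (L*q^M)⁻¹ M) with hS
  have : poch q (J*o*q^2) M * P1 * (P5*poch q (F*q*q^x) M) / (P6*poch q (L*q^M)⁻¹ M * (poch q (O*q^(M+x))⁻¹ M*P3)) *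
    (P6*P2/(P4*P5)*v) = S := by
    trans S * (P1*P2*v*P5*P6/(P3*P4*P5*P6))
    · rw [hS]; simp only [div_eq_mul_inv, mul_inv]; ring
    · rw [key]; field_simp
  rw [this]
  simp only [div_eq_mul_inv, mul_inv]; ring

theorem BE_mirror (M x a y : ℕ) (g : Gn q L J O o F (M+x)) (H : BEp q M x 0 y a O o L J F) :
    BEp q (M+x) 0 x a y L J O o F := by
  have hq := g.hq
  have hX : q^x ≠ 0 := pow_ne_zero _ hq
  unfold BEp at *
  rw [KK_mirror M x a y g]
  have z1 : ∀ (n : ℕ) (U W c c' c'' : ℂ), Rc q n U 1 W c c' c'' = 1 := by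
    intro n U W c c' c''; have := Rc_zeroV q n U W c c' c''; rwa [pow_zero] at this
  have z2 : ∀ (n : ℕ) (V W c c' c'' : ℂ), Rc q n 1 V W c c' c'' = 1 := by
    intro n U W c c' c''; have := Rc_zeroU q n U W c c' c''; rwa [pow_zero] at this
  simp only [add_zero, pow_zero, div_one, z1, z2, mul_one] at *
  rw [Rc_sym q a x _ _ _ _ hq, ← H]
  apply Finset.sum_congr rfl
  intro b _
  rw [Rc_sym q y b _ _ _ _ hq, Rc_sym q b a _ _ _ _ hq]
  have e : q^(M+x)/q^x = q^M := by rw [pow_add]; field_simp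
  rw [e]; unfold wt; rw [mul_comm o J]; ring

theorem L5 (g : Gn q L J O o F N) : BEp q N 0 0 0 0 L J O o F := by
  have ⟨hq, h0, h1, h2, h3, h4⟩ := g.nz
  have hN : q^N ≠ 0 := pow_ne_zero _ hq
  have rel : L*J*O*o*F*q^3*q^N*q^N = 1 := by rw [← g.rel]; ring
  unfold BEp KK
  simp only [add_zero, pow_zero, mul_one, poch_zero, div_one]
  have z1 : ∀ (n : ℕ) (U W c c' c'' : ℂ), Rc q n U 1 W c c' c'' = 1 := by
    intro n U W c c' c''; have := Rc_zeroV q n U W c c' c''; rwa [pow_zero] at this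
  have z2 : ∀ (n : ℕ) (V W c c' c'' : ℂ), Rc q n 1 V W c c' c'' = 1 := by
    intro n U W c c' c''; have := Rc_zeroU q n U W c c' c''; rwa [pow_zero] at this
  simp only [z1, z2, mul_one]
  have e1 : J*o*q*q/(L*(J*o)*q^N*q^2) = (L*q^N)⁻¹ := by field_simp
  have e2 : J*o*q*q/(O*(J*o)*q^N*q^2) = (O*q^N)⁻¹ := by field_simp
  have e3 : J*o*q*q/((L*(J*o)*q^N*q^2)*(O*(J*o)*q^N*q^2)) = F*q := by
    field_simp; linear_combination -rel
  have hA : 1 - J*o*q ≠ 0 := g.ne 0 1 0 1 0 1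
  have s := sum65 q (J*o*q) (L*(J*o)*q^N*q^2) (O*(J*o)*q^N*q^2) N hq (by simp [*]) (by simp [*])
    g.qne (fun k => by rw [e1]; exact g.ne (-1) 0 0 0 0 (k-N))
    (fun k => by rw [e2]; exact g.ne 0 0 (-1) 0 0 (k-N))
    (fun k => g.ne 0 1 0 1 0 (k+2))
  rw [e1, e2, e3] at s
  apply mul_left_cancel₀ hA
  rw [show J*o*q*q = J*o*q^2 by ring] at s
  trans (1-J*o*q) * poch q (J*o*q^2) N * poch q (F*q) N / (poch q (L*q^N)⁻¹ N * poch q (O*q^N)⁻¹ N)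
  swap
  · ring
  rw [← s, Finset.mul_sum]
  apply Finset.sum_congr rfl
  intro b hb
  have hb' : b ≤ N := by simpa [Nat.lt_succ_iff] using hb
  unfold wt pr t65
  have f1 : J*o*q^2/(J*o*q^N*q^2) = (q^N)⁻¹ := by field_simp
  have f2 : J*o*q^2/(L*(J*o)*q^N*q^2) = (L*q^N)⁻¹ := by field_simp
  have f3 : J*o*q^2/(O*(J*o)*q^N*q^2) = (O*q^N)⁻¹ := by field_simp
  have f4 : J*o*q^2/(q^N)⁻¹ = J*o*q^N*q^2 := by field_simp
  have f5 : J*o*q*q*q^N = J*o*q^N*q^2 := by ring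
  have f6 : J*o*q*q*q^N/((L*(J*o)*q^N*q^2)*(O*(J*o)*q^N*q^2)) = F*q^N*q := by
    rw [mul_div_right_comm, e3]; ring
  have f7 : J*o*q*q/(L*(J*o)*q^N*q^2) = (L*q^N)⁻¹ := e1
  rw [f6, f1, f2, f3, f4, e1, e2, f5]
  have d1 : poch q (q^N)⁻¹ b ≠ 0 := poch_ne fun l _ => g.qne' (by omega)
  have d2 : poch q (J*o*q^N*q^2) b ≠ 0 := poch_ne fun l _ => g.ne 0 1 0 1 0 (N+2+l)
  generalize poch q (q^N)⁻¹ b = P1, poch q (J*o*q^N*q^2) b = P2, poch q (L*(J*o)*q^N*q^2) b = P3, poch q (O*(J*o)*q^N*q^2) b = P4, poch q (L*q^N)⁻¹ b = P5, poch q (O*q^N)⁻¹ b = P6, poch q (J*o*q) b = P7, poch q q b = P8, (F*q^N*q)^b = v, 1 - J*o*q = u, 1 - J*o*q*q^b*q^b = u' at *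
  trans (P7*u'*P3*P4*P1/(P8*P5*P6*P2)*v) * (u/u*(P1/P1)*(P2/P2))
  · simp only [div_eq_mul_inv, mul_inv]; ring
  · rw [div_self d1, div_self d2, div_self hA]; ring

theorem BE00y (a : ℕ) (H : ∀ L F, Gn q L J O o F N → BEp q N 0 0 a 0 L J O o F) (y : ℕ) (hy : y ≤ N) :
    ∀ L F, Gn q L J O o F N → BEp q N 0 0 a y L J O o F := by
  induction y with
  | zero => exact H
  | succ y ih =>
    intro L F g
    exact L3 g a y (by omega) (ih (by omega) _ _ g.sh04) (ih (by omega) _ _ g)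

theorem BE00 (g : Gn q L J O o F N) (a y : ℕ) (ha : a ≤ N) (hy : y ≤ N) : BEp q N 0 0 a y L J O o F := by
  apply BE00y a _ y hy _ _ g
  intro L F g
  apply BE_mirror N 0 a 0 g
  apply BE00y 0 _ a ha _ _ g.mirror
  intro L F g
  exact L5 g

end qR

namespace qR

variable {q L J O o F : ℂ} {N : ℕ}

theorem fdiv (hq : q ≠ 0) (f : ℂ → ℂ) (x : ℕ) : (q^x-1)*f (q^x/q) = (q^x-1)*f (q^(x-1)) := by
  rcases x with _ | x
  · simp
  · rw [pow_succ, mul_div_cancel_right₀ _ hq]; simp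

theorem RBSn (n x : ℕ) (W J O o : ℂ) (hq : q ≠ 0) (hW : W ≠ 0) (h1 : J ≠ 0) (h2 : O ≠ 0)
    (hU : 1 - q^(n+1) ≠ 0) (hB1 : 1 - O*o*q*q^(n+1) ≠ 0)
    (hVV : 1 - J*O*q*(q^x)^2 ≠ 0)
    (hD : ∀ k ≤ n, 1 - q*O * q ^ k ≠ 0) (hE : ∀ k ≤ n, 1 - W⁻¹ * q ^ k ≠ 0)
    (hG : ∀ k ≤ n, 1 - J*O*o*q^2*W * q ^ k ≠ 0) (hqq : ∀ k ≤ n, 1 - q * q ^ k ≠ 0) :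
    Rc q (n+1) (q^(n+1)) (q^x) W J O o =
      (1-J*O*q*q^x)*(1-q*O*q^x)*(W-q^x)*(1-J*O*o*q^2*W*q^x)
        /(q^x*(1-J*O*q*(q^x)^2)*(1-q*O)*(W-1)*(1-J*O*o*q^2*W)) *
        Rc q n (q^n) (q^x) (W/q) J (O*q) (o*q)
      + -(q^x-1)*q*O*(1-J*q^x)*(1-J*O*q*q^x*W)*(q^x-o*q*W)
        /(q^x*(1-J*O*q*(q^x)^2)*(1-q*O)*(W-1)*(1-J*O*o*q^2*W)) *
        Rc q n (q^n) (q^(x-1)) (W/q) J (O*q) (o*q) := by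
  rw [RBS n (q^x) W J O o hq (pow_ne_zero _ hq) hW h1 h2 hU hB1 hVV hD hE hG hqq]
  have := fdiv hq (fun V => Rc q n (q^n) V (W/q) J (O*q) (o*q)) x
  linear_combination (-q*O*(1-J*q^x)*(1-J*O*q*q^x*W)*(q^x-o*q*W)
        /(q^x*(1-J*O*q*(q^x)^2)*(1-q*O)*(W-1)*(1-J*O*o*q^2*W))) * this

theorem RT1n (n x : ℕ) (U W J O o : ℂ) (hq : q ≠ 0) (hW : W ≠ 0)
    (hVV : 1 - J*O*q*(q^x)^2 ≠ 0) (hE : ∀ k ≤ n, 1 - W⁻¹ * q ^ k ≠ 0) :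
    Rc q n U (q^x) W J O o =
      (1-J*O*q*q^x)*(W-q^x)/((1-J*O*q*(q^x)^2)*(W-1)) * Rc q n U (q^x) (W/q) (J*q) O o
      + (q^x-1)*(1-J*O*q*q^x*W)/((1-J*O*q*(q^x)^2)*(W-1)) * Rc q n U (q^(x-1)) (W/q) (J*q) O o := by
  rw [RT1 n U (q^x) W J O o hq (pow_ne_zero _ hq) hW hVV hE]
  have := fdiv hq (fun V => Rc q n U V (W/q) (J*q) O o) x
  linear_combination ((1-J*O*q*q^x*W)/((1-J*O*q*(q^x)^2)*(W-1))) * this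

theorem RT2n (n x : ℕ) (U W J O o : ℂ) (hq : q ≠ 0)
    (hVV : 1 - J*O*q*(q^x)^2 ≠ 0) (hG : ∀ k ≤ n, 1 - J*O*o*q^2*W * q ^ k ≠ 0) :
    Rc q n U (q^x) W J O o =
      (1-J*O*q*q^x)*(1-J*O*o*q^2*W*q^x)/((1-J*O*q*(q^x)^2)*(1-J*O*o*q^2*W)) * Rc q n U (q^x) W (J*q) O o
      + -(q^x-1)*J*O*q*(q^x-o*q*W)/((1-J*O*q*(q^x)^2)*(1-J*O*o*q^2*W)) * Rc q n U (q^(x-1)) W (J*q) O o := by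
  rw [RT2 n U (q^x) W J O o hq (pow_ne_zero _ hq) hVV hG]
  have := fdiv hq (fun V => Rc q n U V W (J*q) O o) x
  linear_combination (-J*O*q*(q^x-o*q*W)/((1-J*O*q*(q^x)^2)*(1-J*O*o*q^2*W))) * this

theorem wt_zero (hq : q ≠ 0) (M b : ℕ) (h : M < b) (C L O F Z W : ℂ) : wt q C L O F (q^M) Z W b = 0 := by
  have : poch q (q^M)⁻¹ b = 0 := poch_eq_zero h (by rw [inv_mul_cancel₀ (pow_ne_zero _ hq), sub_self])
  unfold wt pr; rw [this]; simp

/-- alpha tilde, X = q^x, W = q^N -/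
noncomputable def alt (q L J O o F X W : ℂ) : ℂ :=
  (1-O*F*q*X)*(1-q*F*X)*(1-X/W)*(1-J*o*q*W/X)/((1-O*F*q*X^2)*(1-q*F)*(1-J*o*q*W)*(1-W⁻¹))
noncomputable def bet (q L J O o F X W : ℂ) : ℂ :=
  (X-1)*q*F*(1-O*X)*(1-L*(J*o)*q^2*W/X)*(1-X/(L*q*W))/((1-O*F*q*X^2)*(1-q*F)*(1-J*o*q*W)*(1-W⁻¹))

theorem wt_al (g : Gn q L J O o F N) (x b : ℕ) (hb : b < N) (Q : ℂ) :
    (1-O*F*q*q^x)*(1-q*F*q^x)*(q^N/q^b-q^x)*(1-O*F*L*q^2*(q^N/q^b)*q^x)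
        /(q^x*(1-O*F*q*(q^x)^2)*(1-q*F)*(q^N/q^b-1)*(1-O*F*L*q^2*(q^N/q^b)))
      * wt q (J*o) L O F Q (q^N/q^x) (q^N) b =
    alt q L J O o F (q^x) (q^N) * wt q (J*o) (L*q) O (F*q) Q (q^N/q/q^x) (q^N/q) b := by
  have ⟨hq, h0, h1, h2, h3, h4⟩ := g.nz
  have hN : q^N ≠ 0 := pow_ne_zero _ hq
  have hX : q^x ≠ 0 := pow_ne_zero _ hq
  have hB : q^b ≠ 0 := pow_ne_zero _ hq
  have rel : L*J*O*o*F*q^3*q^N*q^N = 1 := by rw [← g.rel]; ring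
  have p1 := pr_shift (q:=q) (J*o) (q^N/q^x)⁻¹ (q^N/q/q^x)⁻¹ b (by simp [*]) (by field_simp) hq
    (poch_ne fun l _ => g.ne 0 1 0 1 0 (1+N-x+l))
    (poch_ne fun l _ => g.ne 0 1 0 1 0 (2+N-x+l))
  have e1 : J*o*q/(J*o*q^N*q) = (q^N)⁻¹ := by field_simp
  have e1' : J*o*q^2/(J*o*q^N*q) = (q^N)⁻¹*q := by field_simp
  have p2 := pr_shift (q:=q) (J*o) (J*o*q^N*q) (J*o*q^N*q^2) b (by simp [*]) (by ring) hq
    (by rw [e1]; exact (poch_ne fun l _ => g.qne' (by omega)))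
    (by rw [e1']; exact (poch_ne fun l _ => by
          have := g.qne' (k:=N) (l := l+1) (by omega); rwa [pow_succ', ← mul_assoc] at this))
  rw [e1] at p2
  have e2 : O*F*L*q^2*(q^N/q^b) = (J*o*q*q^N*q^b)⁻¹ := by
    apply eq_inv_of_mul_eq_one_left; field_simp; linear_combination rel
  unfold wt alt
  have f1 : L*q*(J*o)*(q^N/q/q^x)*q^2 = L*(J*o)*(q^N/q^x)*q^2 := by field_simp
  have f2 : J*o*(q^N/q)*q^2 = J*o*q^N*q := by field_simp
  have f3 : F*q*(q^N/q)*q = F*q^N*q := by field_simp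
  rw [f1, f2, f3, e2]
  have a1 : q^N/q^b-q^x = q^N/q^b*(1-(q^N/q^x)⁻¹*q^b) := by field_simp
  have a2 : 1 - (J*o*q*q^N*q^b)⁻¹*q^x = -q^x*(J*o*q*q^N*q^b)⁻¹*(1-J*o*q/(q^N/q^x)⁻¹*q^b) := by field_simp; ring
  have a3 : q^N/q^b-1 = q^N/q^b*(1-(q^N)⁻¹*q^b) := by field_simp
  have a4 : 1 - (J*o*q*q^N*q^b)⁻¹ = -(J*o*q*q^N*q^b)⁻¹*(1-J*o*q^N*q*q^b) := by field_simp; ring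
  have a5 : 1 - q^x/q^N = 1-(q^N/q^x)⁻¹ := by field_simp
  have a6 : 1 - J*o*q*q^N/q^x = 1 - J*o*q/(q^N/q^x)⁻¹ := by field_simp
  rw [a1, a2, a3, a4, a5, a6, show J*o*q*q^N = J*o*q^N*q by ring]
  have n1 : 1-(q^N)⁻¹*q^b ≠ 0 := g.qne' (by omega)
  have n2 : 1-J*o*q^N*q*q^b ≠ 0 := g.ne 0 1 0 1 0 (1+N+b)
  have n3 : 1-(q^N)⁻¹ ≠ 0 := by have := g.qne' (k:=N) (l:=0) (by omega); simpa using this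
  have n4 : 1-J*o*q^N*q ≠ 0 := g.ne 0 1 0 1 0 (1+N)
  have n5 : (J*o*q^N*q*q^b)⁻¹ ≠ 0 := by simp [*]
  clear a1 a2 a3 a4 a5 a6 e1 e1' e2 f1 f2 f3 g rel
  generalize 1-(q^N)⁻¹*q^b = u1, 1-J*o*q^N*q*q^b = u2, 1-(q^N)⁻¹ = u3, 1-J*o*q^N*q = u4, (J*o*q^N*q*q^b)⁻¹ = u5, pr q (J*o) (J*o*q^N*q^2) b = P1, pr q (J*o) (J*o*q^N*q) b = P2, pr q (J*o) (q^N/q^x)⁻¹ b = P3, pr q (J*o) (q^N/q/q^x)⁻¹ b = P4, 1-(q^N/q^x)⁻¹*q^b = u6, 1-(q^N/q^x)⁻¹ = u8, 1 - J*o*q/(q^N/q^x)⁻¹*q^b = u7, 1 - J*o*q/(q^N/q^x)⁻¹ = u9 at *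
  have hA : q^N/q^b ≠ 0 := by simp [*]
  generalize q^N/q^b = A at *
  have k1 : P1 = u2*u1*P2/(u4*u3) := by rw [eq_div_iff (by simp [*])]; linear_combination p2
  have k2 : (A*u6)*(-q^x*u5*u7)/(q^x*(A*u1)*(-u5*u2)) * P3 * P1 = u8*u9/(u4*u3)*P4*P2 := by
    trans A/A*(u5/u5)*(q^x/q^x)*(u6*u7*P3)*P1/(u1*u2)
    · simp only [div_eq_mul_inv, mul_inv, inv_neg]; ring
    · rw [div_self (by simp [*]), div_self n5, div_self hX, k1, ← p1]
      simp only [one_mul]; field_simp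
  generalize L*(J*o)*(q^N/q^x)*q^2 = b1, poch q (J*o*q) b / poch q q b * ((1-J*o*q*q^b*q^b)/(1-J*o*q)) = b2, 1-O*F*q*q^x = b3, 1-q*F*q^x = b4, 1-O*F*q*(q^x)^2 = b5, 1-q*F = b6, (F*q^N*q)^b = b8
  linear_combination (b3*b4/(b5*b6)*b2*pr q (J*o) b1 b * pr q (J*o) (O*(J*o)*Q*q^2) b * pr q (J*o) Q⁻¹ b * b8) * k2

end qR

namespace qR

variable {q L J O o F : ℂ} {N : ℕ}

theorem wt_be (g : Gn q L J O o F N) (x b : ℕ) (hb : b < N) (Q : ℂ) :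
    -(q^x-1)*q*F*(1-O*q^x)*(1-O*F*q*q^x*(q^N/q^b))*(q^x-L*q*(q^N/q^b))
        /(q^x*(1-O*F*q*(q^x)^2)*(1-q*F)*(q^N/q^b-1)*(1-O*F*L*q^2*(q^N/q^b)))
      * wt q (J*o) L O F Q (q^N/q^x) (q^N) b =
    bet q L J O o F (q^x) (q^N) * wt q (J*o) (L*q) O (F*q) Q (q^N/q^x) (q^N/q) b := by
  have ⟨hq, h0, h1, h2, h3, h4⟩ := g.nz
  have hN : q^N ≠ 0 := pow_ne_zero _ hq
  have hX : q^x ≠ 0 := pow_ne_zero _ hq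
  have hB : q^b ≠ 0 := pow_ne_zero _ hq
  have rel : L*J*O*o*F*q^3*q^N*q^N = 1 := by rw [← g.rel]; ring
  have e0 : J*o*q/(L*(J*o)*(q^N/q^x)*q^2) = q^x/(L*q*q^N) := by field_simp
  have e0' : J*o*q^2/(L*(J*o)*(q^N/q^x)*q^2) = q^x/(L*q^N) := by field_simp
  have p1 := pr_shift (q:=q) (J*o) (L*(J*o)*(q^N/q^x)*q^2) (L*q*(J*o)*(q^N/q^x)*q^2) b (by simp [*]) (by ring) hq
    (by rw [e0]; exact (poch_ne fun l _ => g.ne (-1) 0 0 0 0 (x-1-N+l)))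
    (by rw [e0']; exact (poch_ne fun l _ => g.ne (-1) 0 0 0 0 (x-N+l)))
  rw [e0] at p1
  have e1 : J*o*q/(J*o*q^N*q) = (q^N)⁻¹ := by field_simp
  have e1' : J*o*q^2/(J*o*q^N*q) = (q^N)⁻¹*q := by field_simp
  have p2 := pr_shift (q:=q) (J*o) (J*o*q^N*q) (J*o*q^N*q^2) b (by simp [*]) (by ring) hq
    (by rw [e1]; exact (poch_ne fun l _ => g.qne' (by omega)))
    (by rw [e1']; exact (poch_ne fun l _ => by
          have := g.qne' (k:=N) (l := l+1) (by omega); rwa [pow_succ', ← mul_assoc] at this))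
  rw [e1] at p2
  have e2 : O*F*L*q^2*(q^N/q^b) = (J*o*q*q^N*q^b)⁻¹ := by
    apply eq_inv_of_mul_eq_one_left; field_simp; linear_combination rel
  have e3 : O*F*q*q^x*(q^N/q^b) = (L*(J*o)*(q^N/q^x)*q^2*q^b)⁻¹ := by
    apply eq_inv_of_mul_eq_one_left; field_simp; linear_combination rel
  unfold wt bet
  have f2 : J*o*(q^N/q)*q^2 = J*o*q^N*q := by field_simp
  have f3 : F*q*(q^N/q)*q = F*q^N*q := by field_simp
  rw [f2, f3, e2, e3]
  have a1 : q^x-L*q*(q^N/q^b) = -(L*q*q^N/q^b)*(1-q^x/(L*q*q^N)*q^b) := by field_simp; ring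
  have a2 : 1 - (L*(J*o)*(q^N/q^x)*q^2*q^b)⁻¹ = -(L*(J*o)*(q^N/q^x)*q^2*q^b)⁻¹*(1-L*(J*o)*(q^N/q^x)*q^2*q^b) := by field_simp; ring
  have a3 : q^N/q^b-1 = q^N/q^b*(1-(q^N)⁻¹*q^b) := by field_simp
  have a4 : 1 - (J*o*q*q^N*q^b)⁻¹ = -(J*o*q*q^N*q^b)⁻¹*(1-J*o*q^N*q*q^b) := by field_simp; ring
  have a6 : 1 - L*(J*o)*q^2*q^N/q^x = 1 - L*(J*o)*(q^N/q^x)*q^2 := by field_simp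
  rw [a1, a2, a3, a4, a6]
  have n1 : 1-(q^N)⁻¹*q^b ≠ 0 := g.qne' (by omega)
  have n2 : 1-J*o*q^N*q*q^b ≠ 0 := g.ne 0 1 0 1 0 (1+N+b)
  have n3 : 1-(q^N)⁻¹ ≠ 0 := by have := g.qne' (k:=N) (l:=0) (by omega); simpa using this
  have n4 : 1-J*o*q^N*q ≠ 0 := g.ne 0 1 0 1 0 (1+N)
  have k0 : (L*q*q^N/q^b)*(L*(J*o)*(q^N/q^x)*q^2*q^b)⁻¹/(q^x*(q^N/q^b)*(J*o*q*q^N*q^b)⁻¹) = 1 := by field_simp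
  rw [show J*o*q*q^N = J*o*q^N*q by ring] at *
  clear a1 a2 a3 a4 a6 e1 e1' e2 e3 e0 e0' f2 f3 g rel
  generalize 1-(q^N)⁻¹*q^b = u1, 1-J*o*q^N*q*q^b = u2, 1-(q^N)⁻¹ = u3, 1-J*o*q^N*q = u4, (J*o*q^N*q*q^b)⁻¹ = u5, (L*(J*o)*(q^N/q^x)*q^2*q^b)⁻¹ = u10, (L*q*q^N/q^b) = u11, pr q (J*o) (J*o*q^N*q^2) b = P1, pr q (J*o) (J*o*q^N*q) b = P2, pr q (J*o) (L*(J*o)*(q^N/q^x)*q^2) b = P3, pr q (J*o) (L*q*(J*o)*(q^N/q^x)*q^2) b = P4, 1-L*(J*o)*(q^N/q^x)*q^2*q^b = u6, 1-L*(J*o)*(q^N/q^x)*q^2 = u8, 1 - q^x/(L*q*q^N)*q^b = u7, 1 - q^x/(L*q*q^N) = u9, q^N/q^b = A at *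
  have k1 : P1 = u2*u1*P2/(u4*u3) := by rw [eq_div_iff (by simp [*])]; linear_combination p2
  have k2 : (-u11*u7)*(-u10*u6)/(q^x*(A*u1)*(-u5*u2)) * P3 * P1 = -u8*u9/(u4*u3)*P4*P2 := by
    trans -(u11*u10/(q^x*A*u5))*(u6*u7*P3)*P1/(u1*u2)
    · simp only [div_eq_mul_inv, mul_inv, inv_neg]; ring
    · rw [k0, k1, ← p1]
      field_simp
  generalize poch q (J*o*q) b / poch q q b * ((1-J*o*q*q^b*q^b)/(1-J*o*q)) = b2, 1-O*q^x = b3, (q^x-1) = b4, 1-O*F*q*(q^x)^2 = b5, 1-q*F = b6, (F*q^N*q)^b = b8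
  linear_combination (-b4*q*F*b3/(b5*b6)*b2*pr q (J*o) (q^N/q^x)⁻¹ b * pr q (J*o) (O*(J*o)*Q*q^2) b * pr q (J*o) Q⁻¹ b * b8) * k2

/-- summand -/
noncomputable def BS (q : ℂ) (M j x a y : ℕ) (L J O o F : ℂ) (b : ℕ) : ℂ :=
    wt q (J*o) L O F (q^M) (q^(M+j)/q^x) (q^(M+j)) b
    * Rc q a (q^a) (q^b) (q^M) o J O * Rc q j (q^j) (q^x) (q^(M+j)/q^b) O F L
    * Rc q b (q^b) (q^y) (q^(M+j)/q^x) L o J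

theorem BS_step (M j x a y b : ℕ) (g : Gn q L J O o F (M+j+1)) (hx : x ≤ M+j+1) (hb : b ≤ M) :
    BS q M (j+1) x a y L J O o F b =
      alt q L J O o F (q^x) (q^(M+j+1)) *
        ((1-L*o*q*q^y)*(q^(M+j+1)/q^x-q^y)/((1-L*o*q*(q^y)^2)*(q^(M+j+1)/q^x-1)) * BS q M j x a y (L*q) J O o (F*q) b
        + (q^y-1)*(1-L*o*q*q^y*(q^(M+j+1)/q^x))/((1-L*o*q*(q^y)^2)*(q^(M+j+1)/q^x-1)) * BS q M j x a (y-1) (L*q) J O o (F*q) b)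
      + bet q L J O o F (q^x) (q^(M+j+1)) *
        ((1-L*o*q*q^y)*(1-L*o*J*q^2*(q^(M+j+1)/q^x)*q^y)/((1-L*o*q*(q^y)^2)*(1-L*o*J*q^2*(q^(M+j+1)/q^x))) * BS q M j (x-1) a y (L*q) J O o (F*q) b
        + -(q^y-1)*L*o*q*(q^y-J*q*(q^(M+j+1)/q^x))/((1-L*o*q*(q^y)^2)*(1-L*o*J*q^2*(q^(M+j+1)/q^x))) * BS q M j (x-1) a (y-1) (L*q) J O o (F*q) b) := by
  have ⟨hq, h0, h1, h2, h3, h4⟩ := g.nz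
  have wa := wt_al g x b (by omega) (q^M)
  have wb := wt_be g x b (by omega) (q^M)
  have eW : q^(M+j+1)/q = q^(M+j) := by rw [pow_succ]; field_simp
  have hW : q^(M+j+1) ≠ 0 := pow_ne_zero _ hq
  have hX : q^x ≠ 0 := pow_ne_zero _ hq
  have hB : q^b ≠ 0 := pow_ne_zero _ hq
  have rel : L*J*O*o*F*q^3*q^(M+j+1)*q^(M+j+1) = 1 := by rw [← g.rel]; ring
  have r := RBSn (q:=q) j x (q^(M+j+1)/q^b) O F L hq (by simp [*]) h2 h4
    (by have := g.qne j; rwa [pow_succ'])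
    (g.ne 1 0 0 0 1 (2+j))
    (g.ne 0 0 1 0 1 (1+x+x))
    (fun k _ => g.ne 0 0 0 0 1 (1+k))
    (fun k hk => by
      have := g.qne' (k := M+j+1) (l := b+k) (by omega)
      rwa [show (q^(M+j+1)/q^b)⁻¹ * q^k = (q^(M+j+1))⁻¹*q^(b+k) by rw [pow_add q b]; field_simp])
    (fun k _ => g.ne 1 0 1 0 1 (2+(M+j+1)-b+k))
    (fun k _ => g.qne k)
  have eW2 : q^(M+j+1)/q^b/q = q^(M+j)/q^b := by rw [← eW]; ring
  have eW3 : q^(M+j+1)/q^x/q = q^(M+j)/q^x := by rw [← eW]; ring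
  rw [eW2] at r
  rw [eW] at wa wb
  have nY : 1 - L*o*q*(q^y)^2 ≠ 0 := g.ne 1 0 0 1 0 (1+y+y)
  set W := q^(M+j+1) with hWdef
  set u := (1-L*o*q*q^y)*(W/q^x-q^y)/((1-L*o*q*(q^y)^2)*(W/q^x-1)) with hu
  set v := (q^y-1)*(1-L*o*q*q^y*(W/q^x))/((1-L*o*q*(q^y)^2)*(W/q^x-1)) with hv
  set u2 := (1-L*o*q*q^y)*(1-L*o*J*q^2*(W/q^x)*q^y)/((1-L*o*q*(q^y)^2)*(1-L*o*J*q^2*(W/q^x))) with hu2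
  set v2 := -(q^y-1)*L*o*q*(q^y-J*q*(W/q^x))/((1-L*o*q*(q^y)^2)*(1-L*o*J*q^2*(W/q^x))) with hv2
  have F1 : alt q L J O o F (q^x) W * (wt q (J*o) (L*q) O (F*q) (q^M) (q^(M+j)/q^x) (q^(M+j)) b
        * Rc q b (q^b) (q^y) (W/q^x) L o J) =
      alt q L J O o F (q^x) W * (wt q (J*o) (L*q) O (F*q) (q^M) (q^(M+j)/q^x) (q^(M+j)) b
        * (u * Rc q b (q^b) (q^y) (q^(M+j)/q^x) (L*q) o J + v * Rc q b (q^b) (q^(y-1)) (q^(M+j)/q^x) (L*q) o J)) := by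
    by_cases hxN : x = M+j+1
    · have : alt q L J O o F (q^x) W = 0 := by
        rw [hWdef, hxN]; unfold alt; rw [div_self hW]; simp
      rw [this]; simp
    · congr 1
      by_cases hbx : b ≤ M+j-x
      · congr 1
        have rr := RT1n (q:=q) b y (q^b) (W/q^x) L o J hq (by simp [*]) nY (fun k hk => by
          have := g.qne' (k := M+j+1) (l := x+k) (by omega)
          rwa [show (W/q^x)⁻¹ * q^k = (q^(M+j+1))⁻¹*q^(x+k) by rw [pow_add q x, hWdef]; field_simp])
        rw [rr, eW3]
      · have : wt q (J*o) (L*q) O (F*q) (q^M) (q^(M+j)/q^x) (q^(M+j)) b = 0 := by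
          have e : q^(M+j)/q^x = q^(M+j-x) := by
            rw [div_eq_iff hX, ← pow_add]; congr 1; omega
          have : poch q (q^(M+j-x))⁻¹ b = 0 := poch_eq_zero (l := M+j-x) (by omega) (by rw [inv_mul_cancel₀ (pow_ne_zero _ hq), sub_self])
          rw [e]; unfold wt pr; rw [this]; simp
        rw [this]; simp
  have F2 : Rc q b (q^b) (q^y) (W/q^x) L o J =
      u2 * Rc q b (q^b) (q^y) (W/q^x) (L*q) o J + v2 * Rc q b (q^b) (q^(y-1)) (W/q^x) (L*q) o J := by
    have rr := RT2n (q:=q) b y (q^b) (W/q^x) L o J hq nY (fun k hk =>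
        g.ne 1 1 0 1 0 (2+(M+j+1)-x+k))
    rw [rr]
  have hbx : bet q L J O o F (q^x) W = 0 ∨ W/q^x = q^(M+j)/q^(x-1) := by
    rcases x with _ | x
    · left; simp [bet]
    · right; rw [hWdef, pow_succ q (M+j), pow_succ q x]; simp; field_simp
  unfold BS
  rw [show M+(j+1) = M+j+1 by ring, ← hWdef, r]
  have B : bet q L J O o F (q^x) W * (wt q (J*o) (L*q) O (F*q) (q^M) (W/q^x) (q^(M+j)) b
      * Rc q b (q^b) (q^y) (W/q^x) L o J) = bet q L J O o F (q^x) W * (wt q (J*o) (L*q) O (F*q) (q^M) (q^(M+j)/q^(x-1)) (q^(M+j)) b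
       * (u2 * Rc q b (q^b) (q^y) (q^(M+j)/q^(x-1)) (L*q) o J + v2 * Rc q b (q^b) (q^(y-1)) (q^(M+j)/q^(x-1)) (L*q) o J)) := by
    rw [F2]
    rcases hbx with h | h
    · rw [h]; simp
    · rw [h]
  linear_combination (Rc q a (q^a) (q^b) (q^M) o J O * Rc q j (q^j) (q^x) (q^(M+j)/q^b) O (F*q) (L*q) * Rc q b (q^b) (q^y) (W/q^x) L o J) * wa
   + (Rc q a (q^a) (q^b) (q^M) o J O * Rc q j (q^j) (q^(x-1)) (q^(M+j)/q^b) O (F*q) (L*q) * Rc q b (q^b) (q^y) (W/q^x) L o J) * wb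
   + (Rc q a (q^a) (q^b) (q^M) o J O * Rc q j (q^j) (q^x) (q^(M+j)/q^b) O (F*q) (L*q)) * F1
   + (Rc q a (q^a) (q^b) (q^M) o J O * Rc q j (q^j) (q^(x-1)) (q^(M+j)/q^b) O (F*q) (L*q)) * B

end qR

namespace qR

variable {q L J O o F : ℂ} {N : ℕ}

theorem KKrho (M j x a y : ℕ) (g : Gn q L J O o F (M+j+1)) (ha : a ≤ M) (hy : y < M+j+1) :
    KK q M j x a y (L*q) J O o (F*q) = KK q M (j+1) x a y L J O o F *
     (((1-(J*o*q*q^(M+j+1))⁻¹)/(1-(J*o*q*q^(M+j+1))⁻¹*q^x))*((1-F*q)/(1-F*q*q^x))*(q^x/q^y)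
      *((1-q*L*q^y)/(1-q*L))*((1-L*o*F*q^2*q^(M+j+1)/q^a*q^y)/(1-L*o*F*q^2*q^(M+j+1)/q^a))
      *((1-(q^(M+j+1))⁻¹*(q^a*q^y))*(1-(q^(M+j+1))⁻¹)/((1-(q^(M+j+1))⁻¹*q^a)*(1-(q^(M+j+1))⁻¹*q^y)))) := by
  have ⟨hq, h0, h1, h2, h3, h4⟩ := g.nz
  have eW : q^(M+j) = q^(M+j+1)/q := by rw [pow_succ]; field_simp
  have hX : q^x ≠ 0 := pow_ne_zero _ hq
  have hY : q^y ≠ 0 := pow_ne_zero _ hq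
  have hA : q^a ≠ 0 := pow_ne_zero _ hq
  have n1 : 1-(J*o*q*q^(M+j+1))⁻¹ ≠ 0 := g.ne 0 (-1) 0 (-1) 0 (-1-(M+j+1))
  have n2 : 1-F*q ≠ 0 := g.ne 0 0 0 0 1 1
  have n3 : 1-q*L ≠ 0 := g.ne 1 0 0 0 0 1
  have n4 : 1-L*o*F*q^2*q^(M+j+1)/q^a ≠ 0 := g.ne 1 0 0 1 1 (2+(M+j+1)-a)
  have n5 : 1-(q^(M+j+1))⁻¹ ≠ 0 := by have := g.qne' (k:=M+j+1) (l:=0) (by omega); simpa using this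
  have n6 : 1-(q^(M+j+1))⁻¹*q^a ≠ 0 := g.qne' (by omega)
  have n7 : 1-(q^(M+j+1))⁻¹*q^y ≠ 0 := g.qne' (by omega)
  have n8 : 1-(J*o*q*q^(M+j+1))⁻¹*q^x ≠ 0 := g.ne 0 (-1) 0 (-1) 0 (-1-(M+j+1)+x)
  have n9 : 1-F*q*q^x ≠ 0 := g.ne 0 0 0 0 1 (1+x)
  have hW : q^(M+j+1) ≠ 0 := pow_ne_zero _ hq
  unfold KK
  rw [show M+(j+1) = M+j+1 by ring, eW]
  generalize q^(M+j+1) = W at *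
  rw [show F*q*q*q^j = F*q*q^(j+1) by ring, show L*q*(W/q) = L*W by field_simp, show F*q*(W/q) = F*W by field_simp,
    show J*O*(F*q)*q^2*(W/q)/q^y = J*O*F*q^2*W/q^y by field_simp, show O*(F*q)*q*(W/q) = O*F*q*W by field_simp]
  have p1 : poch q (J*o*q*(W/q))⁻¹ x = _ := poch_up (α := (J*o*q*W)⁻¹) x (by field_simp) n1
  have p2 : poch q (F*q*q) x = _ := poch_up (α := F*q) x rfl n2
  have p3 : (L*q*(F*q)*q*(W/q))^x = (L*F*q*W)^x*q^x := by rw [← mul_pow]; congr 1; field_simp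
  have p3' : (L*q*(F*q)*q*(W/q))^y = (L*F*q*W)^y*q^y := by rw [← mul_pow]; congr 1; field_simp
  have p4 : poch q (q*(L*q)) y = _ := poch_up (α := q*L) y (by ring) n3
  have p5 : poch q (L*q*o*(F*q)*q^2*(W/q)/q^a) y = _ := poch_up (α := L*o*F*q^2*W/q^a) y (by field_simp) n4
  have p6 (n : ℕ) : poch q (W/q)⁻¹ n = _ := poch_up (α := W⁻¹) n (by field_simp) n5
  rw [p1, p2, p3, p3', p4, p5, p6, p6, p6, pow_add q a y]
  clear g p1 p2 p3 p3' p4 p5 p6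
  generalize 1-(J*o*q*W)⁻¹*q^x = u1, 1-(J*o*q*W)⁻¹ = u2, 1-F*q*q^x = u3, 1-F*q = u4, 1-W⁻¹*q^a = u5, 1-W⁻¹*q^y = u6, 1-W⁻¹ = u7 at *
  generalize J*O*F*q^2*W/q^y = b1, L*o*F*q^2*W/q^a = b2, (L*W)⁻¹ = b3, (O*q^M)⁻¹ = b4, (J*o*q*W)⁻¹ = b5, (F*W)⁻¹ = b6, (O*F*q*W)^a = b7, (L*F*q*W)^y = b8
  generalize (1-q*L*q^y) = u8, (1-q*L) = u9 at *
  trans (poch q (J*o*q^2) M * poch q (F*q*q^(j+1)) M / (poch q b3 M * poch q b4 M) * (poch q b3 x * poch q (q*O) x / (poch q b5 x * poch q (F*q) x) * (L*F*q*W)^x)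
     * (poch q (q*O) a * poch q b1 a * poch q (q*L) y * poch q b2 y
     * poch q W⁻¹ (a+y) / (poch q (q*J) a * poch q (q*o) y * poch q b6 (a+y) * poch q W⁻¹ a
      * poch q W⁻¹ y) / b7 / b8 * (q^a)^y)) * ((u2/u1)*(u4/u3)*(q^x/q^y)*(u8/u9)*((1-b2*q^y)/(1-b2))*((1-W⁻¹*(q^a*q^y))/u7*(u7/u5)*(u7/u6)))
  · simp only [div_eq_mul_inv, mul_inv, inv_inv]; ring
  · congr 2; field_simp

theorem KKxs (M j x a y : ℕ) (L J O o F : ℂ) :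
    KK q M j (x+1) a y L J O o F = KK q M j x a y L J O o F *
      ((1-(L*q^(M+j))⁻¹*q^x)*(1-q*O*q^x)/((1-(J*o*q*q^(M+j))⁻¹*q^x)*(1-F*q*q^x))*(L*F*q*q^(M+j))) := by
  unfold KK
  simp only [poch_succ]
  rw [pow_succ (L*F*q*q^(M+j)) x]
  simp only [div_eq_mul_inv, mul_inv, inv_inv]; ring

theorem KKsig (M j x a y : ℕ) (g : Gn q L J O o F (M+j+1)) (ha : a ≤ M) (hy : y < M+j+1) :
    KK q M (j+1) x a (y+1) L J O o F = KK q M j x a y (L*q) J O o (F*q) *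
     (((1-(J*o*q*q^(M+j+1))⁻¹*q^x)/(1-(J*o*q*q^(M+j+1))⁻¹))*((1-F*q*q^x)/(1-F*q))*(q^y/q^x)
      *((1-J*O*F*q*q^(M+j+1)/q^y)/(1-J*O*F*q*q^(M+j+1)/q^y*q^a))
      *(1-q*L)*(1-L*o*F*q^2*q^(M+j+1)/q^a)*(1-(q^(M+j+1))⁻¹*q^a)/(1-(q^(M+j+1))⁻¹)
      /((1-q*o*q^y)*(1-(F*q^(M+j+1))⁻¹*(q^a*q^y)))/(L*F*q*q^(M+j+1))*q^a) := by
  have ⟨hq, h0, h1, h2, h3, h4⟩ := g.nz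
  have eW : q^(M+j) = q^(M+j+1)/q := by rw [pow_succ]; field_simp
  have hX : q^x ≠ 0 := pow_ne_zero _ hq
  have hY : q^y ≠ 0 := pow_ne_zero _ hq
  have hA : q^a ≠ 0 := pow_ne_zero _ hq
  have n1 : 1-(J*o*q*q^(M+j+1))⁻¹ ≠ 0 := g.ne 0 (-1) 0 (-1) 0 (-1-(M+j+1))
  have n2 : 1-F*q ≠ 0 := g.ne 0 0 0 0 1 1
  have n4 : 1-J*O*F*q*q^(M+j+1)/q^y*q^a ≠ 0 := g.ne 0 1 1 0 1 (1+(M+j+1)-y+a)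
  have n5 : 1-(q^(M+j+1))⁻¹ ≠ 0 := by have := g.qne' (k:=M+j+1) (l:=0) (by omega); simpa using this
  have n6 : 1-(q^(M+j+1))⁻¹*q^a ≠ 0 := g.qne' (by omega)
  have n8 : 1-(J*o*q*q^(M+j+1))⁻¹*q^x ≠ 0 := g.ne 0 (-1) 0 (-1) 0 (-1-(M+j+1)+x)
  have n9 : 1-F*q*q^x ≠ 0 := g.ne 0 0 0 0 1 (1+x)
  have hW : q^(M+j+1) ≠ 0 := pow_ne_zero _ hq
  unfold KK
  rw [show M+(j+1) = M+j+1 by ring, eW]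
  generalize q^(M+j+1) = W at *
  rw [show F*q*q*q^j = F*q*q^(j+1) by ring, show L*q*(W/q) = L*W by field_simp, show F*q*(W/q) = F*W by field_simp,
    show J*O*(F*q)*q^2*(W/q)/q^y = J*O*F*q^2*W/q^y by field_simp, show O*(F*q)*q*(W/q) = O*F*q*W by field_simp]
  have p1 : poch q (J*o*q*(W/q))⁻¹ x = _ := poch_up (α := (J*o*q*W)⁻¹) x (by field_simp) n1
  have p2 : poch q (F*q*q) x = _ := poch_up (α := F*q) x rfl n2
  have p3 : (L*q*(F*q)*q*(W/q))^x = (L*F*q*W)^x*q^x := by rw [← mul_pow]; congr 1; field_simp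
  have p3' : (L*q*(F*q)*q*(W/q))^y = (L*F*q*W)^y*q^y := by rw [← mul_pow]; congr 1; field_simp
  have p4 : poch q (J*O*F*q^2*W/q^(y+1)) a = poch q (J*O*F*q^2*W/q^y) a * ((1-J*O*F*q*W/q^y)/(1-J*O*F*q*W/q^y*q^a)) := by
    rw [show J*O*F*q^2*W/q^(y+1) = J*O*F*q*W/q^y by rw [pow_succ q y]; field_simp]
    exact poch_dn a (by field_simp) n4
  have p5 : poch q W⁻¹ a = poch q (W/q)⁻¹ a * ((1-W⁻¹)/(1-W⁻¹*q^a)) := poch_dn a (by field_simp) n6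
  have p6 (n : ℕ) : poch q W⁻¹ (n+1) = (1-W⁻¹)*poch q (W/q)⁻¹ n := by
    rw [poch_succ', show W⁻¹*q = (W/q)⁻¹ by field_simp]
  have p7 : poch q (q*L) (y+1) = (1-q*L)*poch q (q*(L*q)) y := by rw [poch_succ', mul_assoc]
  have p8 : poch q (L*o*F*q^2*W/q^a) (y+1) = (1-L*o*F*q^2*W/q^a)*poch q (L*q*o*(F*q)*q^2*(W/q)/q^a) y := by
    rw [poch_succ']; congr 2; field_simp
  rw [p1, p2, p3, p3', p4, p5, ← add_assoc, p6, p6, p7, p8, poch_succ q (q*o), poch_succ q (F*W)⁻¹, pow_add q a y,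
   pow_succ (L*F*q*W) y, pow_succ (q^a) y]
  clear g p1 p2 p3 p3' p4 p5 p6 p7 p8
  generalize 1-(J*o*q*W)⁻¹*q^x = u1, 1-(J*o*q*W)⁻¹ = u2, 1-F*q*q^x = u3, 1-F*q = u4, 1-W⁻¹*q^a = u5, 1-W⁻¹ = u7, J*O*F*q*W/q^y = b1 at *
  generalize J*O*F*q^2*W/q^y = b1', (1-L*o*F*q^2*W/q^a) = b2, (L*q*o*(F*q)*q^2*(W/q)/q^a) = b2', (L*W)⁻¹ = b3, (O*q^M)⁻¹ = b4, (J*o*q*W)⁻¹ = b5, (F*W)⁻¹ = b6, (O*F*q*W)^a = b7, (L*F*q*W)^y = b8, (L*F*q*W)^x = b8'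
  generalize (1-q*L) = u9, (1-q*o*q^y) = u10, (1-b6*(q^a*q^y)) = u11 at *
  generalize (L*F*q*W) = b9
  trans (poch q (J*o*q^2) M * poch q (F*q*q^(j+1)) M / (poch q b3 M * poch q b4 M) * (poch q b3 x * poch q (q*O) x / (poch q b5 x * poch q (F*q) x) * b8')
     * (poch q (q*O) a * poch q b1' a * poch q (q*(L*q)) y * poch q b2' y
     * poch q (W/q)⁻¹ (a+y) / (poch q (q*J) a * poch q (q*o) y * poch q b6 (a+y) * poch q (W/q)⁻¹ a
      * poch q (W/q)⁻¹ y) / b7 / b8 * (q^a)^y)) * (((1-b1)/(1-b1*q^a))*u9*b2/(u10*u11)/b9*q^a*(u5/u7))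
  · have : u7*u7⁻¹ = 1 := mul_inv_cancel₀ n5
    trans (poch q (J*o*q^2) M * poch q (F*q*q^(j+1)) M / (poch q b3 M * poch q b4 M) * (poch q b3 x * poch q (q*O) x / (poch q b5 x * poch q (F*q) x) * b8')
     * (poch q (q*O) a * poch q b1' a * poch q (q*(L*q)) y * poch q b2' y
     * poch q (W/q)⁻¹ (a+y) / (poch q (q*J) a * poch q (q*o) y * poch q b6 (a+y) * poch q (W/q)⁻¹ a
      * poch q (W/q)⁻¹ y) / b7 / b8 * (q^a)^y)) * (((1-b1)/(1-b1*q^a))*u9*b2/(u10*u11)/b9*q^a*(u7*u7⁻¹*(u5/u7)))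
    · simp only [div_eq_mul_inv, mul_inv, inv_inv]; ring
    · rw [this, one_mul]
  · trans (poch q (J*o*q^2) M * poch q (F*q*q^(j+1)) M / (poch q b3 M * poch q b4 M) * (poch q b3 x * poch q (q*O) x / (poch q b5 x * poch q (F*q) x) * b8')
     * (poch q (q*O) a * poch q b1' a * poch q (q*(L*q)) y * poch q b2' y
     * poch q (W/q)⁻¹ (a+y) / (poch q (q*J) a * poch q (q*o) y * poch q b6 (a+y) * poch q (W/q)⁻¹ a
      * poch q (W/q)⁻¹ y) / b7 / b8 * (q^a)^y)) * (((1-b1)/(1-b1*q^a))*u9*b2/(u10*u11)/b9*q^a*(u5/u7)*((u1/u1)*(u2/u2)*(u3/u3)*(u4/u4)*(q^x/q^x)*(q^y/q^y)))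
    · rw [div_self n8, div_self n1, div_self n9, div_self n2, div_self hX, div_self hY]; simp only [mul_one]
    · simp only [div_eq_mul_inv, mul_inv, inv_inv]; ring

end qR

namespace qR

theorem core (q L J O o F X Y A W : ℂ) (hq : q ≠ 0) (h0 : L ≠ 0) (h1 : J ≠ 0) (h2 : O ≠ 0) (h3 : o ≠ 0) (h4 : F ≠ 0) (hX : X ≠ 0) (hY : Y ≠ 0) (hA : A ≠ 0) (hW : W ≠ 0)
    (rel : L*J*O*o*F*q^3*W*W = 1)
    (n_a2 : 1-q*F*X ≠ 0)
    (n_a4 : X-J*o*q*W ≠ 0)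
    (n_a5 : 1-O*F*q*X^2 ≠ 0)
    (n_a6 : 1-q*F ≠ 0)
    (n_a7 : 1-J*o*q*W ≠ 0)
    (n_a8 : W-1 ≠ 0)
    (n_a11 : 1-L*o*q*Y^2 ≠ 0)
    (n_a13 : 1-q*L ≠ 0)
    (n_a15 : A-L*o*F*q^2*W ≠ 0)
    (n_a17 : W-A ≠ 0)
    : (W-X ≠ 0 → W-Y ≠ 0 → ((1-O*F*q*X)*(1-q*F*X)*(1-X/W)*(1-J*o*q*W/X)/((1-O*F*q*X^2)*(1-q*F)*(1-J*o*q*W)*(1-W⁻¹))) * ((1-L*o*q*Y)*(W/X-Y)/((1-L*o*q*Y^2)*(W/X-1))) * (((1-(J*o*q*W)⁻¹)/(1-(J*o*q*W)⁻¹*X))*((1-F*q)/(1-F*q*X))*(X/Y)*((1-q*L*Y)/(1-q*L))*((1-L*o*F*q^2*W/A*Y)/(1-L*o*F*q^2*W/A))*((1-W⁻¹*(A*Y))*(1-W⁻¹)/((1-W⁻¹*A)*(1-W⁻¹*Y)))) = ((1-o*L*q*Y)*(1-q*L*Y)*(W/A-Y)*(1-o*L*F*q^2*(W/A)*Y)/(Y*(1-o*L*q*Y^2)*(1-q*L)*(W/A-1)*(1-o*L*F*q^2*(W/A))))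 * ((1-F*O*q*X)*(W/Y-X)/((1-F*O*q*X^2)*(W/Y-1)))) ∧
    (W-X ≠ 0 → L*o*q*W*Y-1 ≠ 0 → L*o*q*W*Y-A ≠ 0 → 1-o*Y ≠ 0 → F*W*q-A*Y ≠ 0 → ((1-O*F*q*X)*(1-q*F*X)*(1-X/W)*(1-J*o*q*W/X)/((1-O*F*q*X^2)*(1-q*F)*(1-J*o*q*W)*(1-W⁻¹))) * ((Y-1)*(1-L*o*q*Y*(W/X))/((1-L*o*q*Y^2)*(W/X-1))) = (((1-(J*o*q*W)⁻¹*X)/(1-(J*o*q*W)⁻¹))*((1-F*q*X)/(1-F*q))*((Y/q)/X)*((1-J*O*F*q*W/(Y/q))/(1-J*O*F*q*W/(Y/q)*A))*(1-q*L)*(1-L*o*F*q^2*W/A)*(1-W⁻¹*A)/(1-W⁻¹)/((1-q*o*(Y/q))*(1-(F*W)⁻¹*(A*(Y/q))))/(L*F*q*W)*A) * (-(Y-1)*q*L*(1-o*Y)*(1-o*L*q*Y*(W/A))*(Y-F*q*(W/A))/(Y*(1-o*L*q*Y^2)*(1-q*L)*(W/A-1)*(1-o*L*F*q^2*(W/A))))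 * ((1-F*O*q*X)*(1-F*O*J*q^2*(W/Y)*X)/((1-F*O*q*X^2)*(1-F*O*J*q^2*(W/Y))))) ∧
    (W-Y ≠ 0 → X-L*J*o*q^2*W ≠ 0 → ((X-1)*q*F*(1-O*X)*(1-L*(J*o)*q^2*W/X)*(1-X/(L*q*W))/((1-O*F*q*X^2)*(1-q*F)*(1-J*o*q*W)*(1-W⁻¹))) * ((1-L*o*q*Y)*(1-L*o*J*q^2*(W/X)*Y)/((1-L*o*q*Y^2)*(1-L*o*J*q^2*(W/X)))) * (((1-(J*o*q*W)⁻¹)/(1-(J*o*q*W)⁻¹*X))*((1-F*q)/(1-F*q*X))*(X/Y)*((1-q*L*Y)/(1-q*L))*((1-L*o*F*q^2*W/A*Y)/(1-L*o*F*q^2*W/A))*((1-W⁻¹*(A*Y))*(1-W⁻¹)/((1-W⁻¹*A)*(1-W⁻¹*Y)))) = ((1-(L*q*(W/q))⁻¹*(X/q))*(1-q*O*(X/q))/((1-(J*o*q*(W/q))⁻¹*(X/q))*(1-F*q*q*(X/q)))*(L*q*(F*q)*q*(W/q))) * ((1-o*L*q*Y)*(1-q*L*Y)*(W/A-Y)*(1-o*L*F*q^2*(W/A)*Y)/(Y*(1-o*L*q*Y^2)*(1-q*L)*(W/A-1)*(1-o*L*F*q^2*(W/A))))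 * ((X-1)*(1-F*O*q*X*(W/Y))/((1-F*O*q*X^2)*(W/Y-1)))) ∧
    (L*o*q*W*Y-1 ≠ 0 → L*o*q*W*Y-A ≠ 0 → 1-o*Y ≠ 0 → F*W*q-A*Y ≠ 0 → X-L*J*o*q^2*W ≠ 0 → ((X-1)*q*F*(1-O*X)*(1-L*(J*o)*q^2*W/X)*(1-X/(L*q*W))/((1-O*F*q*X^2)*(1-q*F)*(1-J*o*q*W)*(1-W⁻¹))) * (-(Y-1)*L*o*q*(Y-J*q*(W/X))/((1-L*o*q*Y^2)*(1-L*o*J*q^2*(W/X)))) = ((1-(L*q*(W/q))⁻¹*(X/q))*(1-q*O*(X/q))/((1-(J*o*q*(W/q))⁻¹*(X/q))*(1-F*q*q*(X/q)))*(L*q*(F*q)*q*(W/q))) * (((1-(J*o*q*W)⁻¹*X)/(1-(J*o*q*W)⁻¹))*((1-F*q*X)/(1-F*q))*((Y/q)/X)*((1-J*O*F*q*W/(Y/q))/(1-J*O*F*q*W/(Y/q)*A))*(1-q*L)*(1-L*o*F*q^2*W/A)*(1-W⁻¹*A)/(1-W⁻¹)/((1-q*o*(Y/q))*(1-(F*W)⁻¹*(A*(Y/q))))/(L*F*q*W)*A)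 * (-(Y-1)*q*L*(1-o*Y)*(1-o*L*q*Y*(W/A))*(Y-F*q*(W/A))/(Y*(1-o*L*q*Y^2)*(1-q*L)*(W/A-1)*(1-o*L*F*q^2*(W/A)))) * (-(X-1)*F*O*q*(X-J*q*(W/Y))/((1-F*O*q*X^2)*(1-F*O*J*q^2*(W/Y))))) := by
  have R0 : J*O*F*q*W/(Y/q) = (L*o*q*W*Y)⁻¹ := by apply eq_inv_of_mul_eq_one_left; field_simp; linear_combination rel
  have R1 : F*O*J*q^2*(W/Y) = (L*o*q*W*Y)⁻¹ := by apply eq_inv_of_mul_eq_one_left; field_simp; linear_combination rel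
  have R2 : F*O*q*X*(W/Y) = X*(L*J*o*q^2*W*Y)⁻¹ := by rw [← div_eq_mul_inv, eq_div_iff (by simp [*])]; field_simp; linear_combination rel
  have R3 : -(X-1)*F*O*q = -(X-1)*(L*J*o*q^2*W*W)⁻¹ := by rw [← div_eq_mul_inv, eq_div_iff (by simp [*])]; linear_combination (-(X-1))*rel
  have R : (1-X/W = (W-X)/W) ∧
    (1-J*o*q*W/X = (X-J*o*q*W)/X) ∧
    (1-W⁻¹ = (W-1)/W) ∧
    (W/X-Y = (W-X*Y)/X) ∧
    (W/X-1 = (W-X)/X) ∧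
    (1-(J*o*q*W)⁻¹*X = -(X-J*o*q*W)/(J*o*q*W)) ∧
    (1-(J*o*q*W)⁻¹ = -(1-J*o*q*W)/(J*o*q*W)) ∧
    (1-F*q*X = 1-q*F*X) ∧
    (1-F*q = 1-q*F) ∧
    (1-L*o*F*q^2*W/A*Y = (A-L*o*F*q^2*W*Y)/A) ∧
    (1-L*o*F*q^2*W/A = (A-L*o*F*q^2*W)/A) ∧
    (1-W⁻¹*(A*Y) = (W-A*Y)/W) ∧
    (1-W⁻¹*A = (W-A)/W) ∧
    (1-W⁻¹*Y = (W-Y)/W) ∧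
    (W/A-Y = (W-A*Y)/A) ∧
    (1-o*L*q*Y = 1-L*o*q*Y) ∧
    (1-o*L*F*q^2*(W/A)*Y = (A-L*o*F*q^2*W*Y)/A) ∧
    (1-o*L*F*q^2*(W/A) = (A-L*o*F*q^2*W)/A) ∧
    (W/A-1 = (W-A)/A) ∧
    (1-o*L*q*Y^2 = 1-L*o*q*Y^2) ∧
    (1-F*O*q*X = 1-O*F*q*X) ∧
    (W/Y-X = (W-X*Y)/Y) ∧
    (W/Y-1 = (W-Y)/Y) ∧
    (1-F*O*q*X^2 = 1-O*F*q*X^2) ∧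
    (1-L*o*q*Y*(W/X) = (X-L*o*q*Y*W)/X) ∧
    (1-(L*o*q*W*Y)⁻¹*A = (L*o*q*W*Y-A)/(L*o*q*W*Y)) ∧
    (1-(L*o*q*W*Y)⁻¹ = (L*o*q*W*Y-1)/(L*o*q*W*Y)) ∧
    (1-q*o*(Y/q) = 1-o*Y) ∧
    (1-(F*W)⁻¹*(A*(Y/q)) = (F*W*q-A*Y)/(F*W*q)) ∧
    (1-o*L*q*Y*(W/A) = -(L*o*q*W*Y-A)/A) ∧
    (Y-F*q*(W/A) = -(F*W*q-A*Y)/A) ∧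
    (1-(L*o*q*W*Y)⁻¹*X = -(X-L*o*q*Y*W)/(L*o*q*W*Y)) ∧
    (1-L*(J*o)*q^2*W/X = (X-L*J*o*q^2*W)/X) ∧
    (1-X/(L*q*W) = (L*W*q-X)/(L*q*W)) ∧
    (1-L*o*J*q^2*(W/X)*Y = (X-L*J*o*q^2*W*Y)/X) ∧
    (1-L*o*J*q^2*(W/X) = (X-L*J*o*q^2*W)/X) ∧
    (1-(L*q*(W/q))⁻¹*(X/q) = (L*W*q-X)/(L*W*q)) ∧
    (1-q*O*(X/q) = 1-O*X) ∧
    (1-(J*o*q*(W/q))⁻¹*(X/q) = -(X-J*o*q*W)/(J*o*q*W)) ∧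
    (1-F*q*q*(X/q) = 1-q*F*X) ∧
    (L*q*(F*q)*q*(W/q) = L*F*q^2*W) ∧
    (1-X*(L*J*o*q^2*W*Y)⁻¹ = -(X-L*J*o*q^2*W*Y)/(L*J*o*q^2*W*Y)) ∧
    (Y-J*q*(W/X) = (X*Y-J*q*W)/X) ∧
    (X-J*q*(W/Y) = (X*Y-J*q*W)/Y) := by
    and_intros <;> field_simp <;> ring
  simp only [R, R0, R1, R2, R3]
  clear rel R R0 R1 R2 R3
  generalize 1-O*F*q*X = a1, 1-q*F*X = a2, W-X = a3, X-J*o*q*W = a4, 1-O*F*q*X^2 = a5, 1-q*F = a6, 1-J*o*q*W = a7, W-1 = a8, 1-L*o*q*Y = a9, W-X*Y = a10, 1-L*o*q*Y^2 = a11, 1-q*L*Y = a12, 1-q*L = a13, A-L*o*F*q^2*W*Y = a14, A-L*o*F*q^2*W = a15, W-A*Y = a16, W-A = a17, W-Y = a18, X-L*o*q*Y*W = d1, L*o*q*W*Y-1 = d2, L*o*q*W*Y-A = d3, 1-o*Y = d4, F*W*q-A*Y = d5, L*W*q-X = e1, 1-O*X = e2, X-L*J*o*q^2*W = e3, X-L*J*o*q^2*W*Y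 = e4, X*Y-J*q*W = f1, X-1 = x1, Y-1 = y1 at *
  and_intros <;> intros <;> field_simp

end qR

namespace qR

variable {q L J O o F : ℂ} {N : ℕ}

theorem BS_zero (hq : q ≠ 0) (M j x a y b : ℕ) (h : M < b) (L J O o F : ℂ) : BS q M j x a y L J O o F b = 0 := by
  unfold BS; rw [wt_zero hq M b h]; simp

theorem KK_zero (hq : q ≠ 0) (M j x a y : ℕ) (h : M+j < a+y) (L J O o F : ℂ) : KK q M j x a y L J O o F = 0 := by
  have : poch q (q^(M+j))⁻¹ (a+y) = 0 := poch_eq_zero h (by rw [inv_mul_cancel₀ (pow_ne_zero _ hq), sub_self])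
  unfold KK; rw [this]; simp

theorem sub_of_inv {W Y : ℂ} (hW : W ≠ 0) (h : 1 - W⁻¹*Y ≠ 0) : W - Y ≠ 0 := by
  intro hh; apply h; rw [show Y = W by linear_combination -hh]; field_simp; ring

theorem sub_of_div {W Y Z : ℂ} (hZ : 1 - Z ≠ 0) (hW : W ≠ 0) (h : Z*W = Y := by field_simp) : W - Y ≠ 0 := by
  intro hh; apply hZ; have : (1-Z)*W = 0 := by linear_combination hh - h
  rcases mul_eq_zero.1 this with h | h
  · exact h
  · exact absurd h hW

set_option maxHeartbeats 1000000 in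
theorem L1 (M j x a y : ℕ) (g : Gn q L J O o F (M+j+1)) (ha : a ≤ M) (hxy : x+y ≤ M+j+1)
    (H : ∀ x' y', x'+y' ≤ M+j → x' ≤ x → BEp q M j x' a y' (L*q) J O o (F*q)) :
    BEp q M (j+1) x a y L J O o F := by
  have ⟨hq, h0, h1, h2, h3, h4⟩ := g.nz
  have eW : q^(M+j) = q^(M+j+1)/q := by rw [pow_succ]; field_simp
  have hW : q^(M+j+1) ≠ 0 := pow_ne_zero _ hq
  have hX : q^x ≠ 0 := pow_ne_zero _ hq
  have hY : q^y ≠ 0 := pow_ne_zero _ hq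
  have hA : q^a ≠ 0 := pow_ne_zero _ hq
  have rel : L*J*O*o*F*q^3*q^(M+j+1)*q^(M+j+1) = 1 := by rw [← g.rel]; ring
  obtain ⟨S, hSdef⟩ : ∃ S : ℕ → ℕ → ℂ, S = fun x' y' => ∑ b ∈ Finset.range (M+j+1), BS q M j x' a y' (L*q) J O o (F*q) b := ⟨_, rfl⟩
  obtain ⟨Rj, hRj⟩ : ∃ Rj : ℕ → ℂ, Rj = fun y' => Rc q j (q^j) (q^y') (q^(M+j)/q^a) o (L*q) (F*q) := ⟨_, rfl⟩
  obtain ⟨Ra, hRa⟩ : ∃ Ra : ℕ → ℕ → ℂ, Ra = fun x' y' => Rc q a (q^a) (q^x') (q^(M+j)/q^y') (F*q) O J := ⟨_, rfl⟩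
  have hS : ∀ x' y', x'+y' ≤ M+j → x' ≤ x → S x' y' = KK q M j x' a y' (L*q) J O o (F*q) * Rj y' * Ra x' y' := by
    intro x' y' h h'; rw [hSdef, hRj, hRa]; exact H x' y' h h'
  have n_a2 : 1-q*F*q^x ≠ 0 := g.ne 0 0 0 0 1 (1+x)
  have n_a4 : q^x-J*o*q*q^(M+j+1) ≠ 0 := sub_of_div (Z := J*o*q*q^(M+j+1)/q^x) (g.ne 0 1 0 1 0 (1+(M+j+1)-x)) hX
  have n_a5 : 1-O*F*q*(q^x)^2 ≠ 0 := g.ne 0 0 1 0 1 (1+x+x)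
  have n_a6 : 1-q*F ≠ 0 := g.ne 0 0 0 0 1 1
  have n_a7 : 1-J*o*q*q^(M+j+1) ≠ 0 := g.ne 0 1 0 1 0 (1+(M+j+1))
  have n_a8 : q^(M+j+1)-1 ≠ 0 := sub_of_inv hW (by have := g.qne' (k:=M+j+1) (l:=0) (by omega); simpa using this)
  have n_a11 : 1-L*o*q*(q^y)^2 ≠ 0 := g.ne 1 0 0 1 0 (1+y+y)
  have n_a13 : 1-q*L ≠ 0 := g.ne 1 0 0 0 0 1
  have n_a15 : q^a-L*o*F*q^2*q^(M+j+1) ≠ 0 := sub_of_div (Z := L*o*F*q^2*q^(M+j+1)/q^a) (g.ne 1 0 0 1 1 (2+(M+j+1)-a)) hA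
  have n_a17 : q^(M+j+1)-q^a ≠ 0 := sub_of_inv hW (g.qne' (by omega))
  have n_e3 : q^x-L*J*o*q^2*q^(M+j+1) ≠ 0 := sub_of_div (Z := L*J*o*q^2*q^(M+j+1)/q^x) (g.ne 1 1 0 1 0 (2+(M+j+1)-x)) hX
  obtain ⟨u, hu⟩ : ∃ u : ℂ, u = (1-L*o*q*q^y)*(q^(M+j+1)/q^x-q^y)/((1-L*o*q*(q^y)^2)*(q^(M+j+1)/q^x-1)) := ⟨_, rfl⟩
  obtain ⟨v, hv⟩ : ∃ v : ℂ, v = (q^y-1)*(1-L*o*q*q^y*(q^(M+j+1)/q^x))/((1-L*o*q*(q^y)^2)*(q^(M+j+1)/q^x-1)) := ⟨_, rfl⟩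
  obtain ⟨u2, hu2⟩ : ∃ u2 : ℂ, u2 = (1-L*o*q*q^y)*(1-L*o*J*q^2*(q^(M+j+1)/q^x)*q^y)/((1-L*o*q*(q^y)^2)*(1-L*o*J*q^2*(q^(M+j+1)/q^x))) := ⟨_, rfl⟩
  obtain ⟨v2, hv2⟩ : ∃ v2 : ℂ, v2 = -(q^y-1)*L*o*q*(q^y-J*q*(q^(M+j+1)/q^x))/((1-L*o*q*(q^y)^2)*(1-L*o*J*q^2*(q^(M+j+1)/q^x))) := ⟨_, rfl⟩
  obtain ⟨al, hal⟩ : ∃ al : ℂ, al = (1-o*L*q*q^y)*(1-q*L*q^y)*(q^(M+j+1)/q^a-q^y)*(1-o*L*F*q^2*(q^(M+j+1)/q^a)*q^y)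
        /(q^y*(1-o*L*q*(q^y)^2)*(1-q*L)*(q^(M+j+1)/q^a-1)*(1-o*L*F*q^2*(q^(M+j+1)/q^a))) := ⟨_, rfl⟩
  obtain ⟨be, hbe⟩ : ∃ be : ℂ, be = -(q^y-1)*q*L*(1-o*q^y)*(1-o*L*q*q^y*(q^(M+j+1)/q^a))*(q^y-F*q*(q^(M+j+1)/q^a))
        /(q^y*(1-o*L*q*(q^y)^2)*(1-q*L)*(q^(M+j+1)/q^a-1)*(1-o*L*F*q^2*(q^(M+j+1)/q^a))) := ⟨_, rfl⟩
  have C := core q L J O o F (q^x) (q^y) (q^a) (q^(M+j+1)) hq h0 h1 h2 h3 h4 hX hY hA hW rel n_a2 n_a4 n_a5 n_a6 n_a7 n_a8 n_a11 n_a13 n_a15 n_a17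
  rw [← hu, ← hv, ← hu2, ← hv2, ← hal, ← hbe] at C
  obtain ⟨C1, C2, C3, C4⟩ := C
  have hsum : ∑ b ∈ Finset.range (M+(j+1)+1), BS q M (j+1) x a y L J O o F b =
      alt q L J O o F (q^x) (q^(M+j+1)) * (u * S x y + v * S x (y-1))
      + bet q L J O o F (q^x) (q^(M+j+1)) * (u2 * S (x-1) y + v2 * S (x-1) (y-1)) := by
    rw [Finset.sum_range_succ, BS_zero hq M _ _ _ _ _ (by omega), add_zero, show M+(j+1) = M+j+1 by ring]
    simp only [hSdef, Finset.mul_sum, ← Finset.sum_add_distrib]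
    apply Finset.sum_congr rfl
    intro b _
    by_cases hb : b ≤ M
    · rw [hu, hv, hu2, hv2]; exact BS_step M j x a y b g (by omega) hb
    · simp only [BS_zero hq M _ _ _ _ b (by omega : M < b)]; ring
  have r := RBSn (q:=q) j y (q^(M+j+1)/q^a) o L F hq (by simp [*]) h3 h0
    (by have := g.qne j; rwa [pow_succ'])
    (g.ne 1 0 0 0 1 (2+j))
    (g.ne 1 0 0 1 0 (1+y+y))
    (fun k _ => g.ne 1 0 0 0 0 (1+k))
    (fun k hk => by
      have := g.qne' (k := M+j+1) (l := a+k) (by omega)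
      rwa [show (q^(M+j+1)/q^a)⁻¹ * q^k = (q^(M+j+1))⁻¹*q^(a+k) by rw [pow_add q a]; field_simp])
    (fun k _ => g.ne 1 0 0 1 1 (2+(M+j+1)-a+k))
    (fun k _ => g.qne k)
  have eA : q^(M+j+1)/q^a/q = q^(M+j)/q^a := by rw [eW]; ring
  have eY : q^(M+j+1)/q^y/q = q^(M+j)/q^y := by rw [eW]; ring
  rw [eA, ← hal, ← hbe] at r
  have T1 : KK q M (j+1) x a y L J O o F * (al * Rj y) * Rc q a (q^a) (q^x) (q^(M+j+1)/q^y) F O J =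
     alt q L J O o F (q^x) (q^(M+j+1)) * (u * S x y) + bet q L J O o F (q^x) (q^(M+j+1)) * (u2 * S (x-1) y) := by
    by_cases hay : M+j < a+y
    · have z1 : KK q M (j+1) x a y L J O o F * al = 0 := by
        by_cases h' : M+(j+1) < a+y
        · rw [KK_zero hq _ _ _ _ _ h', zero_mul]
        · have : q^(M+j+1)/q^a-q^y = 0 := by
            rw [show M+j+1 = a+y by omega, pow_add]; field_simp; ring
          rw [hal, this]; simp
      have z2 : u * S x y = 0 := by
        by_cases h' : x + y ≤ M+j
        · rw [hS _ _ h' le_rfl, KK_zero hq _ _ _ _ _ hay]; simp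
        · have : q^(M+j+1)/q^x-q^y = 0 := by
            rw [show M+j+1 = x+y by omega, pow_add]; field_simp; ring
          rw [hu, this]; simp
      have z3 : bet q L J O o F (q^x) (q^(M+j+1)) * S (x-1) y = 0 := by
        rcases x with _ | x
        · simp [bet]
        · rw [hS _ _ (by simp; omega) (by simp), KK_zero hq _ _ _ _ _ hay]; simp
      linear_combination Rj y * Rc q a (q^a) (q^x) (q^(M+j+1)/q^y) F O J * z1 - alt q L J O o F (q^x) (q^(M+j+1)) * z2 - u2*z3
    · have rr := RT1n (q:=q) a x (q^a) (q^(M+j+1)/q^y) F O J hq (by simp [*]) (by rw [mul_comm F O]; exact n_a5) (fun k hk => by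
          have := g.qne' (k := M+j+1) (l := y+k) (by omega)
          rwa [show (q^(M+j+1)/q^y)⁻¹ * q^k = (q^(M+j+1))⁻¹*q^(y+k) by rw [pow_add q y]; field_simp])
      rw [eY] at rr
      rw [rr]
      have n_a18 : q^(M+j+1)-q^y ≠ 0 := sub_of_inv hW (g.qne' (by omega))
      have t1 : alt q L J O o F (q^x) (q^(M+j+1)) * (u * S x y) = KK q M (j+1) x a y L J O o F * (al * Rj y) * ((1-F*O*q*q^x)*(q^(M+j+1)/q^y-q^x)/((1-F*O*q*(q^x)^2)*(q^(M+j+1)/q^y-1)) * Ra x y) := by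
        by_cases h' : x + y ≤ M+j
        · have n_a3 : q^(M+j+1)-q^x ≠ 0 := sub_of_inv hW (g.qne' (by omega))
          rw [hS _ _ h' le_rfl, KKrho M j x a y g ha (by omega)]
          unfold alt
          linear_combination (KK q M (j+1) x a y L J O o F * Rj y * Ra x y) * C1 n_a3 n_a18
        · have : q^(M+j+1)/q^x-q^y = 0 := by
            rw [show M+j+1 = x+y by omega, pow_add]; field_simp; ring
          have e2 : q^(M+j+1)/q^y-q^x = 0 := by
            rw [show M+j+1 = x+y by omega, pow_add]; field_simp; ring
          rw [hu, this, e2]; simp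
      have t2 : bet q L J O o F (q^x) (q^(M+j+1)) * (u2 * S (x-1) y) = KK q M (j+1) x a y L J O o F * (al * Rj y) * ((q^x-1)*(1-F*O*q*q^x*(q^(M+j+1)/q^y))/((1-F*O*q*(q^x)^2)*(q^(M+j+1)/q^y-1)) * Ra (x-1) y) := by
        rcases x with _ | x
        · simp [bet]
        · have kx := KKxs (q:=q) M j x a y (L*q) J O o (F*q)
          rw [KKrho M j (x+1) a y g ha (by omega), eW, show q^x = q^(x+1)/q by rw [pow_succ]; field_simp] at kx
          have nrx : ((1-(L*q*(q^(M+j+1)/q))⁻¹*(q^(x+1)/q))*(1-q*O*(q^(x+1)/q))/((1-(J*o*q*(q^(M+j+1)/q))⁻¹*(q^(x+1)/q))*(1-F*q*q*(q^(x+1)/q)))*(L*q*(F*q)*q*(q^(M+j+1)/q))) ≠ 0 := by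
            have m1 : 1-(L*q*(q^(M+j+1)/q))⁻¹*(q^(x+1)/q) ≠ 0 := g.ne (-1) 0 0 0 0 (x-(M+j+1))
            have m2 : 1-q*O*(q^(x+1)/q) ≠ 0 := g.ne 0 0 1 0 0 (x+1)
            have m3 : 1-(J*o*q*(q^(M+j+1)/q))⁻¹*(q^(x+1)/q) ≠ 0 := g.ne 0 (-1) 0 (-1) 0 (x-(M+j+1))
            have m4 : 1-F*q*q*(q^(x+1)/q) ≠ 0 := by
              rw [show 1-F*q*q*(q^(x+1)/q) = 1-q*F*q^(x+1) by field_simp]; exact n_a2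
            exact mul_ne_zero (div_ne_zero (mul_ne_zero m1 m2) (mul_ne_zero m3 m4)) (by simp [*])
          rw [Nat.add_sub_cancel, hS _ _ (by omega) (by omega)]
          apply mul_left_cancel₀ nrx
          unfold bet
          generalize ((1-(L*q*(q^(M+j+1)/q))⁻¹*(q^(x+1)/q))*(1-q*O*(q^(x+1)/q))/((1-(J*o*q*(q^(M+j+1)/q))⁻¹*(q^(x+1)/q))*(1-F*q*q*(q^(x+1)/q)))*(L*q*(F*q)*q*(q^(M+j+1)/q))) = rx, (q^(x+1)-1)*q*F*(1-O*q^(x+1))*(1-L*(J*o)*q^2*q^(M+j+1)/q^(x+1))*(1-q^(x+1)/(L*q*q^(M+j+1)))/((1-O*F*q*(q^(x+1))^2)*(1-q*F)*(1-J*o*q*q^(M+j+1))*(1-(q^(M+j+1))⁻¹)) = bb at *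
          linear_combination (KK q M (j+1) (x+1) a y L J O o F * Rj y * Ra x y) * C3 n_a18 n_e3 - bb*u2*Rj y * Ra x y * kx
      rw [t1, t2]; simp only [hRa]; ring
  have T2 : KK q M (j+1) x a y L J O o F * (be * Rj (y-1)) * Rc q a (q^a) (q^x) (q^(M+j+1)/q^y) F O J =
     alt q L J O o F (q^x) (q^(M+j+1)) * (v * S x (y-1)) + bet q L J O o F (q^x) (q^(M+j+1)) * (v2 * S (x-1) (y-1)) := by
    rcases y with _ | y
    · simp [hbe, hv, hv2]
    · have rr := RT2n (q:=q) a x (q^a) (q^(M+j+1)/q^(y+1)) F O J hq (by rw [mul_comm F O]; exact n_a5) (fun k hk =>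
          g.ne 0 1 1 0 1 (2+(M+j+1)-(y+1)+k))
      have eY2 : q^(M+j+1)/q^(y+1) = q^(M+j)/q^y := by rw [pow_succ q (M+j), pow_succ q y]; field_simp
      have n_a3 : q^(M+j+1)-q^x ≠ 0 := sub_of_inv hW (g.qne' (by omega))
      have n_d2 : L*o*q*q^(M+j+1)*q^(y+1)-1 ≠ 0 := by
        have : 1 - L*o*q*q^(M+j+1)*q^(y+1) ≠ 0 := g.ne 1 0 0 1 0 (1+(M+j+1)+(y+1))
        intro h; apply this; linear_combination -h
      have n_d3 : L*o*q*q^(M+j+1)*q^(y+1)-q^a ≠ 0 := by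
        have := sub_of_div (W := q^a) (Y := L*o*q*q^(M+j+1)*q^(y+1)) (Z := L*o*q*q^(M+j+1)*q^(y+1)/q^a) (g.ne 1 0 0 1 0 (1+(M+j+1)+(y+1)-a)) hA
        intro h; apply this; linear_combination -h
      have n_d4 : 1-o*q^(y+1) ≠ 0 := g.ne 0 0 0 1 0 (y+1)
      have n_d5 : F*q^(M+j+1)*q-q^a*q^(y+1) ≠ 0 := by
        have := sub_of_div (W := q^a*q^(y+1)) (Y := F*q^(M+j+1)*q) (Z := F*q^(M+j+1)*q/q^a/q^(y+1)) (g.ne 0 0 0 0 1 (1+(M+j+1)-(y+1)-a)) (by simp [*])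
        intro h; apply this; linear_combination -h
      have e1 : q^y = q^(y+1)/q := by rw [pow_succ]; field_simp
      have ks := KKsig M j x a y g ha (by omega)
      rw [e1] at ks
      rw [rr, Nat.add_sub_cancel]
      have t1 : alt q L J O o F (q^x) (q^(M+j+1)) * (v * S x y) = KK q M (j+1) x a (y+1) L J O o F * (be * Rj y) * ((1-F*O*q*q^x)*(1-F*O*J*q^2*(q^(M+j+1)/q^(y+1))*q^x)/((1-F*O*q*(q^x)^2)*(1-F*O*J*q^2*(q^(M+j+1)/q^(y+1)))) * Ra x y) := by
        rw [hS _ _ (by omega) (by omega), ks]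
        unfold alt
        linear_combination (KK q M j x a y (L*q) J O o (F*q) * Rj y * Ra x y) * C2 n_a3 n_d2 n_d3 n_d4 n_d5
      have t2 : bet q L J O o F (q^x) (q^(M+j+1)) * (v2 * S (x-1) y) = KK q M (j+1) x a (y+1) L J O o F * (be * Rj y) * (-(q^x-1)*F*O*q*(q^x-J*q*(q^(M+j+1)/q^(y+1)))/((1-F*O*q*(q^x)^2)*(1-F*O*J*q^2*(q^(M+j+1)/q^(y+1)))) * Ra (x-1) y) := by
        rcases x with _ | x
        · simp [bet]
        · have kx := KKxs (q:=q) M j x a y (L*q) J O o (F*q)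
          rw [eW, show q^x = q^(x+1)/q by rw [pow_succ]; field_simp] at kx
          rw [Nat.add_sub_cancel, hS _ _ (by omega) (by omega), ks, kx]
          unfold bet
          linear_combination (KK q M j x a y (L*q) J O o (F*q) * Rj y * Ra x y) * C4 n_d2 n_d3 n_d4 n_d5 n_e3
      rw [t1, t2]; simp only [hRa]; rw [← eY2]; ring
  unfold BEp
  unfold BS at hsum
  rw [hsum]
  rw [show M+(j+1) = M+j+1 by ring, r]
  simp only [hRj] at T1 T2
  linear_combination -T1 - T2

end qR

namespace qR

variable {q L J O o F : ℂ} {N : ℕ}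

theorem BEx0 (M a : ℕ) (ha : a ≤ M) (j : ℕ) : ∀ (y : ℕ) (L J O o F : ℂ), Gn q L J O o F (M+j) → y ≤ M+j →
    BEp q M j 0 a y L J O o F := by
  induction j with
  | zero => intro y L J O o F g hy; exact BE00 g a y ha hy
  | succ j ih =>
    intro y L J O o F g hy
    apply L1 M j 0 a y g ha (by omega)
    intro x' y' h h'
    obtain rfl : x' = 0 := by omega
    exact ih y' _ _ _ _ _ g.down (by omega)

theorem BE (M a : ℕ) (ha : a ≤ M) (j : ℕ) : ∀ (x y : ℕ) (L J O o F : ℂ), Gn q L J O o F (M+j) → x+y ≤ M+j →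
    BEp q M j x a y L J O o F := by
  induction j with
  | zero =>
    intro x y L J O o F g hy
    obtain ⟨m, rfl⟩ : ∃ m, M = m+x := ⟨M-x, by omega⟩
    apply BE_mirror m x a y g
    exact BEx0 m y (by omega) x a _ _ _ _ _ g.mirror (by omega)
  | succ j ih =>
    intro x y L J O o F g hy
    apply L1 M j x a y g ha (by omega)
    intro x' y' h h'
    exact ih x' y' _ _ _ _ _ g.down (by omega)

end qR

namespace qR

noncomputable def t55 (q A B : ℂ) (n b : ℕ) : ℂ :=
  poch q A b * (1 - A*q^b*q^b) * poch q B b * poch q (q^n)⁻¹ b /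
    (poch q q b * poch q (A*q/B) b * poch q (A*q*q^n) b) * Tq q b * (-(A*q*q^n/B))^b

theorem key55 (q A B x y : ℂ) (hq : q ≠ 0) (hx : x ≠ 0) (hB : B ≠ 0)
    (a1 : 1 - q*y ≠ 0) (a2 : B - A*q*y ≠ 0) (a4 : 1 - A*q*(x*q)*y ≠ 0) :
    (1 - A * q / B * x) * ((1 - A * (y * q) * (y * q)) * (1 - (x * q)⁻¹) /
          ((1 - q * y) * (((B - A * q * y) / B)) * ((1 - A * q * (x * q) * y))) * ((y * q)))
          = ((1 - A * (y * q) * (y * q)) * (1 - x⁻¹*y)/((1 - q * y) * (((B - A * q * y) / B))))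
          + (1 - A*(y*q))*(1-B*(y*q))*(1-x⁻¹*y)/((1 - q * y) * (((B - A * q * y) / B)) * ((1 - A * q * (x * q) * y)))*(-(A*q*x/B))*(y*q) - 1 := by
  generalize hu1 : 1 - q*y = u1, hu2 : B - A*q*y = u2, hu4 : 1 - A*q*(x*q)*y = u4 at *
  field_simp
  rw [← hu1, ← hu2, ← hu4]
  ring

theorem sum55_step (q A B : ℂ) (n : ℕ) (hq : q ≠ 0) (hB : B ≠ 0)
    (h1 : ∀ k : ℕ, 1 - q*q^k ≠ 0) (h2 : ∀ k : ℕ, 1 - A*q/B*q^k ≠ 0)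
    (h4 : ∀ k : ℕ, 1 - A*q*q^k ≠ 0) :
    ∑ b ∈ Finset.range (n+1+1), (1 - A*q/B*q^n)*t55 q A B (n+1) b =
    ∑ b ∈ Finset.range (n+1+1), (1 - A*q*q^n)*t55 q A B n b := by
  set g : ℕ → ℂ := fun b => poch q A (b+1) * poch q B (b+1) * poch q (q^n)⁻¹ b /
    (poch q q b * poch q (A*q/B) b * poch q (A*q*q^(n+1)) b) * Tq q (b+1) * (-(A*q*q^n/B))^(b+1) with hg
  have hqn : q^n ≠ 0 := pow_ne_zero _ hq
  have h4' : ∀ k m: ℕ, 1 - A*q*q^k*q^m ≠ 0 := fun k m => by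
    have := h4 (k+m); rwa [pow_add, ← mul_assoc] at this
  apply tele (n+1) _ _ (fun b => match b with | 0 => 0 | b+1 => g b) g
  · intro k hk
    cases k with
    | zero =>
      simp only [hg, t55, poch_zero, poch_succ, pow_zero, zero_add, pow_one, Tq_succ, Tq_zero]
      field_simp; ring
    | succ k =>
      simp only [hg, t55]
      have p1 : poch q (q^(n+1))⁻¹ (k+1) = (1 - (q^(n+1))⁻¹) * poch q (q^n)⁻¹ k := by
        rw [poch_succ', show (q^(n+1))⁻¹*q = (q^n)⁻¹ by rw [pow_succ]; field_simp]
      have p2 : poch q (A*q*q^n) (k+1) = (1-A*q*q^n) * poch q (A*q*q^(n+1)) k := by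
        rw [poch_succ', show A*q*q^n*q = A*q*q^(n+1) by ring]
      rw [p1, p2, poch_succ _ (q^n)⁻¹, poch_succ _ _ (k+1), poch_succ _ _ (k+1), poch_succ _ q, poch_succ _ (A*q/B),
        poch_succ _ (A*q*q^(n+1)), Tq_succ _ (k+1)]
      have a1 := h1 k; have a2 := h2 k; have a4 := h4' (n+1) k; have a5 := h4 n
      have b1 : poch q q k ≠ 0 := poch_ne fun l _ => h1 l
      have b2 : poch q (A*q/B) k ≠ 0 := poch_ne fun l _ => h2 l
      have b4 : poch q (A*q*q^(n+1)) k ≠ 0 := poch_ne fun l _ => h4' _ l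
      clear h1 h2 h4 h4' p1 p2 hg g hk
      generalize poch q A (k+1) = P1, poch q B (k+1) = P2, poch q q k = P4, poch q (A*q/B) k = P5, poch q (A*q*q^(n+1)) k = P7, poch q (q^n)⁻¹ k = P8, Tq q (k+1) = TT at *
      have z : -(A*q*q^(n+1)/B) = -(A*q*q^n/B)*q := by ring
      rw [z, mul_pow]
      rw [pow_succ (-(A*q*q^n/B)) (k+1)]
      generalize (-(A*q*q^n/B))^(k+1) = Z
      simp only [pow_succ] at *
      generalize q^n = x, q^k = y at *
      have e2 : 1 - A*q/B*y = (B-A*q*y)/B := by field_simp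
      have a2' : B - A*q*y ≠ 0 := fun h => a2 (by rw [e2, h]; simp)
      have key := key55 q A B x y hq hqn hB a1 a2' a4
      rw [← e2] at key
      clear e2 a2'
      generalize 1 - q*y = u1, 1 - A*q/B*y = u2, 1 - A*q*(x*q)*y = u4, 1 - A*q*x = u5, 1 - A * q / B * x = v1, 1 - A * (y * q) * (y * q) = v3, 1 - (x*q)⁻¹ = v4, 1 - x⁻¹*y = v6, 1 - A * (y*q) = v7, 1 - B * (y*q) = v8, A*q*x/B = v10 at *
      trans (P1*P2*P8*Z*TT/(P4*P5*P7)) * (v1*(v3*v4/(u1*u2*u4)*(y*q)))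
      · ring
      rw [key]
      have : u5 * u5⁻¹ = 1 := mul_inv_cancel₀ a5
      linear_combination -((P1*P2*P8*Z*TT/(P4*P5*P7))*(v3*v6/(u1*u2)))*this
  · rfl
  · intro k _; rfl
  · simp only [hg]
    have : poch q (q^n)⁻¹ (n+1) = 0 := poch_eq_zero (l := n) (by omega) (by rw [inv_mul_cancel₀ hqn, sub_self])
    rw [this]; simp

theorem sum55 (q A B : ℂ) (n : ℕ) (hq : q ≠ 0) (hB : B ≠ 0)
    (h1 : ∀ k : ℕ, 1 - q*q^k ≠ 0) (h2 : ∀ k : ℕ, 1 - A*q/B*q^k ≠ 0)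
    (h4 : ∀ k : ℕ, 1 - A*q*q^k ≠ 0) :
    ∑ b ∈ Finset.range (n+1), t55 q A B n b =
      (1-A) * poch q (A*q) n / (poch q (A*q/B) n) := by
  induction n with
  | zero => simp [t55, poch_zero, Tq_zero]
  | succ n ih =>
    have := sum55_step q A B n hq hB h1 h2 h4
    rw [← Finset.mul_sum, ← Finset.mul_sum] at this
    have hz : t55 q A B n (n+1) = 0 := by
      have : poch q (q^n)⁻¹ (n+1) = 0 := poch_eq_zero (l := n) (by omega) (by rw [inv_mul_cancel₀ (pow_ne_zero _ hq), sub_self])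
      simp [t55, this]
    have n2 := h2 n
    have b2 : poch q (A*q/B) n ≠ 0 := poch_ne fun l _ => h2 l
    rw [Finset.sum_range_succ (fun b => t55 q A B n b) (n+1), hz, add_zero, ih] at this
    simp only [poch_succ]
    apply mul_left_cancel₀ n2
    rw [this]
    generalize 1 - A*q/B*q^n = u1 at *
    field_simp

end qR

namespace qR

structure G3 (q J O o : ℂ) : Prop where
  hq : q ≠ 0
  h1 : J ≠ 0
  h2 : O ≠ 0
  h3 : o ≠ 0
  ind : ∀ e1 e2 e3 m : ℤ, J^e1*O^e2*o^e3*q^m = 1 → e1 = 0 ∧ e2 = 0 ∧ e3 = 0 ∧ m = 0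

variable {q J O o : ℂ}

theorem G3.ne (g : G3 q J O o) (e1 e2 e3 m : ℤ) {X : ℂ}
    (hX : q ≠ 0 → X = J^e1*O^e2*o^e3*q^m := by intro hq; simp only [zpow_add₀ hq, zpow_sub₀ hq, zpow_neg, zpow_natCast, zpow_one, zpow_zero, zpow_ofNat, pow_add, div_one, one_mul, mul_one]; first | done | ring1 | (field_simp; done) | (field_simp; ring1)) (h : ¬ (e1 = 0 ∧ e2 = 0 ∧ e3 = 0 ∧ m = 0) := by omega) : 1 - X ≠ 0 := by
  intro hh; apply h; apply g.ind; rw [← hX g.hq]; linear_combination -hh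

theorem G3.sh3 (g : G3 q J O o) : G3 q J O (o*q) where
  hq := g.hq
  h1 := g.h1
  h2 := g.h2
  h3 := mul_ne_zero g.h3 g.hq
  ind := by
    intro e1 e2 e3 m h
    have := g.ind e1 e2 e3 (m+e3) (by
      rw [← h, zpow_add₀ g.hq, mul_zpow]; ring)
    omega

theorem G3.qne (g : G3 q J O o) (k : ℕ) : 1 - q*q^k ≠ 0 :=
  g.ne 0 0 0 (k+1)

theorem G3.qne' (g : G3 q J O o) {k l : ℕ} (h : k ≠ l) : 1 - (q^k)⁻¹*q^l ≠ 0 :=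
  g.ne 0 0 0 (l-k)

noncomputable def hv (q : ℂ) (M : ℕ) (J O o : ℂ) (a : ℕ) : ℂ := t55 q (J*O*q) (J*O*o*q^2*q^M) M a / (1-J*O*q)
noncomputable def HX (q : ℂ) (M i b : ℕ) (J O o : ℂ) : ℂ :=
  ∑ a ∈ Finset.range (M+1), hv q M J O o a * Rc q i (q^i) (q^a) (q^M) J O o * Rc q a (q^a) (q^b) (q^M) o J O
noncomputable def hg (q o O : ℂ) (i : ℕ) : ℂ := poch q (q*o) i/(poch q (q*O) i * ((-(o*q))^i*Tq q i))
noncomputable def Z0 (q : ℂ) (M : ℕ) (J O o : ℂ) : ℂ := poch q (J*O*q^2) M / poch q (o*q^M)⁻¹ M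
noncomputable def HK (q : ℂ) (M i b : ℕ) (J O o : ℂ) : ℂ :=
  Z0 q M J O o * hg q o O i * hg q o J b * Rc q i (q^i) (q^b) (q^M) J o O

end qR

namespace qR

variable {q J O o : ℂ}

set_option maxHeartbeats 2000000 in
theorem FV (q : ℂ) (n : ℕ) (A B a b D E G : ℂ) (hq : q ≠ 0)
    (ha : 1 - a ≠ 0) (hb : 1 - b ≠ 0) (hab : a - b ≠ 0) (hAB : A - B ≠ 0)
    (hD : ∀ k ≤ n, 1 - D * q ^ k ≠ 0) (hE : ∀ k < n, 1 - E * q ^ k ≠ 0)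
    (hG : ∀ k ≤ n, 1 - G * q ^ k ≠ 0) (hqq : ∀ k < n, 1 - q * q ^ k ≠ 0)
    (hz : 1-A*q^n = 0) :
    -(b-E/q)/(a-b) * Fs q n A B (a*q) b D E G + (a-E/q)/(a-b) * Fs q n A B a (b*q) D E G =
    (1-B)*(A-D)*(A-G)/((1-D)*(1-G)*(A-B)) * Fs q n A (B*q) (a*q) (b*q) (D*q) E (G*q)
    + -(1-A)*(B-D)*(B-G)/((1-D)*(1-G)*(A-B)) * Fs q n (A*q) B (a*q) (b*q) (D*q) E (G*q) := by
  have d1 : 1 - D ≠ 0 := by simpa using hD 0 (by omega)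
  have g1 : 1 - G ≠ 0 := by simpa using hG 0 (by omega)
  obtain ⟨τ, hτ⟩ : ∃ τ : ℕ → ℂ, τ = fun k => poch q A k * poch q B k * poch q a k * poch q b k /
    (poch q D k * poch q E k * poch q G k * poch q q k) := ⟨_, rfl⟩
  unfold Fs
  simp only [Finset.mul_sum]
  rw [← Finset.sum_add_distrib, ← Finset.sum_add_distrib]
  apply tele n _ _ (fun k => τ k * (1-E*q^k/q)*(1-q^k)/((1-a)*(1-b)))
    (fun k => τ k * ((1-A*q^k)*(1-B*q^k)*(1-a*q^k)*(1-b*q^k))/((1-a)*(1-b)*((1-D*q^k)*(1-G*q^k))))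
  · intro k hk
    have hGk := hG k hk
    have hDk := hD k hk
    have pa : poch q (a*q) k = poch q a k * (1-a*q^k)/(1-a) := by
      rw [eq_div_iff ha, poch_shift]; ring
    have pb : poch q (b*q) k = poch q b k * (1-b*q^k)/(1-b) := by
      rw [eq_div_iff hb, poch_shift]; ring
    have pG : poch q (G*q) k = poch q G k * (1-G*q^k)/(1-G) := by
      rw [eq_div_iff g1, poch_shift]; ring
    have pD : poch q (D*q) k = poch q D k * (1-D*q^k)/(1-D) := by
      rw [eq_div_iff d1, poch_shift]; ring
    have sA := poch_shift q A k
    have sB := poch_shift q B k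
    have nD : poch q D k ≠ 0 := poch_ne (fun l hl => hD l (by omega))
    have nE : poch q E k ≠ 0 := poch_ne (fun l hl => hE l (by omega))
    have nG : poch q G k ≠ 0 := poch_ne (fun l hl => hG l (by omega))
    have nq : poch q q k ≠ 0 := poch_ne (fun l hl => hqq l (by omega))
    have e2 : poch q A k * poch q B k * poch q (a*q) k * poch q b k * q ^ k
    / (poch q D k * poch q E k * poch q G k * poch q q k) = τ k*((1-a*q^k)/(1-a)*q^k) := by
      rw [pa, hτ]; field_simp
    have e3 : poch q A k * poch q B k * poch q a k * poch q (b*q) k * q ^ k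
    / (poch q D k * poch q E k * poch q G k * poch q q k) = τ k*((1-b*q^k)/(1-b)*q^k) := by
      rw [pb, hτ]; field_simp
    have e4 : (1-B)*(A-D)*(A-G)/((1-D)*(1-G)*(A-B)) * (poch q A k * poch q (B*q) k * poch q (a*q) k * poch q (b*q) k * q ^ k
    / (poch q (D*q) k * poch q E k * poch q (G*q) k * poch q q k)) = (A-D)*(A-G)*(1-B*q^k)*((1-a*q^k)*(1-b*q^k)*q^k*τ k/((A-B)*((1-a)*(1-b))*((1-D*q^k)*(1-G*q^k)))) := by
      trans ((1-B)* poch q (B*q) k)*(A-D)*(A-G)/((1-D)*(1-G)*(A-B)) * (poch q A k * poch q (a*q) k * poch q (b*q) k * q ^ k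
    / (poch q (D*q) k * poch q E k * poch q (G*q) k * poch q q k))
      · ring
      rw [← sB, pa, pb, pD, pG, hτ]
      generalize 1 - D*q^k = x1, 1 - G*q^k = x2, 1 - D = x3, 1 - G = x4 at *
      field_simp
    have e5 : -(1-A)*(B-D)*(B-G)/((1-D)*(1-G)*(A-B)) * (poch q (A*q) k * poch q B k * poch q (a*q) k * poch q (b*q) k * q ^ k
    / (poch q (D*q) k * poch q E k * poch q (G*q) k * poch q q k)) = -((B-D)*(B-G)*(1-A*q^k)*((1-a*q^k)*(1-b*q^k)*q^k*τ k/((A-B)*((1-a)*(1-b))*((1-D*q^k)*(1-G*q^k))))) := by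
      trans -(((1-A)* poch q (A*q) k)*(B-D)*(B-G)/((1-D)*(1-G)*(A-B)) * (poch q B k * poch q (a*q) k * poch q (b*q) k * q ^ k
    / (poch q (D*q) k * poch q E k * poch q (G*q) k * poch q q k)))
      · ring
      rw [← sA, pa, pb, pD, pG, hτ]
      generalize 1 - D*q^k = x1, 1 - G*q^k = x2, 1 - D = x3, 1 - G = x4 at *
      field_simp
    rw [e2, e3, e4, e5]
    clear e2 e3 e4 e5 sA sB pa pb pG pD
    generalize q^k = X at *
    generalize τ k = t
    have k1 : (A-D)*(A-G)*(1-B*X)*X - (B-D)*(B-G)*(1-A*X)*X = (A-B)*((1-D*X)*(1-G*X) - (1-A*X)*(1-B*X)) := by ring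
    have k2 : -(b-E/q)*(1-b)*(1-a*X)*X + (a-E/q)*(1-a)*(1-b*X)*X = (a-b)*((1-a*X)*(1-b*X)-(1-E*X/q)*(1-X)) := by
      field_simp; ring
    have l1 : -(b-E/q)/(a-b)*(t*((1-a*X)/(1-a)*X)) + (a-E/q)/(a-b)*(t*((1-b*X)/(1-b)*X)) =
       t/((a-b)*((1-a)*(1-b)))*(-(b-E/q)*(1-b)*(1-a*X)*X + (a-E/q)*(1-a)*(1-b*X)*X) := by
      generalize 1 - a*X = x1, 1 - b*X = x2, E/q = x3
      field_simp
    rw [l1, k2]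
    have l2 : (A-D)*(A-G)*(1-B*X)*((1-a*X)*(1-b*X)*X*t/((A-B)*((1-a)*(1-b))*((1-D*X)*(1-G*X)))) +
       -((B-D)*(B-G)*(1-A*X)*((1-a*X)*(1-b*X)*X*t/((A-B)*((1-a)*(1-b))*((1-D*X)*(1-G*X))))) =
       (A-B)*((1-D*X)*(1-G*X) - (1-A*X)*(1-B*X))*((1-a*X)*(1-b*X)*t/((A-B)*((1-a)*(1-b))*((1-D*X)*(1-G*X)))) := by
      rw [← k1]; ring
    rw [l2]
    clear l1 l2 k1 k2
    generalize 1 - a*X = x1, 1 - b*X = x2, 1 - D*X = x3, 1 - G*X = x4, 1 - E*X/q = x5, 1 - A*X = x6, 1 - B*X = x7, 1 - a = x8, 1 - b = x9, a - b = y1, A - B = y2 at *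
    field_simp
    ring
  · simp
  · intro k hk
    have hGk := hG k hk.le
    have hDk := hD k hk.le
    have hEk := hE k hk
    have hqk := hqq k hk
    have nD : poch q D k ≠ 0 := poch_ne (fun l hl => hD l (by omega))
    have nE : poch q E k ≠ 0 := poch_ne (fun l hl => hE l (by omega))
    have nG : poch q G k ≠ 0 := poch_ne (fun l hl => hG l (by omega))
    have nq : poch q q k ≠ 0 := poch_ne (fun l hl => hqq l (by omega))
    simp only [hτ, poch_succ]
    rw [show E * q^(k+1)/q = E*q^k by rw [pow_succ]; field_simp, show q^(k+1) = q*q^k by ring]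
    generalize 1 - G*q^k = g1, 1 - D*q^k = g2, 1 - E*q^k = g3, 1 - q*q^k = g4, 1 - a = g5, 1 - b = g6 at *
    field_simp
  · simp only [hz]; simp

end qR

namespace qR

variable {q J O o : ℂ}

theorem RV (n : ℕ) (U V W J O o : ℂ) (hq : q ≠ 0) (hU : U ≠ 0) (hV : V ≠ 0) (hW : W ≠ 0)
    (ha : 1 - q*V ≠ 0) (hb : 1 - J*O*q*V ≠ 0) (hab : 1 - J*O*q^2*V^2 ≠ 0)
    (hAB : 1 - O*o*q*U^2 ≠ 0)
    (hD : ∀ k ≤ n, 1 - q*O * q ^ k ≠ 0) (hE : ∀ k < n, 1 - W⁻¹ * q ^ k ≠ 0)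
    (hG : ∀ k ≤ n, 1 - J*O*o*q^2*W * q ^ k ≠ 0) (hqq : ∀ k < n, 1 - q * q ^ k ≠ 0)
    (hz : q^n = U) :
    V*(1-J*O*q^2*V*W)/(W*(1-J*O*q^2*V^2)) * Rc q n U V W J O o
      + (W-V)/(W*(1-J*O*q^2*V^2)) * Rc q n U (V*q) W J O o =
    (1-O*o*q*U)*(1-q*O*U)*(1-J*O*o*q^2*W*U)/(U*((1-q*O)*(1-J*O*o*q^2*W)*(1-O*o*q*U^2))) * Rc q n U V W J (O*q) o
      + (U-1)*(1-o*U)*(O*O*o*q^2)*(U-J*q*W)/((1-q*O)*(1-J*O*o*q^2*W)*(1-O*o*q*U^2)) * Rc q n (U/q) V W J (O*q) o := by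
  have g1 : 1 - J*O*o*q^2*W ≠ 0 := by simpa using hG 0 (by omega)
  have d1 : 1 - q*O ≠ 0 := by simpa using hD 0 (by omega)
  have e0 : (q*V)⁻¹ - J*O*q*V = (1 - J*O*q^2*V^2)/(q*V) := by field_simp
  have e1 : U⁻¹ - O*o*q*U = (1 - O*o*q*U^2)/U := by field_simp
  have := FV q n U⁻¹ (O*o*q*U) (q*V)⁻¹ (J*O*q*V) (q*O) W⁻¹ (J*O*o*q^2*W) hq
    (by intro h; apply ha; have : (q*V)⁻¹ = 1 := by linear_combination -h
        rw [inv_eq_one] at this; rw [this]; ring)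
    hb (by rw [e0]; exact div_ne_zero hab (mul_ne_zero hq hV)) (by rw [e1]; exact div_ne_zero hAB hU) hD hE hG hqq
    (by rw [hz, inv_mul_cancel₀ hU]; ring)
  unfold Rc
  have f1 : -(J*O*q*V-W⁻¹/q)/((q*V)⁻¹ - J*O*q*V) = V*(1-J*O*q^2*V*W)/(W*(1-J*O*q^2*V^2)) := by
    rw [e0, show -(J*O*q*V-W⁻¹/q) = (1-J*O*q^2*V*W)/(W*q) by field_simp; ring]
    generalize 1-J*O*q^2*V^2 = x1, 1-J*O*q^2*V*W = x2 at *
    field_simp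
  have f2 : ((q*V)⁻¹-W⁻¹/q)/((q*V)⁻¹ - J*O*q*V) = (W-V)/(W*(1-J*O*q^2*V^2)) := by
    rw [e0, show (q*V)⁻¹-W⁻¹/q = (W-V)/(V*W*q) by field_simp]
    generalize 1-J*O*q^2*V^2 = x1, W-V = x2 at *
    field_simp
  have f3 : (1-O*o*q*U)*(U⁻¹-q*O)*(U⁻¹-J*O*o*q^2*W)/((1-q*O)*(1-J*O*o*q^2*W)*(U⁻¹-O*o*q*U)) =
     (1-O*o*q*U)*(1-q*O*U)*(1-J*O*o*q^2*W*U)/(U*((1-q*O)*(1-J*O*o*q^2*W)*(1-O*o*q*U^2))) := by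
    rw [e1, show U⁻¹-q*O = (1-q*O*U)/U by field_simp, show U⁻¹-J*O*o*q^2*W = (1-J*O*o*q^2*W*U)/U by field_simp]
    generalize 1-O*o*q*U^2 = x1, 1-J*O*o*q^2*W*U = x2, 1-J*O*o*q^2*W = x3, 1-q*O*U = x4, 1-q*O = x5 at *
    field_simp
  have f4 : -(1-U⁻¹)*(O*o*q*U-q*O)*(O*o*q*U-J*O*o*q^2*W)/((1-q*O)*(1-J*O*o*q^2*W)*(U⁻¹-O*o*q*U)) =
     (U-1)*(1-o*U)*(O*O*o*q^2)*(U-J*q*W)/((1-q*O)*(1-J*O*o*q^2*W)*(1-O*o*q*U^2)) := by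
    rw [e1, show 1-U⁻¹ = (U-1)/U by field_simp]
    generalize 1-O*o*q*U^2 = x1, 1-J*O*o*q^2*W = x3, 1-q*O = x5 at *
    field_simp
    ring
  rw [f1, f2, f3, f4] at this
  have h4 : (q*V)⁻¹*q = V⁻¹ := by field_simp
  have h6 : (U/q)⁻¹ = U⁻¹*q := by field_simp
  rw [h4] at this
  rw [show V*q = q*V from mul_comm _ _, h6]
  rw [show J*O*q*(q*V) = J*O*q*V*q by ring, show O*q*o*q*U = O*o*q*U*q by ring, show J*(O*q)*q*V = J*O*q*V*q by ring,
   show q*(O*q) = q*O*q by ring, show J*(O*q)*o*q^2*W = J*O*o*q^2*W*q by ring, show O*q*o*q*(U/q) = O*o*q*U by field_simp]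
  exact this

theorem hg_zero (o O : ℂ) : hg q o O 0 = 1 := by simp [hg, poch_zero, Tq_zero]

theorem hg_succ (hq : q ≠ 0) (h3 : o ≠ 0) (i : ℕ) (hd : ∀ k : ℕ, 1 - q*O*q^k ≠ 0) :
    hg q o O (i+1) = hg q o O i * ((1-q*o*q^i)/((1-q*O*q^i)*(-(o*q)*q^i))) := by
  have n1 := hd i
  have n2 : poch q (q*O) i ≠ 0 := poch_ne (fun l _ => hd l)
  have n3 := Tq_ne hq i
  unfold hg
  rw [poch_succ, poch_succ, Tq_succ, pow_succ]
  generalize 1-q*O*q^i = x1 at *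
  field_simp

theorem hg_q (hq : q ≠ 0) (h3 : o ≠ 0) (i : ℕ) (hd : ∀ k : ℕ, 1 - q*O*q^k ≠ 0) (h31 : 1-q*o ≠ 0) :
    hg q (o*q) O i = hg q o O i * ((1-q*o*q^i)/((1-q*o)*q^i)) := by
  have n2 : poch q (q*O) i ≠ 0 := poch_ne (fun l _ => hd l)
  have n3 := Tq_ne hq i
  have hp : poch q (q*(o*q)) i = poch q (q*o) i * (1-q*o*q^i)/(1-q*o) := by
    rw [eq_div_iff h31, poch_shift, ← mul_assoc]; ring
  unfold hg
  rw [hp, show -(o*q*q) = -(o*q)*q by ring, mul_pow]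
  generalize 1-q*o = x1 at *
  field_simp

theorem Z0_q (g : G3 q J O o) (M : ℕ) :
    (1-o*q*q^M)*Z0 q M J O (o*q) = Z0 q M J O o * (q^M*(1-q*o)) := by
  have hq := g.hq
  have hM : q^M ≠ 0 := pow_ne_zero _ hq
  have h3 := g.h3
  have n1 : ∀ k : ℕ, 1 - (o*q^M)⁻¹*q^k ≠ 0 := fun k => g.ne 0 0 (-1) (k-M)
  have n2 : ∀ k : ℕ, 1 - (o*q*q^M)⁻¹*q^k ≠ 0 := fun k => g.ne 0 0 (-1) (k-M-1)
  have p1 : poch q (o*q^M)⁻¹ M ≠ 0 := poch_ne (fun k _ => n1 k)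
  have p2 : poch q (o*q*q^M)⁻¹ M ≠ 0 := poch_ne (fun k _ => n2 k)
  have s := poch_shift q (o*q*q^M)⁻¹ M
  rw [show (o*q*q^M)⁻¹*q = (o*q^M)⁻¹ by field_simp, show 1 - (o*q*q^M)⁻¹*q^M = -(1-q*o)/(q*o) by field_simp; ring,
    show 1 - (o*q*q^M)⁻¹ = -(1-o*q*q^M)/(o*q*q^M) by field_simp; ring] at s
  unfold Z0
  generalize poch q (J*O*q^2) M = P0, poch q (o*q^M)⁻¹ M = P1, poch q (o*q*q^M)⁻¹ M = P2, 1-o*q*q^M = x1, 1-q*o = x2 at *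
  field_simp at s ⊢
  linear_combination P0 * s

theorem hv_q (g : G3 q J O o) (M a : ℕ) :
    (1-o*q*q^M)*hv q M J O (o*q) a = hv q M J O o a * ((1-J*O*o*q^2*q^M*q^a)*(1-o*q*q^M/q^a)/(1-J*O*o*q^2*q^M)) := by
  have hq := g.hq
  have hM : q^M ≠ 0 := pow_ne_zero _ hq
  have ha : q^a ≠ 0 := pow_ne_zero _ hq
  have h1 := g.h1
  have h2 := g.h2
  have h3 := g.h3
  have n1 : ∀ k : ℕ, 1 - (o*q^M)⁻¹*q^k ≠ 0 := fun k => g.ne 0 0 (-1) (k-M)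
  have n2 : ∀ k : ℕ, 1 - (o*q*q^M)⁻¹*q^k ≠ 0 := fun k => g.ne 0 0 (-1) (k-M-1)
  have n3 : 1-J*O*o*q^2*q^M ≠ 0 := g.ne 1 1 1 (2+M)
  have n4 : 1-o*q*q^M ≠ 0 := g.ne 0 0 1 (1+M)
  have p1 : poch q (o*q^M)⁻¹ a ≠ 0 := poch_ne (fun k _ => n1 k)
  have p2 : poch q (o*q*q^M)⁻¹ a ≠ 0 := poch_ne (fun k _ => n2 k)
  have s := poch_shift q (o*q*q^M)⁻¹ a
  rw [show (o*q*q^M)⁻¹*q = (o*q^M)⁻¹ by field_simp, show 1 - (o*q*q^M)⁻¹*q^a = -(1-o*q*q^M/q^a)*q^a/(o*q*q^M) by field_simp; ring,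
    show 1 - (o*q*q^M)⁻¹ = -(1-o*q*q^M)/(o*q*q^M) by field_simp; ring] at s
  have s2 := poch_shift q (J*O*o*q^2*q^M) a
  unfold hv t55
  rw [show J*O*q*q/(J*O*(o*q)*q^2*q^M) = (o*q*q^M)⁻¹ by field_simp, show J*O*q*q/(J*O*o*q^2*q^M) = (o*q^M)⁻¹ by field_simp,
    show J*O*(o*q)*q^2*q^M = J*O*o*q^2*q^M*q by ring,
    show -(J*O*q*q*q^M/(J*O*o*q^2*q^M*q)) = -(1/(o*q)) by field_simp,
    show -(J*O*q*q*q^M/(J*O*o*q^2*q^M)) = -(1/(o*q))*q by field_simp, mul_pow]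
  generalize poch q (o*q^M)⁻¹ a = P1, poch q (o*q*q^M)⁻¹ a = P2, poch q (J*O*o*q^2*q^M) a = P3, poch q (J*O*o*q^2*q^M*q) a = P4, 1-o*q*q^M/q^a = x1, 1-o*q*q^M = x2, 1-J*O*o*q^2*q^M*q^a = x3, 1-J*O*o*q^2*q^M = x4 at *
  have s' : x1*q^a/P1 = x2/P2 := by
    rw [div_eq_div_iff p1 p2]; field_simp at s; linear_combination -s
  have s2' : P4 = P3*x3/x4 := by rw [eq_div_iff n3]; linear_combination -s2
  rw [s2']
  simp only [div_eq_mul_inv, mul_inv] at s' ⊢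
  generalize (P1)⁻¹ = i1, (P2)⁻¹ = i2 at *
  linear_combination (-(poch q (J * O * q) a * (1 - J * O * q * q ^ a * q ^ a) * (P3 * x3 * x4⁻¹) * poch q (q ^ M)⁻¹ a * (
            ((poch q q a)⁻¹ * (poch q (J * O * q * q * q ^ M) a)⁻¹) *
          Tq q a *
        (-(1*(o⁻¹ * q⁻¹))) ^ a) *
      (1 - J * O * q)⁻¹)) * s'

end qR

namespace qR

variable {q J O o : ℂ}

theorem G3.facts (g : G3 q J O o) :
  (∀ k : ℕ, 1 - q*J*q^k ≠ 0) ∧ (∀ k : ℕ, 1 - q*O*q^k ≠ 0) ∧ (∀ k : ℕ, 1 - q*o*q^k ≠ 0) ∧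
  (∀ M k : ℕ, 1 - J*O*o*q^2*q^M*q^k ≠ 0) ∧
  (∀ k : ℕ, 1 - J*o*q*(q^k)^2 ≠ 0) ∧ (∀ k : ℕ, 1 - J*o*q^2*(q^k)^2 ≠ 0) ∧ (∀ k : ℕ, 1 - J*o*q*q^k ≠ 0) ∧
  (∀ k : ℕ, 1 - O*o*q*(q^k)^2 ≠ 0) ∧ (∀ k : ℕ, 1 - O*o*q^2*(q^k)^2 ≠ 0) ∧ (∀ k : ℕ, 1 - O*o*q*q^k ≠ 0) := by
  have hq := g.hq
  refine ⟨?_, ?_, ?_, ?_, ?_, ?_, ?_, ?_, ?_, ?_⟩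
  · intro k; exact g.ne 1 0 0 (1+k)
  · intro k; exact g.ne 0 1 0 (1+k)
  · intro k; exact g.ne 0 0 1 (1+k)
  · intro M k; exact g.ne 1 1 1 (1+1+M+k)
  · intro k; exact g.ne 1 0 1 (1+k+k)
  · intro k; exact g.ne 1 0 1 (1+1+k+k)
  · intro k; exact g.ne 1 0 1 (1+k)
  · intro k; exact g.ne 0 1 1 (1+k+k)
  · intro k; exact g.ne 0 1 1 (1+1+k+k)
  · intro k; exact g.ne 0 1 1 (1+k)

theorem HX_b (M i b : ℕ) (g : G3 q J O o) :
    (1-o*q*q^M)*((1-O*o*q*q^i)*(1-J*O*o*q^2*q^M*q^i)/((1-O*o*q*(q^i)^2)*(1-J*O*o*q^2*q^M)) * HX q M i b J O (o*q)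
    + -(q^i-1)*O*o*q*(q^i-J*q*q^M)/((1-O*o*q*(q^i)^2)*(1-J*O*o*q^2*q^M)) * HX q M (i-1) b J O (o*q)) =
    (1-o*q*q^b)*(1-J*o*q^2*q^b*q^M)/(1-J*o*q^2*(q^b)^2) * HX q M i b J O o
    + -o*q*(1-q*J*q^b)*(q^M-q^b)/(1-J*o*q^2*(q^b)^2) * HX q M i (b+1) J O o := by
  have hq := g.hq
  obtain ⟨f1, f2, f3, f4, f5, f6, f7, f8, f9, f10⟩ := g.facts
  unfold HX
  simp only [Finset.mul_sum, ← Finset.sum_add_distrib]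
  apply Finset.sum_congr rfl
  intro a ha
  have ha : a ≤ M := by simpa [Nat.lt_succ_iff] using ha
  have ev := hv_q g M a
  have r1 := RT2n (q:=q) i i (q^a) (q^M) o O J hq (by convert f8 i using 1; ring)
    (fun k _ => by convert f4 M k using 1; ring)
  have r2 := RII (q:=q) a (q^a) (q^b) (q^M) o J O hq (pow_ne_zero _ hq) (pow_ne_zero _ hq) (pow_ne_zero _ hq) g.h3 g.h1 g.h2
    (g.qne b) (by convert f7 b using 1; ring) (by convert f6 b using 1; ring) (fun k _ => f1 k) (fun k hk => g.qne' (by omega))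
    (fun k _ => by convert f4 M k using 1; ring) (fun k _ => g.qne k) (Or.inl rfl)
  rw [Rc_swap, Rc_swap q i (q^a) (q^i), Rc_swap q i (q^a) (q^(i-1)), Rc_truncU q (i-1) i _ _ _ _ _ hq (by omega)] at r1
  rw [show o*O*J = J*O*o by ring, show o*O = O*o by ring] at r1
  rw [show o*J*O = J*O*o by ring, show o*J = J*o by ring, ← pow_succ q b] at r2
  linear_combination (-Rc q a (q^a) (q^b) (q^M) (o*q) J O * (1-o*q*q^M)*hv q M J O (o*q) a) * r1 + (hv q M J O o a * Rc q i (q^i) (q^a) (q^M) J O o)*r2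
    + Rc q i (q^i) (q^a) (q^M) J O o*Rc q a (q^a) (q^b) (q^M) (o*q) J O *ev

theorem HX_i (M i : ℕ) (hi : i < M) (g : G3 q J O o) :
    (1-o*q*q^M)*HX q M i 0 J O (o*q) =
    (1-o*q*q^i)*(1-O*o*q^2*q^i*q^M)/(1-O*o*q^2*(q^i)^2) * HX q M i 0 J O o
    + -o*q*(1-q*O*q^i)*(q^M-q^i)/(1-O*o*q^2*(q^i)^2) * HX q M (i+1) 0 J O o := by
  have hq := g.hq
  obtain ⟨f1, f2, f3, f4, f5, f6, f7, f8, f9, f10⟩ := g.facts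
  unfold HX
  simp only [Finset.mul_sum, ← Finset.sum_add_distrib, Rc_zeroV, mul_one]
  apply Finset.sum_congr rfl
  intro a ha
  have ha : a ≤ M := by simpa [Nat.lt_succ_iff] using ha
  have ev := hv_q g M a
  have r2 := RII (q:=q) (i+1) (q^a) (q^i) (q^M) o O J hq (pow_ne_zero _ hq) (pow_ne_zero _ hq) (pow_ne_zero _ hq) g.h3 g.h2 g.h1
    (g.qne i) (by convert f10 i using 1; ring) (by convert f9 i using 1; ring) (fun k _ => f2 k) (fun k hk => g.qne' (by omega))
    (fun k _ => by convert f4 M k using 1; ring) (fun k _ => g.qne k) (Or.inr (by ring))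
  rw [← pow_succ q i, Rc_swap, Rc_swap q (i+1) (q^a) (q^i), Rc_swap q (i+1) (q^a) (q^(i+1)), Rc_truncU q i (i+1) _ _ _ _ _ hq (by omega),
   Rc_truncU q i (i+1) _ _ _ _ _ hq (by omega)] at r2
  rw [show o*O*J = J*O*o by ring, show o*O = O*o by ring] at r2
  linear_combination (hv q M J O o a)*r2 + Rc q i (q^i) (q^a) (q^M) J O (o*q) *ev

theorem HX_00 (M : ℕ) (g : G3 q J O o) : HX q M 0 0 J O o = Z0 q M J O o := by
  have hq := g.hq
  have h1 := g.h1
  have h2 := g.h2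
  have h3 := g.h3
  have hM : q^M ≠ 0 := pow_ne_zero _ hq
  have n1 : ∀ k : ℕ, 1 - (o*q^M)⁻¹*q^k ≠ 0 := fun k => g.ne 0 0 (-1) (k-M)
  have n2 : 1-J*O*q ≠ 0 := g.ne 1 1 0 1
  have eB : J*O*q*q/(J*O*o*q^2*q^M) = (o*q^M)⁻¹ := by field_simp
  unfold HX hv Z0
  simp only [Rc_zeroV, Rc_zeroU, mul_one]
  rw [← Finset.sum_div, sum55 (hq := hq) (hB := by simp [h1, h2, h3, hq]) (h1 := fun k => g.qne k) (h2 := by rw [eB]; exact n1)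
    (h4 := fun k => g.ne 1 1 0 (1+1+k)), eB]
  rw [show J*O*q*q = J*O*q^2 by ring]
  generalize 1 - J*O*q = x at *
  field_simp

theorem HX_i0 (M i : ℕ) : i ≤ M → ∀ J O o : ℂ, G3 q J O o → HX q M i 0 J O o = Z0 q M J O o * hg q o O i := by
  induction i with
  | zero => intro _ J O o g; rw [hg_zero, mul_one]; exact HX_00 M g
  | succ i ih =>
    intro hi J O o g
    have r := HX_i M i (by omega) g
    rw [ih (by omega) _ _ _ g.sh3, ih (by omega) _ _ _ g] at r
    have hq := g.hq
    have h3 := g.h3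
    obtain ⟨f1, f2, f3, f4, f5, f6, f7, f8, f9, f10⟩ := g.facts
    have f31 : 1 - q*o ≠ 0 := by simpa using f3 0
    rw [hg_q hq h3 i f2 f31] at r
    rw [hg_succ hq h3 i f2]
    have z := Z0_q g M
    have hI : q^i ≠ 0 := pow_ne_zero _ hq
    have hMI : q^M - q^i ≠ 0 := by
      have := g.qne' (k := i) (l := M) (by omega)
      intro h; apply this; rw [sub_eq_zero.1 h, inv_mul_cancel₀ hI, sub_self]
    have fi := f9 i
    have f2i := f2 i
    have ed : 1 - O*o*q^2*(q^i)^2 ≠ 0 := fi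
    have r' : (-o*q*(1-q*O*q^i)*(q^M-q^i)/(1-O*o*q^2*(q^i)^2)) * HX q M (i+1) 0 J O o =
       (-o*q*(1-q*O*q^i)*(q^M-q^i)/(1-O*o*q^2*(q^i)^2)) * (Z0 q M J O o * (hg q o O i * ((1-q*o*q^i)/((1-q*O*q^i)*(-(o*q)*q^i))))) := by
      have e1 : (1-o*q*q^M)*(Z0 q M J O (o*q) * (hg q o O i * ((1-q*o*q^i)/((1-q*o)*q^i)))) =
         Z0 q M J O o * hg q o O i * (1-q*o*q^i) * (q^M/q^i) := by
        rw [← mul_assoc, z]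
        generalize 1 - q*o*q^i = x1, 1 - q*o = x2 at *
        field_simp
      rw [e1] at r
      have e2 : (-o*q*(1-q*O*q^i)*(q^M-q^i)/(1-O*o*q^2*(q^i)^2)) * (Z0 q M J O o * (hg q o O i * ((1-q*o*q^i)/((1-q*O*q^i)*(-(o*q)*q^i)))))
        = Z0 q M J O o * hg q o O i * (1-q*o*q^i) * ((q^M-q^i)/(q^i*(1-O*o*q^2*(q^i)^2))) := by
        generalize 1 - q*o*q^i = x1, 1 - q*O*q^i = x2, q^M-q^i = x3, 1-O*o*q^2*(q^i)^2 = x4 at *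
        field_simp
      have e3 : q^M/q^i = (1-O*o*q^2*q^i*q^M)/(1-O*o*q^2*(q^i)^2) + (q^M-q^i)/(q^i*(1-O*o*q^2*(q^i)^2)) := by
        generalize hx : 1-O*o*q^2*(q^i)^2 = x4 at *
        field_simp
        rw [← hx]; ring
      rw [e2]
      rw [e3] at r
      linear_combination -r
    exact mul_left_cancel₀ (div_ne_zero (mul_ne_zero (mul_ne_zero (mul_ne_zero (neg_ne_zero.2 h3) hq) f2i) hMI) fi) r'

end qR

namespace qR

variable {q J O o : ℂ}

theorem hg_prev (hq : q ≠ 0) (h3 : o ≠ 0) (i : ℕ) (hd : ∀ k : ℕ, 1 - q*O*q^k ≠ 0) (h31 : 1-q*o ≠ 0) (h3i : ∀ k : ℕ, 1 - q*o*q^k ≠ 0) :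
    (q^i-1)*hg q (o*q) O (i-1) = (q^i-1)*(hg q o O i * ((1-O*q^i)*(-(o*q))/(1-q*o))) := by
  rcases i with _ | i
  · simp
  · simp only [Nat.add_sub_cancel]
    rw [hg_q hq h3 i hd h31, hg_succ hq h3 i hd]
    congr 1
    have n1 := hd i
    have n2 := h3i i
    rw [show O*q^(i+1) = q*O*q^i by ring]
    generalize 1-q*O*q^i = x1, 1-q*o*q^i = x2, 1-q*o = x3 at *
    field_simp

theorem HK_b (M i b : ℕ) (hi : i ≤ M) (g : G3 q J O o) :
    (1-o*q*q^M)*((1-O*o*q*q^i)*(1-J*O*o*q^2*q^M*q^i)/((1-O*o*q*(q^i)^2)*(1-J*O*o*q^2*q^M)) * HK q M i b J O (o*q)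
    + -(q^i-1)*O*o*q*(q^i-J*q*q^M)/((1-O*o*q*(q^i)^2)*(1-J*O*o*q^2*q^M)) * HK q M (i-1) b J O (o*q)) =
    (1-o*q*q^b)*(1-J*o*q^2*q^b*q^M)/(1-J*o*q^2*(q^b)^2) * HK q M i b J O o
    + -o*q*(1-q*J*q^b)*(q^M-q^b)/(1-J*o*q^2*(q^b)^2) * HK q M i (b+1) J O o := by
  have hq := g.hq
  have h3 := g.h3
  have hI : q^i ≠ 0 := pow_ne_zero _ hq
  have hV : q^b ≠ 0 := pow_ne_zero _ hq
  have hM : q^M ≠ 0 := pow_ne_zero _ hq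
  obtain ⟨f1, f2, f3, f4, f5, f6, f7, f8, f9, f10⟩ := g.facts
  have f31 : 1 - q*o ≠ 0 := by simpa using f3 0
  have f40 : 1 - J*O*o*q^2*q^M ≠ 0 := by simpa using f4 M 0
  have r := RV (q:=q) i (q^i) (q^b) (q^M) J o O hq (pow_ne_zero _ hq) (pow_ne_zero _ hq) (pow_ne_zero _ hq)
    (g.qne b) (f7 b) (f6 b) (by convert f8 i using 1; ring) (fun k _ => f3 k) (fun k hk => g.qne' (by omega))
    (fun k _ => by convert f4 M k using 1; ring) (fun k _ => g.qne k) rfl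
  have fd : (q^i-1)*Rc q i (q^i/q) (q^b) (q^M) J (o*q) O = (q^i-1)*Rc q i (q^(i-1)) (q^b) (q^M) J (o*q) O := fdiv hq (fun U => Rc q i U (q^b) (q^M) J (o*q) O) i

  rw [Rc_truncU q (i-1) i _ _ _ _ _ hq (by omega)] at fd
  have z := Z0_q g M
  have gi := hg_q (O := O) hq h3 i f2 f31
  have gp := hg_prev (O := O) hq h3 i f2 f31 f3
  have gb := hg_q (O := J) hq h3 b f1 f31
  have gb1 := hg_succ (O := J) hq h3 b f1
  unfold HK
  rw [gb1, gb, gi, pow_succ q b]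
  rw [show J*o*O = J*O*o by ring, show o*O = O*o by ring] at r
  clear gb gb1 gi
  generalize Rc q i (q^i) (q^b) (q^M) J o O = R1, Rc q i (q^i) (q^b*q) (q^M) J o O = R2, Rc q i (q^i) (q^b) (q^M) J (o*q) O = R3, Rc q i (q^i/q) (q^b) (q^M) J (o*q) O = R4, Rc q (i-1) (q^(i-1)) (q^b) (q^M) J (o*q) O = R5, hg q (o*q) O (i-1) = gm, hg q o O i = gi, hg q o J b = hb, Z0 q M J O (o*q) = Z', Z0 q M J O o = Z at *
  have w1 := f1 b
  have w6 := f6 b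
  have w8 := f8 i
  clear f1 f2 f3 f4 f5 f6 f7 f8 f9 f10 g
  generalize q^i = I, q^b = V, q^M = W at *
  have key : (1-o*q*W)*((1-O*o*q*I)*(1-J*O*o*q^2*W*I)/((1-O*o*q*I^2)*(1-J*O*o*q^2*W)) * (Z'*(gi*((1-q*o*I)/((1-q*o)*I)))*(hb*((1-q*o*V)/((1-q*o)*V)))*R3)
     + -(I-1)*O*o*q*(I-J*q*W)/((1-O*o*q*I^2)*(1-J*O*o*q^2*W)) * (Z'*gm*(hb*((1-q*o*V)/((1-q*o)*V)))*R5)) =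
     Z*hb*gi*(W*(1-q*o*V)/V) * ((1-O*o*q*I)*(1-q*o*I)*(1-J*O*o*q^2*W*I)/(I*((1-q*o)*(1-J*O*o*q^2*W)*(1-O*o*q*I^2))) * R3
      + (I-1)*(1-O*I)*(o*o*O*q^2)*(I-J*q*W)/((1-q*o)*(1-J*O*o*q^2*W)*(1-O*o*q*I^2)) * R4) := by
    have e1 : (1-o*q*W)*((1-O*o*q*I)*(1-J*O*o*q^2*W*I)/((1-O*o*q*I^2)*(1-J*O*o*q^2*W)) * (Z'*(gi*((1-q*o*I)/((1-q*o)*I)))*(hb*((1-q*o*V)/((1-q*o)*V)))*R3)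
     + -(I-1)*O*o*q*(I-J*q*W)/((1-O*o*q*I^2)*(1-J*O*o*q^2*W)) * (Z'*gm*(hb*((1-q*o*V)/((1-q*o)*V)))*R5)) =
     ((1-o*q*W)*Z')*((1-O*o*q*I)*(1-J*O*o*q^2*W*I)/((1-O*o*q*I^2)*(1-J*O*o*q^2*W)) * ((gi*((1-q*o*I)/((1-q*o)*I)))*(hb*((1-q*o*V)/((1-q*o)*V)))*R3)
     + -((I-1)*gm)*O*o*q*(I-J*q*W)/((1-O*o*q*I^2)*(1-J*O*o*q^2*W)) * ((hb*((1-q*o*V)/((1-q*o)*V)))*R5)) := by ring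
    rw [e1, z, gp]
    have e2 : -((I-1)*(gi*((1-O*I)*(-(o*q))/(1-q*o))))*O*o*q*(I-J*q*W)/((1-O*o*q*I^2)*(1-J*O*o*q^2*W)) * ((hb*((1-q*o*V)/((1-q*o)*V)))*R5) =
      ((I-1)*R5)*(-((gi*((1-O*I)*(-(o*q))/(1-q*o))))*O*o*q*(I-J*q*W)/((1-O*o*q*I^2)*(1-J*O*o*q^2*W)) * ((hb*((1-q*o*V)/((1-q*o)*V))))) := by ring
    rw [e2, ← fd]
    clear e1 e2 z gp fd r
    generalize 1-O*o*q*I^2 = x1, 1-J*O*o*q^2*W*I = x2, 1-J*O*o*q^2*W = x3, 1-q*o*V = x4, 1-q*o*I = x5, 1-q*o = x6, 1-O*o*q*I = x7, 1-O*I = x8, I-J*q*W = x9 at *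
    field_simp
  rw [key, ← r]
  clear key r z gp fd
  rw [show 1-o*q*V = 1-q*o*V by ring]
  generalize 1-J*o*q^2*V^2 = x1, 1-q*o*V = x2, 1-q*J*V = x3, 1-J*o*q^2*V*W = x4, W-V = x5 at *
  field_simp

theorem HEX (M b : ℕ) : b ≤ M → ∀ i ≤ M, ∀ J O o : ℂ, G3 q J O o → HX q M i b J O o = HK q M i b J O o := by
  induction b with
  | zero =>
    intro _ i hi J O o g
    rw [HX_i0 M i hi _ _ _ g]; unfold HK; rw [hg_zero, Rc_zeroV]; ring
  | succ b ih =>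
    intro hb i hi J O o g
    have hq := g.hq
    have r := HX_b M i b g
    have k := HK_b M i b hi g
    rw [ih (by omega) i hi _ _ _ g, ih (by omega) i hi _ _ _ g.sh3, ih (by omega) (i-1) (by omega) _ _ _ g.sh3, k] at r
    obtain ⟨f1, f2, f3, f4, f5, f6, f7, f8, f9, f10⟩ := g.facts
    have hV : q^b ≠ 0 := pow_ne_zero _ hq
    have hMI : q^M - q^b ≠ 0 := by
      have := g.qne' (k := b) (l := M) (by omega)
      intro h; apply this; rw [sub_eq_zero.1 h, inv_mul_cancel₀ hV, sub_self]
    exact (mul_left_cancel₀ (div_ne_zero (mul_ne_zero (mul_ne_zero (mul_ne_zero (neg_ne_zero.2 g.h3) hq) (f1 b)) hMI) (f6 b)) (add_left_cancel r)).symm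

end qR

namespace qR

open Complex

def Lf (σ z : ℂ) (f : ℤ → ℂ) : Prop := ∀ n : ℤ, exp (f (n+1)) = exp (f n) * (1 - exp (z+2*σ*n))

def Lq (σ : ℂ) (f : ℤ → ℂ) : Prop := ∀ n : ℤ, 0 ≤ n → exp (f (n+1)) = exp (f n) * (1 - exp (2*σ+2*σ*n))

theorem LL0 {σ z : ℂ} {f : ℤ → ℂ} {m : ℤ} {k : ℕ} (H : ∀ n, m ≤ n → n < m+k → exp (f (n+1)) = exp (f n) * (1 - exp (z+2*σ*n)))
   {q X : ℂ} (hq : q = exp (2*σ)) (hX : X = exp (z+2*σ*m)) : poch q X k = exp (f (m+k) - f m) := by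
  rw [exp_sub, eq_div_iff (exp_ne_zero _)]
  induction k with
  | zero => simp [poch_zero]
  | succ k ih =>
    rw [poch_succ]
    have := H (m+k) (by omega) (by push_cast; omega)
    rw [show (m+((k+1:ℕ):ℤ)) = m+k+1 by push_cast; ring, this, ← ih (fun n h1 h2 => H n h1 (by push_cast; omega)), hX, hq, ← exp_nat_mul]
    rw [show (z+2*σ*((m+k:ℤ):ℂ)) = z+2*σ*m+k*(2*σ) by push_cast; ring, exp_add (z+2*σ*m)]
    ring

theorem LL1 {σ z : ℂ} {f : ℤ → ℂ} (H : Lf σ z f) (m : ℤ) (k : ℕ) {q X : ℂ} (hq : q = exp (2*σ) := by assumption)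
   (hX : X = exp (z+2*σ*m) := by subst_vars; simp only [← exp_nat_mul, ← exp_int_mul, ← exp_neg, ← exp_add, ← exp_sub]; congr 1; push_cast; ring) :
   poch q X k = exp (f (m+k) - f m) := LL0 (fun n _ _ => H n) hq hX

theorem LLq {σ : ℂ} {f : ℤ → ℂ} (H : Lq σ f) (k : ℕ) {q : ℂ} (hq : q = exp (2*σ)) :
   poch q q k = exp (f k - f 0) := by
  rw [LL0 (m := 0) (z := 2*σ) (f := f) (fun n h _ => H n h) hq (by rw [hq]; simp)]; simp

theorem Rflem {σ z : ℂ} (w : ℂ) (W n f0 f1: ℂ) (hw : w = -z-2*σ*W) (h : exp f1 = exp f0 * (1 - exp (z+2*σ*(W-n)))) :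
   exp (Real.pi*I*(n+1)+w*(n+1)+σ*(n+1)*n - f0) = exp (Real.pi*I*n+w*n+σ*n*(n-1) - f1) * (1 - exp (w+2*σ*n)) := by
  have h2 : exp (Real.pi*I*(n+1)+w*(n+1)+σ*(n+1)*n - f0) = exp (Real.pi*I*n+w*n+σ*n*(n-1)) * -exp (w+2*σ*n) / exp f0 := by
    rw [exp_sub, show Real.pi*I*(n+1)+w*(n+1)+σ*(n+1)*n = Real.pi*I*n+w*n+σ*n*(n-1) + (w+2*σ*n) + Real.pi*I by ring, exp_add, exp_add, exp_pi_mul_I]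
    ring
  rw [h2, exp_sub _ f1, h, show z+2*σ*(W-n) = -(w+2*σ*n) by rw [hw]; ring, exp_neg]
  have h3 : exp f1 ≠ 0 := exp_ne_zero _
  rw [h, show z+2*σ*(W-n) = -(w+2*σ*n) by rw [hw]; ring, exp_neg] at h3
  have := exp_ne_zero f0
  have h4 := exp_ne_zero (w+2*σ*n)
  have h5 := right_ne_zero_of_mul h3
  generalize exp (w+2*σ*n) = e at *
  rw [show 1 - e⁻¹ = -(1-e)/e by field_simp; ring] at *
  have : 1 - e ≠ 0 := by intro h; apply h5; rw [h]; simp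
  field_simp

theorem RF {σ z : ℂ} {f : ℤ → ℂ} (H : Lf σ z f) (w : ℂ) (W : ℤ) (hw : w = -z-2*σ*W) :
   Lf σ w (fun n => Real.pi*I*n+w*n+σ*n*(n-1) - f (W+1-n)) := by
  intro n
  have := H (W-n)
  have := Rflem w W n (f (W-n)) (f (W-n+1)) hw (by rw [this]; push_cast; ring_nf)
  simp only
  rw [show W+1-(n+1) = W-n by ring, show W+1-n = W-n+1 by ring, ← this]
  push_cast; ring_nf

theorem LLr {σ : ℂ} {f : ℤ → ℂ} (H : Lq σ f) (W k : ℕ) (hk : k ≤ W) {q X : ℂ} (hq : q = exp (2*σ)) (hX : X = (q^W)⁻¹):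
   poch q X k = exp (Real.pi*I*k-2*σ*W*k+σ*k*(k-1) - f (W-k) + f W) := by
  rw [LL0 (m := 0) (z := -2*σ*W) (f := fun n => Real.pi*I*n+(-2*σ*W)*n+σ*n*(n-1) - f (W-n)) _ hq]
  · simp; ring_nf
  · rw [hX, hq, ← exp_nat_mul, ← exp_neg]; congr 1; push_cast; ring
  · intro n h0 h
    have h1 := H (W-n-1) (by omega)
    have := Rflem (z := 2*σ) (-2*σ*W) (W-1) n (f (W-n-1)) (f (W-n-1+1)) (by ring) (by rw [h1]; push_cast; ring_nf)
    rw [show (W:ℤ)-(n+1) = W-n-1 by ring, show (W:ℤ)-n = W-n-1+1 by ring, ← this]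
    push_cast; ring_nf

theorem IVlem {σ z : ℂ} (n f0 f1: ℂ) (h : exp f1 = exp f0 * (1 - exp (z+2*σ*n))) :
   exp (Real.pi*I*(n+1)-z*(n+1)-σ*(n+1)*n + f1) = exp (Real.pi*I*n-z*n-σ*n*(n-1) + f0) * (1 - exp (-z+2*(-σ)*n)) := by
  rw [exp_add, h, exp_add _ f0, show Real.pi*I*(n+1)-z*(n+1)-σ*(n+1)*n = Real.pi*I*n-z*n-σ*n*(n-1) + (-z+2*(-σ)*n) + Real.pi*I by ring, exp_add, exp_add, exp_pi_mul_I,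
    show z+2*σ*n = -(-z+2*(-σ)*n) by ring, exp_neg]
  have h4 := exp_ne_zero (-z+2*(-σ)*n)
  generalize exp (-z+2*(-σ)*n) = e at *
  field_simp; ring

theorem IV {σ z : ℂ} {f : ℤ → ℂ} (H : Lf σ z f) {w : ℂ} (hw : w = -z) :
   Lf (-σ) w (fun n => Real.pi*I*n-z*n-σ*n*(n-1) + f n) := by
  intro n
  have := IVlem n (f n) (f (n+1)) (H n)
  rw [hw]
  simp only
  rw [← this]; push_cast; ring_nf

theorem IVq {σ : ℂ} {f : ℤ → ℂ} (H : Lq σ f) :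
   Lq (-σ) (fun n => Real.pi*I*n-2*σ*n-σ*n*(n-1) + f n) := by
  intro n hn
  have := IVlem n (f n) (f (n+1)) (H n hn)
  simp only
  rw [show 2*(-σ) = -(2*σ) by ring] at *
  rw [← this]; push_cast; ring_nf

theorem one_poch (q X : ℂ) : 1 - X = poch q X 1 := by simp [poch_succ, poch_zero]

theorem exists_Lf (σ z : ℂ) (h : ∀ n : ℤ, 1 - exp (z+2*σ*n) ≠ 0) : ∃ f : ℤ → ℂ, Lf σ z f := by
  refine ⟨fun n => match n with
    | Int.ofNat n => ∑ l ∈ Finset.range n, log (1 - exp (z+2*σ*l))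
    | Int.negSucc n => - ∑ l ∈ Finset.range (n+1), log (1 - exp (z+2*σ*((Int.negSucc l : ℤ):ℂ))), ?_⟩
  intro n
  match n with
  | Int.ofNat n =>
    rw [show Int.ofNat n + 1 = Int.ofNat (n+1) from rfl]
    simp only
    rw [Finset.sum_range_succ, exp_add, exp_log]
    · rfl
    · simpa using h n
  | Int.negSucc 0 =>
    rw [show Int.negSucc 0 + 1 = Int.ofNat 0 from rfl]
    simp only [Finset.range_zero, Finset.sum_empty, zero_add, Finset.range_one, Finset.sum_singleton]
    rw [exp_neg, exp_log (h _), exp_zero, inv_mul_cancel₀ (h _)]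
  | Int.negSucc (n+1) =>
    rw [show Int.negSucc (n+1) + 1 = Int.negSucc n from rfl]
    simp only
    rw [Finset.sum_range_succ _ (n+1), neg_add, exp_add, exp_neg (log _), exp_log (h _), mul_assoc, inv_mul_cancel₀ (h _), mul_one]

theorem exists_Lq (σ : ℂ) (h : ∀ n : ℕ, 1 - exp (2*σ+2*σ*n) ≠ 0) : ∃ f : ℤ → ℂ, Lq σ f := by
  refine ⟨fun n => ∑ l ∈ Finset.range n.toNat, log (1 - exp (2*σ+2*σ*l)), ?_⟩
  intro n hn
  lift n to ℕ using hn
  simp only [show ((n:ℤ)+1).toNat = n+1 by omega, Int.toNat_natCast]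
  rw [Finset.sum_range_succ, exp_add, exp_log]
  · rfl
  · exact h n

theorem OmE {σ z1 z2 z3 ρ : ℂ} {f1 f2 f3 f23 f123 fq : ℤ → ℂ} (H1 : Lf σ z1 f1) (H2 : Lf σ z2 f2) (H3 : Lf σ z3 f3)
   (H23 : Lf σ (z2+z3) f23) (H123 : Lf σ (z1+z2+z3) f123) (Hq : Lq σ fq) {q s J O o t2 : ℂ} (hq : q = exp (2*σ))
   (h1 : J = exp z1) (h2 : O = exp z2) (h3 : o = exp z3) (hr : s*t2 = exp ρ) (K n : ℤ) (h0 : 0 ≤ n) (hn : n ≤ K) :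
   Om q s J O o t2 K n = exp (fq K - fq n - fq (K-n) + fq 0 + (f23 (2*n+2) - f23 (2*n+1)) + (f2 (n+1)-f2 1)
     + (f123 (K+2+n) - f123 (K+2)) + (f1 (K-n+1)-f1 1) - (2*n-K)*ρ - (f23 (K+n+2) - f23 (n+1)) - (f3 (n+1) - f3 1)) := by
  lift n to ℕ using h0
  obtain ⟨m, rfl⟩ : ∃ m : ℕ, K = n+m := ⟨(K-n).toNat, by omega⟩
  unfold Om binom
  rw [if_pos (by omega), hr, show ((n:ℤ)+m-n).toNat = m by omega, show ((n:ℤ)+m).toNat = n+m by omega, show ((n:ℤ)+m+1).toNat = n+m+1 by omega, Int.toNat_natCast,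
    one_poch q, LLq Hq _ hq, LLq Hq _ hq, LLq Hq _ hq, LL1 H2 1 n, LL1 H1 1 m, LL1 H123 (n+m+2) n, LL1 H3 1 n,
    LL1 H23 (2*n+1) 1, LL1 H23 (n+1) (n+m+1), ← exp_int_mul]
  simp only [← exp_add, ← exp_sub]
  congr 1
  push_cast
  ring_nf

theorem omE {σ ρ q r : ℂ} (hq : q = exp (2*σ)) (hr : r = exp ρ) (n : ℤ) : om q r n = exp (Real.pi*I*n + ρ*n+σ*n*(n+1)) := by
  unfold om
  have : ((n*(n+1)/2 : ℤ) : ℂ) = n*(n+1)/2 := by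
    rw [Int.cast_div (Int.even_mul_succ_self n).two_dvd (by simp)]; push_cast; ring
  rw [hq, hr, ← exp_pi_mul_I, ← exp_int_mul, ← exp_int_mul, ← exp_int_mul, this, ← exp_add, ← exp_add]
  congr 1; ring

theorem TqE {σ q : ℂ} (hq : q = exp (2*σ)) (n : ℕ) : Tq q n = exp (σ*n*(n-1)) := by
  induction n with
  | zero => simp [Tq_zero]
  | succ n ih => rw [Tq_succ, ih, hq, ← exp_nat_mul, ← exp_add]; congr 1; push_cast; ring

end qR

namespace qR

open Complex

theorem exp_sq {z c : ℂ} (h : c ≠ 0) (hz : z^2 = c) : ∃ τ, z = exp τ ∧ c = exp (2*τ) := by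
  have : z ≠ 0 := by rintro rfl; apply h; rw [← hz]; simp
  refine ⟨log z, (exp_log this).symm, ?_⟩
  rw [two_mul, exp_add, exp_log this, ← hz, sq]

set_option maxHeartbeats 4000000 in
theorem Sid {q s L J O o F t0 t1 t2 t3 t4 : ℂ} {M j : ℕ} (g : Gn q L J O o F (M+j)) (hs : s^2 = q)
   (ht1 : t1^2 = J) (ht2 : t2^2 = O) (ht3 : t3^2 = o) (ht4 : t4^2 = F) (ht0 : t0 = (s^(2*((M+j:ℕ):ℤ)+3)*t1*t2*t3*t4)⁻¹)
   {i x y a b : ℕ} (hi : i ≤ M) (ha : a ≤ M) (hb : b ≤ M) (hay : a+y ≤ M+j) (hbx : b+x ≤ M+j) :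
   (t0/t1)^i*(t3/t1)^j*(t1/t0)^x*(t1/t4)^y*(xi q O o t2 t3 i*xi q L F t0 t4 j/(xi q O F t2 t4 x*xi q L o t0 t3 y))
     *(om q (t0*t2*t4/t1) j/om q (t3*t0*t2/t1) i)*om q (s*t1*t2*t3) (M+j:ℕ)
     *(om q⁻¹ (t1⁻¹*t3⁻¹*t2⁻¹/t0⁻¹) b*Om q⁻¹ s⁻¹ J⁻¹ o⁻¹ O⁻¹ t3⁻¹ M i*Om q⁻¹ s⁻¹ O⁻¹ F⁻¹ L⁻¹ t4⁻¹ ((M+j:ℕ)-b) j*Om q⁻¹ s⁻¹ L⁻¹ o⁻¹ J⁻¹ t3⁻¹ ((M+j:ℕ)-x) b)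
     *hv q M J O o a*KK q M j x a y L J O o F
   = om q (t1*t2*t3/t4) a*Om q s J O o t2 M i*Om q s o L F t0 ((M+j:ℕ)-a) j*Om q s F O J t2 ((M+j:ℕ)-y) a
     *wt q (J*o) L O F (q^M) (q^(M+j)/q^x) (q^(M+j)) b*(Z0 q M J O o*hg q o O i*hg q o J b) := by
  have k0 := g.hq; have k1 := g.h1; have k3 := g.h3
  obtain ⟨σ, es, hq⟩ := exp_sq g.hq hs
  obtain ⟨τ1, e1, h1⟩ := exp_sq g.h1 ht1
  obtain ⟨τ2, e2, h2⟩ := exp_sq g.h2 ht2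
  obtain ⟨τ3, e3, h3⟩ := exp_sq g.h3 ht3
  obtain ⟨τ4, e4, h4⟩ := exp_sq g.h4 ht4
  obtain ⟨τ0, hτ⟩ : ∃ τ, τ = -(τ1+τ2+τ3+τ4)-σ*(2*(M+j)+3) := ⟨_, rfl⟩
  have e0 : t0 = exp τ0 := by
    rw [ht0, es, e1, e2, e3, e4, ← exp_int_mul]; simp only [← exp_add, ← exp_neg]; rw [hτ]; congr 1; push_cast; ring
  have h0 : L = exp (2*τ0) := by
    have := g.rel
    rw [h1, h2, h3, h4, hq, ← exp_nat_mul] at this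
    simp only [mul_assoc, ← exp_add] at this
    rw [eq_inv_of_mul_eq_one_left this, ← exp_neg, hτ]; congr 1; push_cast; ring
  clear ht0 hs ht1 ht2 ht3 ht4
  have A (d0 d1 d2 d3 d4 : ℤ) (z : ℂ) (hz : z = d0*(2*τ0)+d1*(2*τ1)+d2*(2*τ2)+d3*(2*τ3)+d4*(2*τ4)) (h : ¬ (d0 = d1 ∧ d1 = d2 ∧ d2 = d3 ∧ d3 = d4)) : ∃ f, Lf σ z f := by
    refine exists_Lf σ z fun n => g.ne d0 d1 d2 d3 d4 n (fun _ => ?_) fun hh => h ⟨hh.1, hh.2.1, hh.2.2.1, hh.2.2.2.1⟩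
    rw [h0, h1, h2, h3, h4, hq, hz]; simp only [← exp_int_mul, ← exp_add]; congr 1; ring
  obtain ⟨fq, Hq⟩ := exists_Lq σ fun n => by
    have := g.qne n
    rwa [hq, ← exp_nat_mul, ← exp_add, mul_comm (n:ℂ)] at this
  obtain ⟨f0, H0⟩ := A 1 0 0 0 0 (2*τ0) (by push_cast; ring) (by omega)
  obtain ⟨f1, H1⟩ := A 0 1 0 0 0 (2*τ1) (by push_cast; ring) (by omega)
  obtain ⟨f2, H2⟩ := A 0 0 1 0 0 (2*τ2) (by push_cast; ring) (by omega)
  obtain ⟨f3, H3⟩ := A 0 0 0 1 0 (2*τ3) (by push_cast; ring) (by omega)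
  obtain ⟨f4, H4⟩ := A 0 0 0 0 1 (2*τ4) (by push_cast; ring) (by omega)
  obtain ⟨f03, H03⟩ := A 1 0 0 1 0 (2*τ0+2*τ3) (by push_cast; ring) (by omega)
  obtain ⟨f04, H04⟩ := A 1 0 0 0 1 (2*τ0+2*τ4) (by push_cast; ring) (by omega)
  obtain ⟨f12, H12⟩ := A 0 1 1 0 0 (2*τ2+2*τ1) (by push_cast; ring) (by omega)
  obtain ⟨f13, H13⟩ := A 0 1 0 1 0 (2*τ1+2*τ3) (by push_cast; ring) (by omega)
  obtain ⟨f23, H23⟩ := A 0 0 1 1 0 (2*τ2+2*τ3) (by push_cast; ring) (by omega)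
  obtain ⟨f24, H24⟩ := A 0 0 1 0 1 (2*τ2+2*τ4) (by push_cast; ring) (by omega)
  clear A g
  have R24 := RF H24 (2*τ0+2*τ3+2*τ1) (2*(M+j)+3) (by rw [hτ]; push_cast; ring)
  have R04 := RF H04 (2*τ1+2*τ2+2*τ3) (2*(M+j)+3) (by rw [hτ]; push_cast; ring)
  have R12 := RF H12 (2*τ3+2*τ0+2*τ4) (2*(M+j)+3) (by rw [hτ]; push_cast; ring)
  have R03 := RF H03 (2*τ4+2*τ2+2*τ1) (2*(M+j)+3) (by rw [hτ]; push_cast; ring)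
  have R13 := RF H13 (2*τ2+2*τ4+2*τ0) (2*(M+j)+3) (by rw [hτ]; push_cast; ring)
  have S0 := RF H0 (-(2*τ0)) 0 (by push_cast; ring)
  have S2 := RF H2 (-(2*τ2)) 0 (by push_cast; ring)
  have S3 := RF H3 (-(2*τ3)) 0 (by push_cast; ring)
  have S4 := RF H4 (-(2*τ4)) 0 (by push_cast; ring)
  have S13 := RF H13 (-(2*τ1+2*τ3)) 0 (by push_cast; ring)
  have iq : q⁻¹ = exp (2*(-σ)) := by rw [hq, ← exp_neg]; congr 1; ring
  have IE {u v : ℂ} (h : u = exp v) : u⁻¹ = exp (-v) := by rw [h, exp_neg]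
  have O1 := OmE H1 H2 H3 H23 R04 Hq hq h1 h2 h3 (ρ := σ+τ2) (s := s) (t2 := t2) (by rw [es, e2, exp_add]) M i (by omega) (by omega)
  have O2 := OmE H3 H0 H4 H04 R12 Hq hq h3 h0 h4 (ρ := σ+τ0) (s := s) (t2 := t0) (by rw [es, e0, exp_add]) ((M+j:ℕ)-a) j (by omega) (by omega)
  have O3 := OmE H4 H2 H1 H12 R03 Hq hq h4 h2 h1 (ρ := σ+τ2) (s := s) (t2 := t2) (by rw [es, e2, exp_add]) ((M+j:ℕ)-y) a (by omega) (by omega)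
  have O4 := OmE (IV H1 rfl) (IV H3 rfl) (IV H2 rfl) (IV H23 (by ring)) (IV R04 (by ring)) (IVq Hq) iq (IE h1) (IE h3) (IE h2) (ρ := -σ+-τ3) (s := s⁻¹) (t2 := t3⁻¹) (by rw [IE es, IE e3, exp_add]) M i (by omega) (by omega)
  have O5 := OmE (IV H2 rfl) (IV H4 rfl) (IV H0 rfl) (IV H04 (by ring)) (IV R13 (by ring)) (IVq Hq) iq (IE h2) (IE h4) (IE h0) (ρ := -σ+-τ4) (s := s⁻¹) (t2 := t4⁻¹) (by rw [IE es, IE e4, exp_add]) ((M+j:ℕ)-b) j (by omega) (by omega)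
  have O6 := OmE (IV H0 rfl) (IV H3 rfl) (IV H1 rfl) (IV H13 (by ring)) (IV R24 (by ring)) (IVq Hq) iq (IE h0) (IE h3) (IE h1) (ρ := -σ+-τ3) (s := s⁻¹) (t2 := t3⁻¹) (by rw [IE es, IE e3, exp_add]) ((M+j:ℕ)-x) b (by omega) (by omega)
  rw [O1, O2, O3, O4, O5, O6]
  clear O1 O2 O3 O4 O5 O6
  have w1 (n : ℤ) := omE hq (show t0*t2*t4/t1 = exp (τ0+τ2+τ4-τ1) by rw [e0, e2, e4, e1]; simp only [← exp_add, ← exp_sub]) n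
  have w2 (n : ℤ) := omE hq (show t3*t0*t2/t1 = exp (τ3+τ0+τ2-τ1) by rw [e0, e2, e3, e1]; simp only [← exp_add, ← exp_sub]) n
  have w3 (n : ℤ) := omE hq (show s*t1*t2*t3 = exp (σ+τ1+τ2+τ3) by rw [es, e2, e3, e1]; simp only [← exp_add, ← exp_sub]) n
  have w4 (n : ℤ) := omE hq (show t1*t2*t3/t4 = exp (τ1+τ2+τ3-τ4) by rw [e4, e2, e3, e1]; simp only [← exp_add, ← exp_sub]) n
  have w5 (n : ℤ) := omE iq (show t1⁻¹*t3⁻¹*t2⁻¹/t0⁻¹ = exp (-τ1+-τ3+-τ2- -τ0) by rw [IE e0, IE e2, IE e3, IE e1]; simp only [← exp_add, ← exp_sub]) n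
  rw [w1, w2, w3, w4, w5]
  clear w1 w2 w3 w4 w5
  unfold wt pr KK hv t55 hg Z0 xi
  simp only [Int.toNat_natCast, TqE hq,
    show poch q (J*o*q) b = _ from LL1 H13 1 b,
    show poch q q b = _ from LLq Hq b hq,
    show 1-J*o*q*q^b*q^b = _ from (one_poch q _).trans (LL1 H13 (2*b+1) 1),
    show 1-J*o*q = _ from (one_poch q _).trans (LL1 H13 1 1),
    show poch q ((q^(M+j)/q^x)⁻¹) b = _ from LLr Hq (M+j-x) b (by omega) hq (by rw [pow_sub₀ _ k0 (by omega)]; rfl),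
    show poch q (J*o*q^2/(q^(M+j)/q^x)⁻¹) b = _ from LL1 H13 (M+j-x+2) b,
    show poch q ((L*(J*o)*(q^(M+j)/q^x)*q^2)) b = _ from LL1 R24 (M+j-x+2) b,
    show poch q (J*o*q^2/(L*(J*o)*(q^(M+j)/q^x)*q^2)) b = _ from LL1 S0 (-M-j+x) b,
    show poch q ((O*(J*o)*q^M*q^2)) b = _ from LL1 R04 (M+2) b,
    show poch q (J*o*q^2/(O*(J*o)*q^M*q^2)) b = _ from LL1 S2 (-M) b,
    show poch q ((q^M)⁻¹) b = _ from LLr Hq M b (by omega) hq rfl,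
    show poch q (J*o*q^2/(q^M)⁻¹) b = _ from LL1 H13 (M+2) b,
    show poch q ((J*o*q^(M+j)*q^2)) b = _ from LL1 H13 (M+j+2) b,
    show poch q (J*o*q^2/(J*o*q^(M+j)*q^2)) b = _ from LLr Hq (M+j) b (by omega) hq (by field_simp),
    show poch q (J*o*q^2) M = _ from LL1 H13 2 M,
    show poch q (F*q*q^j) M = _ from LL1 H4 (j+1) M,
    show poch q ((L*q^(M+j))⁻¹) M = _ from LL1 S0 (-M-j) M,
    show poch q ((O*q^M)⁻¹) M = _ from LL1 S2 (-M) M,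
    show poch q ((L*q^(M+j))⁻¹) x = _ from LL1 S0 (-M-j) x,
    show poch q (q*O) x = _ from LL1 H2 1 x,
    show poch q ((J*o*q*q^(M+j))⁻¹) x = _ from LL1 S13 (-M-j-1) x,
    show poch q (F*q) x = _ from LL1 H4 1 x,
    show poch q (q*O) a = _ from LL1 H2 1 a,
    show poch q (J*O*F*q^2*q^(M+j)/q^y) a = _ from LL1 R03 (M+j-y+2) a,
    show poch q (q*L) y = _ from LL1 H0 1 y,
    show poch q (L*o*F*q^2*q^(M+j)/q^a) y = _ from LL1 R12 (M+j-a+2) y,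
    show poch q ((q^(M+j))⁻¹) (a+y) = _ from LLr Hq (M+j) (a+y) (by omega) hq rfl,
    show poch q (q*J) a = _ from LL1 H1 1 a,
    show poch q (q*o) y = _ from LL1 H3 1 y,
    show poch q ((F*q^(M+j))⁻¹) (a+y) = _ from LL1 S4 (-M-j) (a+y),
    show poch q ((q^(M+j))⁻¹) a = _ from LLr Hq (M+j) a (by omega) hq rfl,
    show poch q ((q^(M+j))⁻¹) y = _ from LLr Hq (M+j) y (by omega) hq rfl,
    show poch q (J*O*q) a = _ from LL1 H12 1 a,
    show 1-J*O*q*q^a*q^a = _ from (one_poch q _).trans (LL1 H12 (2*a+1) 1),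
    show poch q (J*O*o*q^2*q^M) a = _ from LL1 R04 (M+2) a,
    show poch q ((q^M)⁻¹) a = _ from LLr Hq M a (by omega) hq rfl,
    show poch q q a = _ from LLq Hq a hq,
    show poch q (J*O*q*q/(J*O*o*q^2*q^M)) a = _ from LL1 S3 (-M) a,
    show poch q (J*O*q*q*q^M) a = _ from LL1 H12 (M+2) a,
    show 1-J*O*q = _ from (one_poch q _).trans (LL1 H12 1 1),
    show poch q (q*o) i = _ from LL1 H3 1 i,
    show poch q (q*O) i = _ from LL1 H2 1 i,
    show poch q (q*o) b = _ from LL1 H3 1 b,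
    show poch q (q*J) b = _ from LL1 H1 1 b,
    show poch q (J*O*q^2) M = _ from LL1 H12 2 M,
    show poch q ((o*q^M)⁻¹) M = _ from LL1 S3 (-M) M,
    show poch q (q*L) j = _ from LL1 H0 1 j,
    show poch q (q*F) j = _ from LL1 H4 1 j,
    show poch q (q*F) x = _ from LL1 H4 1 x]
  clear H0 H1 H2 H3 H4 H03 H04 H12 H13 H23 H24 R24 R04 R12 R03 R13 S0 S2 S3 S4 S13 Hq iq IE
  have n1 (u : ℂ) : -u = exp (Real.pi*I)*u := by simp
  rw [n1 (o*q), n1 (J*O*q*q*q^M/(J*O*o*q^2*q^M))]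
  simp only [h0, h1, h2, h3, h4, hq, e0, e1, e2, e3, e4, ← exp_nat_mul, ← exp_int_mul, ← exp_add, ← exp_sub]
  rw [exp_eq_exp_iff_exists_int]
  refine ⟨j+b, ?_⟩
  have hx : x ≤ M+j := by omega
  rw [hτ]
  push_cast [Nat.cast_sub hx]
  ring_nf

end qR

namespace qR

open Finset

theorem poch_inv {q α : ℂ} (hq : q ≠ 0) (h : α ≠ 0) (k : ℕ) : poch q⁻¹ α⁻¹ k = poch q α k*((-1)^k*(Tq q k)⁻¹)*(α⁻¹)^k := by
  induction k with
  | zero => simp [poch_zero, Tq_zero]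
  | succ k ih =>
    rw [poch_succ, ih, poch_succ, Tq_succ, mul_inv, pow_succ, pow_succ]
    have : 1 - α⁻¹*q⁻¹^k = -(1-α*q^k)*(q^k)⁻¹*α⁻¹ := by rw [inv_pow]; field_simp; ring
    rw [this]; ring

theorem Fs_inv {q A B A' B' D E G : ℂ} (n : ℕ) (hq : q ≠ 0) (hA : A ≠ 0) (hB : B ≠ 0) (hA' : A' ≠ 0) (hB' : B' ≠ 0) (hD : D ≠ 0) (hE : E ≠ 0) (hG : G ≠ 0)
    (h : D*E*G = q*A*B*A'*B') : Fs q⁻¹ n A⁻¹ B⁻¹ A'⁻¹ B'⁻¹ D⁻¹ E⁻¹ G⁻¹ = Fs q n A B A' B' D E G := by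
  unfold Fs
  apply sum_congr rfl
  intro k _
  simp only [poch_inv hq, hA, hB, hA', hB', hD, hE, hG, hq, ne_eq, not_false_eq_true]
  have e : ((-1:ℂ)^k*(Tq q k)⁻¹) ≠ 0 := mul_ne_zero (by simp) (inv_ne_zero (Tq_ne hq k))
  generalize ((-1:ℂ)^k*(Tq q k)⁻¹) = t at *
  have h2 : D⁻¹^k*E⁻¹^k*G⁻¹^k*q^k = A⁻¹^k*B⁻¹^k*A'⁻¹^k*B'⁻¹^k := by
    simp only [← mul_pow]; congr 1
    rw [← mul_inv, ← mul_inv, h]; field_simp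
  have h3 : A⁻¹^k*B⁻¹^k*A'⁻¹^k*B'⁻¹^k*t^4/(D⁻¹^k*E⁻¹^k*G⁻¹^k*t^4) = q^k := by
    rw [← h2]; field_simp
  have h4 : q⁻¹^k ≠ 0 := by simp [hq]
  calc _ = (A⁻¹^k*B⁻¹^k*A'⁻¹^k*B'⁻¹^k*t^4/(D⁻¹^k*E⁻¹^k*G⁻¹^k*t^4))*(q⁻¹^k/q⁻¹^k)*(poch q A k * poch q B k * poch q A' k * poch q B' k/ (poch q D k * poch q E k * poch q G k * poch q q k)) := by
        simp only [div_eq_mul_inv, mul_inv]; ring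
    _ = _ := by rw [h3, div_self h4]; ring

theorem pbr {q : ℂ} (hq : q ≠ 0) (s J O o t2 : ℂ) (K : ℤ) (n x : ℕ) (hn : (n:ℤ) ≤ K) (hx : (x:ℤ) ≤ K) {W : ℂ} (hW : W = q^K) :
    p q s J O o t2 K n x = Om q s J O o t2 K n*Rc q n (q^n) (q^x) W J O o := by
  unfold p Rc Fs
  rw [if_pos (by omega), Int.toNat_natCast]; congr 1
  apply sum_congr rfl
  intro k _
  rw [hW]
  simp only [zpow_add₀ hq, zpow_neg, zpow_natCast, zpow_one, zpow_ofNat, pow_one]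
  rw [show O*o*q*q^n = O*o*(q^n*q) by ring, show J*O*q*q^x = J*O*(q^x*q) by ring, show J*O*o*q^2*q^K = J*O*o*(q^K*q^2) by ring, mul_right_comm (poch q (q*O) k)]

theorem pbr' {q : ℂ} (hq : q ≠ 0) (s J O o t2 : ℂ) (h1 : J ≠ 0) (h2 : O ≠ 0) (h3 : o ≠ 0) (K : ℤ) (n x : ℕ) (hn : (n:ℤ) ≤ K) (hx : (x:ℤ) ≤ K) {W : ℂ} (hW : W = q^K) :
    p q⁻¹ s J⁻¹ O⁻¹ o⁻¹ t2 K n x = Om q⁻¹ s J⁻¹ O⁻¹ o⁻¹ t2 K n*Rc q n (q^n) (q^x) W J O o := by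
  have hW' : W ≠ 0 := by rw [hW]; exact zpow_ne_zero _ hq
  rw [pbr (inv_ne_zero hq) s _ _ _ t2 K n x hn hx (W := W⁻¹) (by rw [hW, inv_zpow])]
  congr 1
  unfold Rc
  rw [← Fs_inv (q := q)]
  · simp only [mul_inv, inv_inv, inv_pow]
  all_goals first | positivity | skip
  all_goals first | (simp [*]; done) | (field_simp)

theorem Gn.pn {q L J O o F : ℂ} {N : ℕ} (g : Gn q L J O o F N) (e0 e1 e2 e3 e4 m : ℤ) {X : ℂ} (k : ℕ)
    (h : ¬ (e0 = e1 ∧ e1 = e2 ∧ e2 = e3 ∧ e3 = e4) := by omega) (hX : q ≠ 0 → X = L^e0*J^e1*O^e2*o^e3*F^e4*q^m := by intro hq; simp only [zpow_add₀ hq, zpow_sub₀ hq, zpow_neg, zpow_natCast, zpow_one, zpow_zero, zpow_ofNat, pow_add, div_one, one_mul, mul_one]; first | done | ring1 | (field_simp; done) | (field_simp; ring1)) : poch q X k ≠ 0 :=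
  poch_ne fun l _ => g.ne e0 e1 e2 e3 e4 (m+l) (fun hq => by rw [hX hq, zpow_add₀ hq, zpow_natCast]; ring) (by tauto)

variable {q s L J O o F t0 t1 t2 t3 t4 : ℂ} {M j : ℕ}

theorem KK0_ne (g : Gn q L J O o F (M+j)) (x y : ℕ) (hy : y ≤ M+j) : KK q M j x 0 y L J O o F ≠ 0 := by
  have ⟨hq, k0, k1, k2, k3, k4⟩ := g.nz
  have hy : poch q (q^(M+j))⁻¹ y ≠ 0 := poch_ne fun l hl => g.qne' (by omega)
  unfold KK
  simp only [poch_zero, zero_add, pow_zero, one_pow]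
  have a1 := g.pn 0 1 0 1 0 2 (X := J*o*q^2) M
  have a2 := g.pn 0 0 0 0 1 (j+1) (X := F*q*q^j) M
  have a3 (k) := g.pn (-1) 0 0 0 0 (-(M+j)) (X := (L*q^(M+j))⁻¹) k
  have a4 := g.pn 0 0 (-1) 0 0 (-M) (X := (O*q^M)⁻¹) M
  have a5 := g.pn 0 0 1 0 0 1 (X := q*O) x
  have a6 := g.pn 0 (-1) 0 (-1) 0 (-(M+j+1)) (X := (J*o*q*q^(M+j))⁻¹) x
  have a7 := g.pn 0 0 0 0 1 1 (X := F*q) x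
  have a8 := g.pn 1 0 0 0 0 1 (X := q*L) y
  have a9 := g.pn 1 0 0 1 1 (M+j+2) (X := L*o*F*q^2*q^(M+j)/1) y
  have b1 := g.pn 0 0 0 1 0 1 (X := q*o) y
  have b2 := g.pn 0 0 0 0 (-1) (-(M+j)) (X := (F*q^(M+j))⁻¹) y
  simp only [div_one] at a9
  simp only [ne_eq, mul_eq_zero, div_eq_zero_iff, pow_eq_zero_iff', not_or, *]; simp [*]

theorem Z0_ne (g : Gn q L J O o F (M+j)) (i : ℕ) : Z0 q M J O o*hg q o O i ≠ 0 := by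
  have hq := g.hq; have k3 := g.h3
  have a1 := g.pn 0 1 1 0 0 2 (X := J*O*q^2) M
  have a2 := g.pn 0 0 0 (-1) 0 (-M) (X := (o*q^M)⁻¹) M
  have a3 := g.pn 0 0 1 0 0 1 (X := q*O) i
  have a4 := g.pn 0 0 0 1 0 1 (X := q*o) i
  have := Tq_ne hq i
  unfold Z0 hg
  simp only [ne_eq, mul_eq_zero, div_eq_zero_iff, not_or, *]; simp [*]

theorem Gn.g3 (g : Gn q L J O o F (M+j)) : G3 q J O o :=
  ⟨g.hq, g.h1, g.h2, g.h3, fun e1 e2 e3 m h => by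
    obtain ⟨h1, h2, h3, h4, h5⟩ := g.ind 0 e1 e2 e3 0 m (by simpa using h)
    exact ⟨by omega, by omega, by omega, by simpa using h5⟩⟩

end qR

namespace qR

open Finset

variable {q s L J O o F t0 t1 t2 t3 t4 : ℂ} {M j : ℕ}

theorem Gexp (hq : q ≠ 0) (hc0 : (q^(2*((M+j:ℕ):ℤ)+3)*J*O*o*F)⁻¹ = L) (ht0 : (s^(2*((M+j:ℕ):ℤ)+3)*t1*t2*t3*t4)⁻¹ = t0)
    {i x y : ℕ} (hi : i ≤ M) (hxy : x+y ≤ M+j) :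
    G q s J O o F t1 t2 t3 t4 (M+j:ℕ) i j x y = ∑ a ∈ range (min M (M+j-y)+1),
      (om q (t1*t2*t3/t4) a*Om q s J O o t2 M i*Om q s o L F t0 ((M+j:ℕ)-a) j*Om q s F O J t2 ((M+j:ℕ)-y) a)
      *(Rc q i (q^i) (q^a) (q^M) J O o*(Rc q j (q^j) (q^y) (q^(M+j)/q^a) o L F*Rc q a (q^a) (q^x) (q^(M+j)/q^y) F O J)) := by
  unfold G
  rw [if_pos (by omega), hc0, ht0, show ((M+j:ℕ):ℤ)-j = M by omega, show (min (M:ℤ) ((M+j:ℕ)-y)).toNat = min M (M+j-y) by omega]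
  apply sum_congr rfl
  intro a ha
  rw [mem_range] at ha
  have e (k : ℕ) : q^(M+j)/q^k = q^(((M+j:ℕ):ℤ)-k) := by rw [zpow_sub₀ hq, zpow_natCast, zpow_natCast]
  rw [pbr hq s _ _ _ _ M i a (by omega) (by omega) (zpow_natCast q M).symm, pbr hq s _ _ _ _ _ j y (by omega) (by omega) (e a),
    pbr hq s _ _ _ _ _ a x (by omega) (by omega) (e y)]
  ring

theorem Gexp' (hq : q ≠ 0) (h0 : L ≠ 0) (h1 : J ≠ 0) (h2 : O ≠ 0) (h3 : o ≠ 0) (h4 : F ≠ 0)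
    (hc4 : (q⁻¹^(2*((M+j:ℕ):ℤ)+3)*J⁻¹*o⁻¹*O⁻¹*L⁻¹)⁻¹ = F⁻¹) (ht4 : (s⁻¹^(2*((M+j:ℕ):ℤ)+3)*t1⁻¹*t3⁻¹*t2⁻¹*t0⁻¹)⁻¹ = t4⁻¹)
    {i x y : ℕ} (hi : i ≤ M) (hxy : x+y ≤ M+j) :
    G q⁻¹ s⁻¹ J⁻¹ o⁻¹ O⁻¹ L⁻¹ t1⁻¹ t3⁻¹ t2⁻¹ t0⁻¹ (M+j:ℕ) i j y x = ∑ b ∈ range (min M (M+j-x)+1),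
      (om q⁻¹ (t1⁻¹*t3⁻¹*t2⁻¹/t0⁻¹) b*Om q⁻¹ s⁻¹ J⁻¹ o⁻¹ O⁻¹ t3⁻¹ M i*Om q⁻¹ s⁻¹ O⁻¹ F⁻¹ L⁻¹ t4⁻¹ ((M+j:ℕ)-b) j*Om q⁻¹ s⁻¹ L⁻¹ o⁻¹ J⁻¹ t3⁻¹ ((M+j:ℕ)-x) b)
      *(Rc q i (q^i) (q^b) (q^M) J o O*(Rc q j (q^j) (q^x) (q^(M+j)/q^b) O F L*Rc q b (q^b) (q^y) (q^(M+j)/q^x) L o J)) := by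
  unfold G
  rw [if_pos (by omega), hc4, ht4, show ((M+j:ℕ):ℤ)-j = M by omega, show (min (M:ℤ) ((M+j:ℕ)-x)).toNat = min M (M+j-x) by omega]
  apply sum_congr rfl
  intro a ha
  rw [mem_range] at ha
  have e (k : ℕ) : q^(M+j)/q^k = q^(((M+j:ℕ):ℤ)-k) := by rw [zpow_sub₀ hq, zpow_natCast, zpow_natCast]
  rw [pbr' hq s⁻¹ _ _ _ _ h1 h3 h2 M i a (by omega) (by omega) (zpow_natCast q M).symm, pbr' hq s⁻¹ _ _ _ _ h2 h4 h0 _ j x (by omega) (by omega) (e a),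
    pbr' hq s⁻¹ _ _ _ _ h0 h3 h1 _ a y (by omega) (by omega) (e x)]
  ring

theorem absum {x y : ℕ} (hxy : x+y ≤ M+j) {A B v w K h R R' T T' : ℕ → ℂ} {P Z : ℂ} {Q : ℕ → ℕ → ℂ}
   (S : ∀ {a b : ℕ}, a ≤ M → b ≤ M → a+y ≤ M+j → b+x ≤ M+j → P*B b*v a*K a = A a*w b*(Z*h b))
   (be : ∀ a ≤ M, ∑ b ∈ range (M+j+1), w b*Q a b*T' b = K a*T a) (hx : ∀ b ≤ M, ∑ a ∈ range (M+1), v a*R a*Q a b = Z*h b*R' b)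
   (k0 : K 0 ≠ 0) (z0 : Z ≠ 0) (v0 : v 0 = 1) (w0 : w 0 = 1) (hg0 : h 0 = 1) (wz : ∀ b, ¬ b ≤ min M (M+j-x) → w b = 0)
   (kz : ∀ a ≤ M, ¬ a ≤ min M (M+j-y) → K a = 0) :
   ∑ a ∈ range (min M (M+j-y)+1), A a*(R a*T a) = P*∑ b ∈ range (min M (M+j-x)+1), B b*(R' b*T' b) := by
  have hBb b (hb : b ≤ min M (M+j-x)) : P*B b = A 0/K 0*(w b*(Z*h b)) := by
    have := S (a := 0) (b := b) (by omega) (by omega) (by omega) (by omega)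
    rw [v0] at this
    field_simp; linear_combination this
  have hAa a (ha : a ≤ min M (M+j-y)) : A a = A 0/K 0*(v a*K a) := by
    have := S (a := a) (b := 0) (by omega) (by omega) (by omega) (by omega)
    have h2 := S (a := 0) (b := 0) (by omega) (by omega) (by omega) (by omega)
    rw [hg0, w0] at this h2
    rw [v0] at h2
    rw [div_mul_eq_mul_div, eq_div_iff k0]
    apply mul_right_cancel₀ z0
    linear_combination (-K 0)*this+v a*K a*h2
  trans ∑ a ∈ range (M+1), ∑ b ∈ range (M+j+1), A 0/K 0*(v a*w b*(R a*Q a b*T' b))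
  · trans ∑ a ∈ range (M+1), A 0/K 0*(v a*K a)*(R a*T a)
    · trans ∑ a ∈ range (min M (M+j-y)+1), A 0/K 0*(v a*K a)*(R a*T a)
      · apply sum_congr rfl
        intro a ha
        rw [mem_range] at ha
        rw [hAa a (by omega)]
      · apply sum_subset
        · intro a ha; rw [mem_range] at *; omega
        · intro a ha ha'
          rw [mem_range] at *
          rw [kz a (by omega) (by omega)]; ring
    · apply sum_congr rfl
      intro a ha
      rw [mem_range] at ha
      calc _ = A 0/K 0*v a*R a*(K a*T a) := by ring
        _ = _ := by
          rw [← be a (by omega), mul_sum]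
          exact sum_congr rfl fun b _ => by ring
  · rw [sum_comm, mul_sum]
    symm
    trans ∑ b ∈ range (min M (M+j-x)+1), ∑ a ∈ range (M+1), A 0/K 0*(v a*w b*(R a*Q a b*T' b))
    · apply sum_congr rfl
      intro b hb
      rw [mem_range] at hb
      calc _ = P*B b*(R' b*T' b) := by ring
        _ = A 0/K 0*w b*T' b*(Z*h b*R' b) := by rw [hBb b (by omega)]; ring
        _ = _ := by
          rw [← hx b (by omega), mul_sum]
          exact sum_congr rfl fun b _ => by ring
    · apply sum_subset
      · intro a ha; rw [mem_range] at *; omega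
      · intro a ha ha'
        rw [mem_range] at *
        rw [wz a (by omega)]; simp

theorem Ggen (g : Gn q L J O o F (M+j)) (hs : s^2 = q)
   (ht1 : t1^2 = J) (ht2 : t2^2 = O) (ht3 : t3^2 = o) (ht4 : t4^2 = F) (ht0 : t0 = (s^(2*((M+j:ℕ):ℤ)+3)*t1*t2*t3*t4)⁻¹)
   {i x y : ℕ} (hi : i ≤ M) (hxy : x+y ≤ M+j) :
   G q s J O o F t1 t2 t3 t4 (M+j:ℕ) i j x y =
   (t0/t1)^i*(t3/t1)^j*(t1/t0)^x*(t1/t4)^y*(xi q O o t2 t3 i*xi q L F t0 t4 j/(xi q O F t2 t4 x*xi q L o t0 t3 y))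
     *(om q (t0*t2*t4/t1) j/om q (t3*t0*t2/t1) i)*om q (s*t1*t2*t3) (M+j:ℕ)*
   G q⁻¹ s⁻¹ J⁻¹ o⁻¹ O⁻¹ L⁻¹ t1⁻¹ t3⁻¹ t2⁻¹ t0⁻¹ (M+j:ℕ) i j y x := by
  have ⟨hq, h0, h1, h2, h3, h4⟩ := g.nz
  have e3 : q^(2*((M+j:ℕ):ℤ)+3) = q^(2*(M+j)+3) := by
    rw [← zpow_natCast]; push_cast; rfl
  have ne {t c : ℂ} (h : t^2 = c) (hc : c ≠ 0) : t ≠ 0 := by rintro rfl; apply hc; rw [← h]; simp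
  have u := ne hs hq; have u1 := ne ht1 h1; have u2 := ne ht2 h2; have u3 := ne ht3 h3; have u4 := ne ht4 h4
  rw [Gexp hq (L := L) (by rw [e3]; refine inv_eq_of_mul_eq_one_left ?_; rw [← g.rel]; ring) ht0.symm hi hxy,
    Gexp' (t4 := t4) hq h0 h1 h2 h3 h4 (by
      simp only [inv_zpow, ← mul_inv, inv_inv]; rw [e3]; refine eq_inv_of_mul_eq_one_left ?_; rw [← g.rel]; ring) (by
      rw [ht0]; simp only [inv_zpow, ← mul_inv, inv_inv]
      have := zpow_ne_zero (2*((M+j:ℕ):ℤ)+3) u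
      field_simp) hi hxy]
  refine absum (v := hv q M J O o) (w := wt q (J*o) L O F (q^M) (q^(M+j)/q^x) (q^(M+j))) (K := fun a => KK q M j x a y L J O o F)
    (h := hg q o J) (Z := Z0 q M J O o*hg q o O i) (Q := fun a b => Rc q a (q^a) (q^b) (q^M) o J O) hxy ?_ ?_ ?_ (KK0_ne g x y (by omega)) (Z0_ne g i) ?_ ?_ ?_ ?_ ?_
  · intro a b ha hb hay hbx
    exact Sid g hs ht1 ht2 ht3 ht4 ht0 hi ha hb hay hbx
  · intro a ha
    have := BE M a ha j x y L J O o F g hxy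
    unfold BEp at this
    simpa only [mul_assoc] using this
  · intro b hb
    exact HEX M b hb i hi J O o g.g3
  · have := g.ne 0 1 1 0 0 1 (X := J*O*q)
    simp [hv, t55, poch_zero, Tq_zero, this]
  · have := g.ne 0 1 0 1 0 1 (X := J*o*q)
    simp [wt, pr, poch_zero, this]
  · simp [hg, poch_zero, Tq_zero]
  · intro b hb
    by_cases h : M < b
    · exact wt_zero hq M b h _ _ _ _ _ _
    · have : poch q (q^(M+j)/q^x)⁻¹ b = 0 := poch_eq_zero (l := M+j-x) (by omega) (by
        rw [div_eq_mul_inv, ← pow_sub₀ _ hq (by omega), inv_mul_cancel₀ (pow_ne_zero _ hq), sub_self])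
      unfold wt pr; rw [this]; simp
  · exact fun a ha ha' => KK_zero hq _ _ _ _ _ (by omega) _ _ _ _ _

end qR

namespace qR

open Complex

theorem fin_bad (d0 d1 d2 d3 d4 : ℤ) (σ τ1 τ2 τ3 τ4 : ℂ) (h : ¬ (d0 = 0 ∧ d1 = 0 ∧ d2 = 0 ∧ d3 = 0 ∧ d4 = 0)) :
    {r : ℝ | exp (d0*(σ+r)+d1*(τ1+(r:ℂ)^2)+d2*(τ2+(r:ℂ)^3)+d3*(τ3+(r:ℂ)^4)+d4*(τ4+(r:ℂ)^5)) = 1}.Finite := by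
  open Polynomial in
  let P : Polynomial ℝ := C (d0*σ.re+d1*τ1.re+d2*τ2.re+d3*τ3.re+d4*τ4.re)+C (d0:ℝ)*X^1+C (d1:ℝ)*X^2+C (d2:ℝ)*X^3+C (d3:ℝ)*X^4+C (d4:ℝ)*X^5
  have hP : P ≠ 0 := by
    intro hP
    apply h
    have c (n : ℕ) : P.coeff n = 0 := by rw [hP]; simp
    have := c 1; have := c 2; have := c 3; have := c 4; have := c 5
    simp only [P, Polynomial.coeff_add, Polynomial.coeff_C_mul, Polynomial.coeff_X_pow, Polynomial.coeff_C] at *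
    norm_num at *
    tauto
  refine (Polynomial.finite_setOf_isRoot hP).subset fun r hr => ?_
  have h1 := congrArg norm (Set.mem_setOf.1 hr)
  rw [norm_exp, norm_one, Real.exp_eq_one_iff] at h1
  simp only [← ofReal_pow, ← ofReal_intCast, add_re, re_ofReal_mul, ofReal_re] at h1
  simp only [Set.mem_setOf_eq, Polynomial.IsRoot.def, P]
  simp only [Polynomial.eval_add, Polynomial.eval_mul, Polynomial.eval_C, Polynomial.eval_pow, Polynomial.eval_X]
  linear_combination h1

theorem dense_gn (N : ℕ) (σ τ1 τ2 τ3 τ4 : ℂ) : Dense {r : ℝ | ∀ q L J O o F : ℂ, q = exp (σ+r)^2 → J = exp (τ1+(r:ℂ)^2)^2 →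
    O = exp (τ2+(r:ℂ)^3)^2 → o = exp (τ3+(r:ℂ)^4)^2 → F = exp (τ4+(r:ℂ)^5)^2 → L = (q^(2*(N:ℤ)+3)*J*O*o*F)⁻¹ → Gn q L J O o F N} := by
  have hc : (⋃ d ∈ {d : ℤ×ℤ×ℤ×ℤ×ℤ | ¬ (d.1 = 0 ∧ d.2.1 = 0 ∧ d.2.2.1 = 0 ∧ d.2.2.2.1 = 0 ∧ d.2.2.2.2 = 0)},
    {r : ℝ | exp (d.1*(σ+r)+d.2.1*(τ1+(r:ℂ)^2)+d.2.2.1*(τ2+(r:ℂ)^3)+d.2.2.2.1*(τ3+(r:ℂ)^4)+d.2.2.2.2*(τ4+(r:ℂ)^5)) = 1}).Countable :=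
    Set.Countable.biUnion (Set.to_countable _) fun d hd => (fin_bad _ _ _ _ _ σ τ1 τ2 τ3 τ4 hd).countable
  refine (hc.dense_compl ℝ).mono fun r hr => ?_
  intro q L J O o F hq h1 h2 h3 h4 h0
  simp only [Set.mem_compl_iff, Set.mem_iUnion, not_exists] at hr
  have nq : q ≠ 0 := by rw [hq]; simp
  have n1 : J ≠ 0 := by rw [h1]; simp
  have n2 : O ≠ 0 := by rw [h2]; simp
  have n3 : o ≠ 0 := by rw [h3]; simp
  have n4 : F ≠ 0 := by rw [h4]; simp
  have nN := zpow_ne_zero (2*(N:ℤ)+3) nq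
  have n0 : L ≠ 0 := by rw [h0]; exact inv_ne_zero (mul_ne_zero (mul_ne_zero (mul_ne_zero (mul_ne_zero nN n1) n2) n3) n4)
  refine ⟨nq, n0, n1, n2, n3, n4, ?_, ?_⟩
  · rw [h0, show q^(2*N+3) = q^(2*(N:ℤ)+3) by rw [← zpow_natCast]; push_cast; rfl]
    field_simp
  · intro e0 e1 e2 e3 e4 m h
    by_contra hh
    refine hr (2*(m-(2*N+3)*e0), 2*(e1-e0), 2*(e2-e0), 2*(e3-e0), 2*(e4-e0)) ?_ ?_
    · simp only [Set.mem_setOf_eq]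
      intro hd
      apply hh
      refine ⟨by omega, by omega, by omega, by omega, by linarith⟩
    · rw [Set.mem_setOf_eq, ← h, h0, h1, h2, h3, h4, hq]
      simp only [← exp_nat_mul, ← exp_int_mul, ← exp_add, ← exp_neg]
      congr 1
      push_cast
      ring

end qR

namespace qR

open Finset

def Gd (q J O o : ℂ) (N : ℕ) : Prop := ∀ m : ℤ, 1 ≤ m → m ≤ 2*N+5 →
  O*q^m ≠ 1 ∧ o*q^m ≠ 1 ∧ O*o*q^m ≠ 1 ∧ J*O*o*q^m ≠ 1

theorem pz {q a c : ℂ} (hq : q ≠ 0) (m : ℤ) {k : ℕ} (ha : a = c*q^m) (h : ∀ l : ℤ, m ≤ l → l < m+k → c*q^l ≠ 1) : poch q a k ≠ 0 :=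
  poch_ne fun l hl h' => h (m+l) (by omega) (by omega) (by
    rw [zpow_add₀ hq, zpow_natCast]; rw [ha] at h'; linear_combination -h')

variable {q s J O o F L t0 t1 t2 t3 t4 : ℝ → ℂ} {u : ℝ} {N : ℕ}

theorem poch_ca (k : ℕ) (hq : ContinuousAt q u) (h : ContinuousAt J u) : ContinuousAt (fun r => poch (q r) (J r) k) u := by
  unfold poch
  fun_prop

theorem p_ca (hq : ContinuousAt q u) (hs : ContinuousAt s u) (h1 : ContinuousAt J u) (h2 : ContinuousAt O u) (h3 : ContinuousAt o u) (h : ContinuousAt t2 u)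
    (nq : q u ≠ 0) (ns : s u ≠ 0) (nt : t2 u ≠ 0) (g : Gd (q u) (J u) (O u) (o u) N) (gq : ∀ k : ℕ, 1 ≤ k → k ≤ N → (q u)^k ≠ 1)
    (K n x : ℤ) (hK : K ≤ N) : ContinuousAt (fun r => p (q r) (s r) (J r) (O r) (o r) (t2 r) K n x) u := by
  unfold p
  by_cases hc : 0 ≤ n ∧ n ≤ K ∧ 0 ≤ x ∧ x ≤ K
  swap
  · simp only [if_neg hc]; exact continuousAt_const
  simp only [if_pos hc]
  have zq (m : ℤ) : ContinuousAt (fun r => q r^m) u := hq.zpow₀ m (Or.inl nq)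
  have gq' (k : ℤ) (h1 : 1 ≤ k) (h2 : k ≤ N) : (q u)^k ≠ 1 := by
    lift k to ℕ using by omega
    rw [zpow_natCast]; exact gq k (by omega) (by omega)
  have nqq (k : ℕ) (hk : (k:ℤ) ≤ K) : poch (q u) (q u) k ≠ 0 := pz (c := 1) nq 1 (by simp) fun l _ _ => by rw [one_mul]; exact gq' l (by omega) (by omega)
  have n2 (k : ℕ) (hk : (k:ℤ) ≤ K) : poch (q u) (q u*O u) k ≠ 0 := pz nq 1 (by rw [zpow_one, mul_comm]) fun l _ _ => (g l (by omega) (by omega)).1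
  have n3 (k : ℕ) (hk : (k:ℤ) ≤ K) : poch (q u) (q u*o u) k ≠ 0 := pz nq 1 (by rw [zpow_one, mul_comm]) fun l _ _ => (g l (by omega) (by omega)).2.1
  have n23 : poch (q u) (O u*o u*q u^(n+1)) (K+1).toNat ≠ 0 := pz nq _ rfl fun l _ _ => (g l (by omega) (by omega)).2.2.1
  have n123 (k : ℕ) (hk : (k:ℤ) ≤ n) : poch (q u) (J u*O u*o u*q u^(K+2)) k ≠ 0 := pz nq _ rfl fun l _ _ => (g l (by omega) (by omega)).2.2.2
  have nK (k : ℕ) (hk : (k:ℤ) ≤ n) : poch (q u) (q u^(-K)) k ≠ 0 := pz (c := 1) nq (-K) (by rw [one_mul]) fun l _ _ => by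
    rw [one_mul]; intro hl; apply gq' (-l) (by omega) (by omega); rw [zpow_neg, hl, inv_one]
  refine ContinuousAt.mul ?_ (tendsto_finsetSum _ fun k hk => ?_)
  · unfold Om binom
    simp only [if_pos (show 0 ≤ n ∧ n ≤ K from ⟨hc.1, hc.2.1⟩)]
    refine ContinuousAt.div ?_ ?_ ?_
    · refine ((((ContinuousAt.div ?_ ?_ ?_).mul ?_).mul ?_).mul ?_).mul ?_
      all_goals first | (refine mul_ne_zero (nqq _ (by omega)) (nqq _ (by omega))) | skip
      · exact poch_ca _ hq hq
      · exact (poch_ca _ hq hq).mul (poch_ca _ hq hq)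
      · exact continuousAt_const.sub ((h2.mul h3).mul (zq _))
      · exact poch_ca _ hq (hq.mul h2)
      · exact poch_ca _ hq (((h1.mul h2).mul h3).mul (zq _))
      · exact poch_ca _ hq (hq.mul h1)
    · exact (((hs.mul h).zpow₀ _ (Or.inl (mul_ne_zero ns nt))).mul (poch_ca _ hq ((h2.mul h3).mul (zq _)))).mul (poch_ca _ hq (hq.mul h3))
    · exact mul_ne_zero (mul_ne_zero (zpow_ne_zero _ (mul_ne_zero ns nt)) n23) (n3 _ (by omega))
  · rw [mem_range] at hk
    refine ContinuousAt.div ?_ ?_ ?_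
    · exact ((((poch_ca _ hq (zq _)).mul (poch_ca _ hq ((h2.mul h3).mul (zq _)))).mul (poch_ca _ hq (zq _))).mul (poch_ca _ hq ((h1.mul h2).mul (zq _)))).mul (hq.pow _)
    · exact (((poch_ca _ hq (hq.mul h2)).mul (poch_ca _ hq (((h1.mul h2).mul h3).mul (zq _)))).mul (poch_ca _ hq (zq _))).mul (poch_ca _ hq hq)
    · exact mul_ne_zero (mul_ne_zero (mul_ne_zero (n2 _ (by omega)) (n123 _ (by omega))) (nK _ (by omega))) (nqq _ (by omega))

theorem om_ca (hq : ContinuousAt q u) (hs : ContinuousAt s u) (nq : q u ≠ 0) (ns : s u ≠ 0) (n : ℤ) : ContinuousAt (fun r => om (q r) (s r) n) u :=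
  (continuousAt_const.mul (hs.zpow₀ _ (Or.inl ns))).mul (hq.zpow₀ _ (Or.inl nq))

theorem xi_ca (hq : ContinuousAt q u) (h1 : ContinuousAt J u) (h2 : ContinuousAt O u) (k1 : ContinuousAt t1 u) (k2 : ContinuousAt t2 u)
    (nq : q u ≠ 0) (n1 : t1 u ≠ 0) (n2 : t2 u ≠ 0) (g : ∀ m : ℤ, 1 ≤ m → m ≤ 2*N+5 → O u*q u^m ≠ 1) {n : ℕ} (hn : n ≤ N) :
    ContinuousAt (fun r => xi (q r) (J r) (O r) (t1 r) (t2 r) n) u :=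
  ((poch_ca _ hq (hq.mul h1)).div (poch_ca _ hq (hq.mul h2)) (pz nq 1 (by rw [zpow_one, mul_comm]; rfl) fun l _ _ => g l (by omega) (by omega))).mul
    ((k2.div k1 n1).zpow₀ _ (Or.inl (div_ne_zero n2 n1)))

theorem xi_ne {q J O t1 t2 : ℂ} (nq : q ≠ 0) (n1 : t1 ≠ 0) (n2 : t2 ≠ 0) (g : ∀ m : ℤ, 1 ≤ m → m ≤ 2*N+5 → J*q^m ≠ 1)
    (g2 : ∀ m : ℤ, 1 ≤ m → m ≤ 2*N+5 → O*q^m ≠ 1) {n : ℕ} (hn : n ≤ N) : xi q J O t1 t2 n ≠ 0 :=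
  mul_ne_zero (div_ne_zero (pz nq 1 (by rw [zpow_one, mul_comm]) fun l _ _ => g l (by omega) (by omega)) (pz nq 1 (by rw [zpow_one, mul_comm]) fun l _ _ => g2 l (by omega) (by omega)))
    (zpow_ne_zero _ (div_ne_zero n2 n1))

theorem G_ca (hq : ContinuousAt q u) (hs : ContinuousAt s u) (h1 : ContinuousAt J u) (h2 : ContinuousAt O u) (h3 : ContinuousAt o u) (h4 : ContinuousAt F u)
    (h0 : ContinuousAt L u) (k1 : ContinuousAt t1 u) (k2 : ContinuousAt t2 u) (k3 : ContinuousAt t3 u) (k4 : ContinuousAt t4 u) (k0 : ContinuousAt t0 u)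
    (nq : q u ≠ 0) (ns : s u ≠ 0) (n1 : t1 u ≠ 0) (n2 : t2 u ≠ 0) (n3 : t3 u ≠ 0) (n4 : t4 u ≠ 0) (n0 : t0 u ≠ 0)
    (hc0 : ∀ r, (q r^(2*(N:ℤ)+3)*J r*O r*o r*F r)⁻¹ = L r) (ht0 : ∀ r, (s r^(2*(N:ℤ)+3)*t1 r*t2 r*t3 r*t4 r)⁻¹ = t0 r)
    (g1 : Gd (q u) (J u) (O u) (o u) N) (g2 : Gd (q u) (o u) (L u) (F u) N) (g3 : Gd (q u) (F u) (O u) (J u) N)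
    (gq : ∀ k : ℕ, 1 ≤ k → k ≤ N → (q u)^k ≠ 1) (i j x y : ℕ) :
    ContinuousAt (fun r => G (q r) (s r) (J r) (O r) (o r) (F r) (t1 r) (t2 r) (t3 r) (t4 r) N i j x y) u := by
  unfold G
  split_ifs
  swap
  · exact continuousAt_const
  simp only [hc0, ht0]
  refine tendsto_finsetSum _ fun a ha => ?_
  exact (((om_ca hq (((k1.mul k2).mul k3).div k4 n4) nq (div_ne_zero (mul_ne_zero (mul_ne_zero n1 n2) n3) n4) _).mul
    (p_ca hq hs h1 h2 h3 k2 nq ns n2 g1 gq _ _ _ (by omega))).mul (p_ca hq hs h3 h0 h4 k0 nq ns n0 g2 gq _ _ _ (by omega))).mul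
    (p_ca hq hs h4 h2 h1 k2 nq ns n2 g3 gq _ _ _ (by omega))

end qR

set_option maxHeartbeats 1000000 in
/-- First symmetry relation of the Griffiths polynomials of q-Racah type
(exchange of the two variables). -/
theorem griffiths_symmetry_variables
    (N : ℕ) (q s c1 c2 c3 c4 c0 t1 t2 t3 t4 t0 : ℂ)
    (hq : q ≠ 0) (hc1 : c1 ≠ 0) (hc2 : c2 ≠ 0) (hc3 : c3 ≠ 0) (hc4 : c4 ≠ 0)
    (hs : s ^ 2 = q) (ht1 : t1 ^ 2 = c1) (ht2 : t2 ^ 2 = c2) (ht3 : t3 ^ 2 = c3)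
    (ht4 : t4 ^ 2 = c4)
    (hc0 : c0 = (q ^ (2 * (N : ℤ) + 3) * c1 * c2 * c3 * c4)⁻¹)
    (ht0 : t0 = (s ^ (2 * (N : ℤ) + 3) * t1 * t2 * t3 * t4)⁻¹)
    (hgen : ∀ e0 e1 e2 e3 e4 : ℕ, e0 ≤ 1 → e1 ≤ 1 → e2 ≤ 1 → e3 ≤ 1 → e4 ≤ 1 →
      1 ≤ e0 + e1 + e2 + e3 + e4 → e0 + e1 + e2 + e3 + e4 ≤ 4 →
      ∀ k : ℤ, 1 ≤ k → k ≤ 2 * (N : ℤ) + 5 →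
        c0 ^ e0 * c1 ^ e1 * c2 ^ e2 * c3 ^ e3 * c4 ^ e4 ≠ q ^ (-k))
    (hq1 : ∀ k : ℕ, 1 ≤ k → k ≤ N → q ^ k ≠ 1)
    (i j x y : ℕ) (hij : i + j ≤ N) (hxy : x + y ≤ N) :
    qR.G q s c1 c2 c3 c4 t1 t2 t3 t4 (N : ℤ) (i : ℤ) (j : ℤ) (x : ℤ) (y : ℤ)
      = (t0 / t1) ^ i * (t3 / t1) ^ j * (t1 / t0) ^ x * (t1 / t4) ^ y
          * (qR.xi q c2 c3 t2 t3 (i : ℤ) * qR.xi q c0 c4 t0 t4 (j : ℤ)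
              / (qR.xi q c2 c4 t2 t4 (x : ℤ) * qR.xi q c0 c3 t0 t3 (y : ℤ)))
          * (qR.om q (t0 * t2 * t4 / t1) (j : ℤ) / qR.om q (t3 * t0 * t2 / t1) (i : ℤ))
          * qR.om q (s * t1 * t2 * t3) (N : ℤ)
          * qR.G q⁻¹ s⁻¹ c1⁻¹ c3⁻¹ c2⁻¹ c0⁻¹ t1⁻¹ t3⁻¹ t2⁻¹ t0⁻¹
              (N : ℤ) (i : ℤ) (j : ℤ) (y : ℤ) (x : ℤ) := by
  obtain ⟨σ, es, -⟩ := qR.exp_sq hq hs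
  obtain ⟨τ1, e1, -⟩ := qR.exp_sq hc1 ht1
  obtain ⟨τ2, e2, -⟩ := qR.exp_sq hc2 ht2
  obtain ⟨τ3, e3, -⟩ := qR.exp_sq hc3 ht3
  obtain ⟨τ4, e4, -⟩ := qR.exp_sq hc4 ht4
  clear hc1 hc2 hc3 hc4
  have D := qR.dense_gn N σ τ1 τ2 τ3 τ4
  have pt (f : ℂ → ℂ) (hf : Continuous f) : ∃ F : ℝ → ℂ, (∀ r : ℝ, F r = Complex.exp (f r)) ∧ ContinuousAt F 0 :=
    ⟨fun r => Complex.exp (f r), fun _ => rfl, by fun_prop⟩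
  obtain ⟨S, fS, kS⟩ := pt (fun r => σ+r) (by fun_prop)
  obtain ⟨T1, f1, k1⟩ := pt (fun r => τ1+r^2) (by fun_prop)
  obtain ⟨T2, f2, k2⟩ := pt (fun r => τ2+r^3) (by fun_prop)
  obtain ⟨T3, f3, k3⟩ := pt (fun r => τ3+r^4) (by fun_prop)
  obtain ⟨T4, f4, k4⟩ := pt (fun r => τ4+r^5) (by fun_prop)
  simp only [← fS, ← f1, ← f2, ← f3, ← f4] at D
  have nS r : S r ≠ 0 := by simp [fS]
  have n1 r : T1 r ≠ 0 := by simp [f1]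
  have n2 r : T2 r ≠ 0 := by simp [f2]
  have n3 r : T3 r ≠ 0 := by simp [f3]
  have n4 r : T4 r ≠ 0 := by simp [f4]
  have sS : S 0 = s := by simp [fS, es]
  have s1 : T1 0 = t1 := by simp [f1, e1]
  have s2 : T2 0 = t2 := by simp [f2, e2]
  have s3 : T3 0 = t3 := by simp [f3, e3]
  have s4 : T4 0 = t4 := by simp [f4, e4]
  clear fS f1 f2 f3 f4 es e1 e2 e3 e4 pt
  have sq (T : ℝ → ℂ) (n : ∀ r, T r ≠ 0) (k : ContinuousAt T 0) : ∃ F : ℝ → ℂ, (∀ r, F r = T r^2) ∧ (∀ r, F r ≠ 0) ∧ ContinuousAt F 0 :=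
    ⟨_, fun _ => rfl, fun r => pow_ne_zero _ (n r), k.pow 2⟩
  obtain ⟨Q, hQ, mQ, lQ⟩ := sq S nS kS
  obtain ⟨C1, h1, m1, l1⟩ := sq T1 n1 k1
  obtain ⟨C2, h2, m2, l2⟩ := sq T2 n2 k2
  obtain ⟨C3, h3, m3, l3⟩ := sq T3 n3 k3
  obtain ⟨C4, h4, m4, l4⟩ := sq T4 n4 k4
  have zQ r := zpow_ne_zero (2*(N:ℤ)+3) (mQ r)
  have zS r := zpow_ne_zero (2*(N:ℤ)+3) (nS r)
  have pd (S T1 T2 T3 T4 : ℝ → ℂ) (nS : ∀ r, S r ≠ 0) (n1 : ∀ r, T1 r ≠ 0) (n2 : ∀ r, T2 r ≠ 0) (n3 : ∀ r, T3 r ≠ 0) (n4 : ∀ r, T4 r ≠ 0)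
      (kS : ContinuousAt S 0) (k1 : ContinuousAt T1 0) (k2 : ContinuousAt T2 0) (k3 : ContinuousAt T3 0) (k4 : ContinuousAt T4 0) :
      ∃ F : ℝ → ℂ, (∀ r, F r = (S r^(2*(N:ℤ)+3)*T1 r*T2 r*T3 r*T4 r)⁻¹) ∧ (∀ r, F r ≠ 0) ∧ ContinuousAt F 0 := by
    have z r : S r^(2*(N:ℤ)+3)*T1 r*T2 r*T3 r*T4 r ≠ 0 :=
      mul_ne_zero (mul_ne_zero (mul_ne_zero (mul_ne_zero (zpow_ne_zero _ (nS r)) (n1 r)) (n2 r)) (n3 r)) (n4 r)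
    exact ⟨_, fun _ => rfl, fun r => inv_ne_zero (z r), (((((kS.zpow₀ _ (Or.inl (nS 0))).mul k1).mul k2).mul k3).mul k4).inv₀ (z 0)⟩
  obtain ⟨C0, h0, m0, l0⟩ := pd Q C1 C2 C3 C4 mQ m1 m2 m3 m4 lQ l1 l2 l3 l4
  obtain ⟨T0, h0', n0, k0⟩ := pd S T1 T2 T3 T4 nS n1 n2 n3 n4 kS k1 k2 k3 k4
  obtain ⟨M, rfl⟩ : ∃ M, N = M+j := ⟨N-j, by omega⟩
  have key r (g : qR.Gn (Q r) (C0 r) (C1 r) (C2 r) (C3 r) (C4 r) (M+j)) :=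
    qR.Ggen g (hQ r).symm (h1 r).symm (h2 r).symm (h3 r).symm (h4 r).symm (h0' r) (i := i) (x := x) (y := y) (by omega) hxy
  obtain ⟨A, D, hA⟩ : ∃ A : Set ℝ, Dense A ∧ ∀ r ∈ A, qR.Gn (Q r) (C0 r) (C1 r) (C2 r) (C3 r) (C4 r) (M+j) :=
    ⟨_, D, fun r hr => by
      simp only [Set.mem_ofPred_eq] at hr; exact hr _ _ _ _ _ _ (hQ r) (h1 r) (h2 r) (h3 r) (h4 r) (h0 r)⟩
  have gen (e0 e1 e2 e3 e4 : ℕ) {X : ℂ} (m : ℤ) (h : 1 ≤ m) (h' : m ≤ 2*(M+j:ℕ)+5) (hX : C0 0^e0*C1 0^e1*C2 0^e2*C3 0^e3*C4 0^e4 = X := by ring)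
      (b : e0 ≤ 1 ∧ e1 ≤ 1 ∧ e2 ≤ 1 ∧ e3 ≤ 1 ∧ e4 ≤ 1 ∧ 1 ≤ e0+e1+e2+e3+e4 ∧ e0+e1+e2+e3+e4 ≤ 4 := by simp) : X*Q 0^m ≠ 1 := by
    intro hh
    obtain ⟨b0, b1, b2, b3, b4, b5, b6⟩ := b
    apply hgen e0 e1 e2 e3 e4 b0 b1 b2 b3 b4 b5 b6 m h h'
    rw [zpow_neg, ← hs, ← sS, ← hQ]
    refine eq_inv_of_mul_eq_one_left ?_
    rw [← hh, ← hX, h0, hQ, h1, h2, h3, h4, sS, s1, s2, s3, s4, hs, ht1, ht2, ht3, ht4, hc0]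
  have eQ : Q 0 = q := by rw [hQ, sS, hs]
  have gqq (k : ℕ) (h : 1 ≤ k) (h' : k ≤ M+j) : Q 0^k ≠ 1 := by rw [eQ]; exact hq1 k h h'
  have iv {X : ℂ} {m : ℤ} (h : X*Q 0^m ≠ 1) : X⁻¹*(Q 0)⁻¹^m ≠ 1 := by
    rw [inv_zpow, ← mul_inv]; intro h'; exact h (inv_eq_one.1 h')
  have u0 m a b := gen 1 0 0 0 0 m a b (X := C0 0)
  have u1 m a b := gen 0 1 0 0 0 m a b (X := C1 0)
  have u2 m a b := gen 0 0 1 0 0 m a b (X := C2 0)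
  have u3 m a b := gen 0 0 0 1 0 m a b (X := C3 0)
  have u4 m a b := gen 0 0 0 0 1 m a b (X := C4 0)
  have L := qR.G_ca lQ kS l1 l2 l3 l4 l0 k1 k2 k3 k4 k0 (mQ 0) (nS 0) (n1 0) (n2 0) (n3 0) (n4 0) (n0 0) (fun r => (h0 r).symm) (fun r => (h0' r).symm)
    (fun m a b => ⟨u2 m a b, u3 m a b, gen 0 0 1 1 0 m a b,
      gen 0 1 1 1 0 m a b⟩)
    (fun m a b => ⟨u0 m a b, u4 m a b, gen 1 0 0 0 1 m a b,
      gen 1 0 0 1 1 m a b⟩)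
    (fun m a b => ⟨u2 m a b, u1 m a b, gen 0 1 1 0 0 m a b,
      gen 0 1 1 0 1 m a b⟩) gqq i j x y
  have R := qR.G_ca (N := M+j) (lQ.inv₀ (mQ 0)) (kS.inv₀ (nS 0)) (l1.inv₀ (m1 0)) (l3.inv₀ (m3 0)) (l2.inv₀ (m2 0)) (l0.inv₀ (m0 0)) (l4.inv₀ (m4 0))
    (k1.inv₀ (n1 0)) (k3.inv₀ (n3 0)) (k2.inv₀ (n2 0)) (k0.inv₀ (n0 0)) (k4.inv₀ (n4 0))
    (inv_ne_zero (mQ 0)) (inv_ne_zero (nS 0)) (inv_ne_zero (n1 0)) (inv_ne_zero (n3 0)) (inv_ne_zero (n2 0)) (inv_ne_zero (n0 0)) (inv_ne_zero (n4 0))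
    (fun r => by
      have := zQ r; have := m1 r; have := m2 r; have := m3 r; have := m4 r
      simp only [Pi.inv_apply]
      rw [h0, inv_zpow]; field_simp)
    (fun r => by
      have := zS r; have := n1 r; have := n2 r; have := n3 r; have := n4 r
      simp only [Pi.inv_apply]
      rw [h0', inv_zpow]; field_simp)
    (fun m a b => ⟨iv (u3 m a b), iv (u2 m a b), by
      simp only [Pi.inv_apply, ← mul_inv]
      exact ⟨iv (gen 0 0 1 1 0 m a b),
        iv (gen 0 1 1 1 0 m a b)⟩⟩)
    (fun m a b => ⟨iv (u4 m a b), iv (u0 m a b), by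
      simp only [Pi.inv_apply, ← mul_inv]
      exact ⟨iv (gen 1 0 0 0 1 m a b),
        iv (gen 1 0 1 0 1 m a b)⟩⟩)
    (fun m a b => ⟨iv (u3 m a b), iv (u1 m a b), by
      simp only [Pi.inv_apply, ← mul_inv]
      exact ⟨iv (gen 0 1 0 1 0 m a b),
        iv (gen 1 1 0 1 0 m a b)⟩⟩)
    (fun k a b => by
      simp only [Pi.inv_apply]
      rw [inv_pow]; exact fun h => gqq k a b (inv_eq_one.1 h)) i j y x
  have W := ((((((k0.div k1 (n1 0)).pow i).mul ((k3.div k1 (n1 0)).pow j)).mul ((k1.div k0 (n0 0)).pow x)).mul ((k1.div k4 (n4 0)).pow y)).mul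
    (((qR.xi_ca (N := M+j) lQ l2 l3 k2 k3 (mQ 0) (n2 0) (n3 0) u3 (n := i) (by omega)).mul (qR.xi_ca (N := M+j) lQ l0 l4 k0 k4 (mQ 0) (n0 0) (n4 0) u4 (n := j) (by omega))).div
      ((qR.xi_ca (N := M+j) lQ l2 l4 k2 k4 (mQ 0) (n2 0) (n4 0) u4 (n := x) (by omega)).mul (qR.xi_ca (N := M+j) lQ l0 l3 k0 k3 (mQ 0) (n0 0) (n3 0) u3 (n := y) (by omega)))
      (mul_ne_zero (qR.xi_ne (N := M+j) (mQ 0) (n2 0) (n4 0) u2 u4 (by omega)) (qR.xi_ne (N := M+j) (mQ 0) (n0 0) (n3 0) u0 u3 (by omega))))).mul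
    ((qR.om_ca lQ (((k0.mul k2).mul k4).div k1 (n1 0)) (mQ 0) (div_ne_zero (mul_ne_zero (mul_ne_zero (n0 0) (n2 0)) (n4 0)) (n1 0)) j).div
      (qR.om_ca lQ (((k3.mul k0).mul k2).div k1 (n1 0)) (mQ 0) (div_ne_zero (mul_ne_zero (mul_ne_zero (n3 0) (n0 0)) (n2 0)) (n1 0)) i)
      (mul_ne_zero (mul_ne_zero (zpow_ne_zero _ (by norm_num)) (zpow_ne_zero _ (div_ne_zero (mul_ne_zero (mul_ne_zero (n3 0) (n0 0)) (n2 0)) (n1 0)))) (zpow_ne_zero _ (mQ 0))))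
  have W' := (W.mul (qR.om_ca lQ (((kS.mul k1).mul k2).mul k3) (mQ 0) (mul_ne_zero (mul_ne_zero (mul_ne_zero (nS 0) (n1 0)) (n2 0)) (n3 0)) (M+j:ℕ))).mul R
  have := mem_closure_iff_nhdsWithin_neBot.1 (D 0)
  have E := tendsto_nhds_unique_of_eventuallyEq (L.mono_left nhdsWithin_le_nhds) (W'.mono_left nhdsWithin_le_nhds)
    (Filter.eventually_of_mem self_mem_nhdsWithin fun r hr => key r (hA r hr))
  have e1 : C1 0 = c1 := by rw [h1, s1, ht1]
  have e2 : C2 0 = c2 := by rw [h2, s2, ht2]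
  have e3 : C3 0 = c3 := by rw [h3, s3, ht3]
  have e4 : C4 0 = c4 := by rw [h4, s4, ht4]
  have e0 : C0 0 = c0 := by rw [h0, eQ, e1, e2, e3, e4, hc0]
  have s0 : T0 0 = t0 := by rw [h0', sS, s1, s2, s3, s4, ht0]
  simp only [Pi.mul_apply, Pi.div_apply, Pi.pow_apply, Pi.inv_apply, eQ, e1, e2, e3, e4, e0, sS, s1, s2, s3, s4, s0] at E
  exact E
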